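/- The fourth homotopy group π₄(S²×S², (p,p)) of the product of two 2-spheres is isomorphic, as a group, to ZMod 2 × ZMod 2. -/

import Mathlib

open Topology

/-- The 2-sphere as the unit sphere in `EuclideanSpace ℝ (Fin 3)`. -/
abbrev Sph : Type := Metric.sphere (0 : EuclideanSpace ℝ (Fin 3)) 1

/-- `X = S² × S²`. -/
abbrev Xt : Type := Sph × Sph

open scoped unitInterval Topology.Homotopy

set_option linter.unusedSectionVars false

section LoopMaps

variable {N M X Y Z : Type*} [TopologicalSpace X] [TopologicalSpace Y] [TopologicalSpace Z]
  {x : X} {y : Y} {z : Z}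

/-- A family of maps that is stationary on the boundary of the cube gives a homotopy of
generalized loops. -/
theorem GenLoop.homotopic_mk {f g : Ω^ N X x} (H : I → (N → I) → X)
    (hH : Continuous fun q : I × (N → I) => H q.1 q.2) (h0 : ∀ a, H 0 a = f a)
    (h1 : ∀ a, H 1 a = g a) (hb : ∀ t, ∀ a ∈ Cube.boundary N, H t a = x) :
    GenLoop.Homotopic f g :=
  ⟨{ toFun := fun q => H q.1 q.2
     continuous_toFun := hH
     map_zero_left := h0
     map_one_left := h1
     prop' := fun t a ha => (hb t a ha).trans (f.2 a ha).symm }⟩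

theorem GenLoop.Homotopic.exists_homotopy {f g : Ω^ N X x} (h : GenLoop.Homotopic f g) :
    ∃ H : I → (N → I) → X, (Continuous fun q : I × (N → I) => H q.1 q.2) ∧
      (∀ a, H 0 a = f a) ∧ (∀ a, H 1 a = g a) ∧ ∀ t, ∀ a ∈ Cube.boundary N, H t a = x := by
  obtain ⟨F⟩ := h
  exact ⟨fun t a => F (t, a), F.continuous, F.apply_zero, F.apply_one,
    fun t a ha => (F.prop' t a ha).trans (f.2 a ha)⟩

theorem GenLoop.transAt_apply [DecidableEq N] (i : N) (f g : Ω^ N X x) (t : N → I) :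
    GenLoop.transAt i f g t = if (t i : ℝ) ≤ 1 / 2
      then f (Function.update t i <| Set.projIcc 0 1 zero_le_one (2 * t i))
      else g (Function.update t i <| Set.projIcc 0 1 zero_le_one (2 * t i - 1)) := rfl

theorem GenLoop.symmAt_apply [DecidableEq N] (i : N) (f : Ω^ N X x) (t : N → I) :
    GenLoop.symmAt i f t = f fun j ↦ if j = i then σ (t i) else t j := rfl

theorem GenLoop.continuous (f : Ω^ N X x) : Continuous f := f.1.2

/-- The generalized loop obtained by composing with a based map. -/
def GenLoop.map (f : C(X, Y)) (h : f x = y) (g : Ω^ N X x) : Ω^ N Y y :=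
  ⟨f.comp g.1, fun a ha => (congrArg f (g.2 a ha)).trans h⟩

theorem GenLoop.map_apply (f : C(X, Y)) (h : f x = y) (g : Ω^ N X x) (a : N → I) :
    GenLoop.map f h g a = f (g a) := rfl

namespace HomotopyGroup

/-- The class of a generalized loop. -/
def cls (f : Ω^ N X x) : HomotopyGroup N X x := Quotient.mk _ f

theorem cls_eq_iff {f g : Ω^ N X x} : cls f = cls g ↔ GenLoop.Homotopic f g := Quotient.eq

theorem cls_surj (a : HomotopyGroup N X x) : ∃ f : Ω^ N X x, cls f = a := Quotient.exists_rep a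

variable [DecidableEq N] [DecidableEq M] [Nonempty N] [Nonempty M]

theorem cls_transAt (i : N) (f g : Ω^ N X x) : cls (GenLoop.transAt i f g) = cls g * cls f :=
  (HomotopyGroup.mul_spec (i := i)).symm

theorem cls_symmAt (i : N) (f : Ω^ N X x) : cls (GenLoop.symmAt i f) = (cls f)⁻¹ :=
  (HomotopyGroup.inv_spec (i := i)).symm

theorem cls_const : cls (GenLoop.const : Ω^ N X x) = 1 :=
  HomotopyGroup.one_def.symm

theorem cls_eq_one_iff {f : Ω^ N X x} : cls f = 1 ↔ GenLoop.Homotopic f GenLoop.const := by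
  rw [← cls_const, cls_eq_iff]

/-- A homotopy-invariant operation on generalized loops which is compatible with concatenation
induces a homomorphism. -/
noncomputable def homOfLoops (Φ : Ω^ N X x → Ω^ M Y y)
    (hΦ : ∀ f g, GenLoop.Homotopic f g → GenLoop.Homotopic (Φ f) (Φ g)) (i : N) (j : M)
    (ht : ∀ f g, Φ (GenLoop.transAt i f g) = GenLoop.transAt j (Φ f) (Φ g)) :
    HomotopyGroup N X x →* HomotopyGroup M Y y :=
  MonoidHom.mk' (Quotient.map Φ hΦ) (by
    intro a b
    obtain ⟨f, rfl⟩ := cls_surj a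
    obtain ⟨g, rfl⟩ := cls_surj b
    rw [← cls_transAt i]
    change cls (Φ _) = cls (Φ f) * cls (Φ g)
    rw [ht, cls_transAt])

/-- The homomorphism induced by a based map. -/
noncomputable def map (f : C(X, Y)) (h : f x = y) : HomotopyGroup N X x →* HomotopyGroup N Y y :=
  homOfLoops (GenLoop.map f h) (by
    intro a b hab
    obtain ⟨H, hH, h0, h1, hb⟩ := hab.exists_homotopy
    refine GenLoop.homotopic_mk (fun t a => f (H t a)) (f.continuous.comp hH) ?_ ?_ ?_
    · intro a; rw [h0]; rfl
    · intro a; rw [h1]; rfl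
    · intro t a ha; rw [hb t a ha, h]) (Classical.arbitrary N) (Classical.arbitrary N) (by
    intro a b
    ext t
    simp only [GenLoop.map_apply, GenLoop.transAt_apply]
    split_ifs <;> rfl)

theorem map_cls (f : C(X, Y)) (h : f x = y) (g : Ω^ N X x) :
    map f h (cls g) = cls (GenLoop.map f h g) := rfl

theorem map_map (f : C(X, Y)) (h : f x = y) (g : C(Y, Z)) (h' : g y = z)
    (a : HomotopyGroup N X x) :
    map g h' (map f h a) = map (g.comp f) (by simp [h, h']) a := by
  obtain ⟨a, rfl⟩ := cls_surj a
  rfl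

/-- Based homotopic maps induce the same homomorphism. -/
theorem map_eq_map (f g : C(X, Y)) (hf : f x = y) (hg : g x = y) (H : I → X → Y)
    (hH : Continuous fun q : I × X => H q.1 q.2) (h0 : ∀ a, H 0 a = f a) (h1 : ∀ a, H 1 a = g a)
    (hb : ∀ t, H t x = y) (a : HomotopyGroup N X x) : map f hf a = map g hg a := by
  obtain ⟨a, rfl⟩ := cls_surj a
  rw [map_cls, map_cls, cls_eq_iff]
  refine GenLoop.homotopic_mk (fun t q => H t (a q)) ?_ ?_ ?_ ?_
  · exact hH.comp (continuous_fst.prodMk ((GenLoop.continuous a).comp continuous_snd))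
  · intro q; exact h0 _
  · intro q; exact h1 _
  · intro t q hq; rw [GenLoop.boundary a q hq, hb]

theorem map_id (f : C(X, X)) (h : f x = x) (hf : ∀ a, f a = a) (a : HomotopyGroup N X x) :
    map f h a = a := by
  obtain ⟨a, rfl⟩ := cls_surj a
  rw [map_cls]
  congr 1
  ext t
  exact hf _

/-- Mutually inverse based homotopy equivalences induce an isomorphism. -/
noncomputable def equivOfInverse (f : C(X, Y)) (h : f x = y) (g : C(Y, X)) (h' : g y = x)
    (hgf : ∀ a : HomotopyGroup N X x, map (g.comp f) (by simp [h, h']) a = a)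
    (hfg : ∀ a : HomotopyGroup N Y y, map (f.comp g) (by simp [h, h']) a = a) :
    HomotopyGroup N X x ≃* HomotopyGroup N Y y :=
  { map f h with
    invFun := map g h'
    left_inv := fun a => (map_map _ _ _ _ a).trans (hgf a)
    right_inv := fun a => (map_map _ _ _ _ a).trans (hfg a) }

/-- A homeomorphism induces an isomorphism. -/
noncomputable def equivOfHomeomorph (e : X ≃ₜ Y) (h : e x = y) :
    HomotopyGroup N X x ≃* HomotopyGroup N Y y :=
  equivOfInverse (e : C(X, Y)) h (e.symm : C(Y, X)) (by simp [← h])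
    (map_id _ _ (by simp)) (map_id _ _ (by simp))

/-- The homotopy groups of a product. -/
noncomputable def prodEquiv :
    HomotopyGroup N (X × Y) (x, y) ≃* HomotopyGroup N X x × HomotopyGroup N Y y :=
  MulEquiv.ofBijective
    ((map (N := N) (x := (x, y)) (y := x) ContinuousMap.fst rfl).prod
      (map (x := (x, y)) (y := y) ContinuousMap.snd rfl)) (by
    constructor
    · intro a b hab
      obtain ⟨a, rfl⟩ := cls_surj a
      obtain ⟨b, rfl⟩ := cls_surj b
      have h1 := cls_eq_iff.1 (congrArg Prod.fst hab)
      have h2 := cls_eq_iff.1 (congrArg Prod.snd hab)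
      obtain ⟨H, hH, h0, h1, hb⟩ := h1.exists_homotopy
      obtain ⟨K, hK, k0, k1, kb⟩ := h2.exists_homotopy
      rw [cls_eq_iff]
      refine GenLoop.homotopic_mk (fun t a => (H t a, K t a)) (hH.prodMk hK) ?_ ?_ ?_
      · intro t; exact Prod.ext (h0 t) (k0 t)
      · intro t; exact Prod.ext (h1 t) (k1 t)
      · intro s t ht; exact Prod.ext (hb s t ht) (kb s t ht)
    · rintro ⟨a, b⟩
      obtain ⟨a, rfl⟩ := cls_surj a
      obtain ⟨b, rfl⟩ := cls_surj b
      exact ⟨cls ⟨a.1.prodMk b.1, fun t ht => Prod.ext (a.2 t ht) (b.2 t ht)⟩, rfl⟩)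

/-- Reindexing the coordinates of the cube. -/
noncomputable def reindex (e : M ≃ N) : HomotopyGroup N X x →* HomotopyGroup M X x :=
  homOfLoops (fun f => GenLoop.congr x e.symm f) (by
    intro f g h
    obtain ⟨H, hH, h0, h1, hb⟩ := h.exists_homotopy
    refine GenLoop.homotopic_mk (fun t a => H t (fun n => a (e.symm n))) ?_ ?_ ?_ ?_
    · exact hH.comp (by fun_prop : Continuous fun q : I × (M → I) =>
        (q.1, fun n => q.2 (e.symm n)))
    · intro a; exact h0 _
    · intro a; exact h1 _
    · rintro t a ⟨i, hi⟩
      exact hb _ _ ⟨e i, by simpa using hi⟩)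
    (Classical.arbitrary N) (e.symm (Classical.arbitrary N)) (by
    intro f g
    ext t
    change GenLoop.transAt _ f g (fun n => t (e.symm n)) = _
    rw [GenLoop.transAt_apply, GenLoop.transAt_apply]
    have key : ∀ (h : Ω^ N X x) v, h (Function.update (fun n => t (e.symm n))
        (Classical.arbitrary N) v) = (GenLoop.congr x e.symm h)
          (Function.update t (e.symm (Classical.arbitrary N)) v) := by
      intro h v
      change h _ = h _
      congr 1
      ext n
      by_cases hn : n = Classical.arbitrary N
      · subst hn; simp
      · have : e.symm n ≠ e.symm (Classical.arbitrary N) := by simpa using hn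
        simp [Function.update_of_ne hn, Function.update_of_ne this]
    rw [key, key])

theorem reindex_cls (e : M ≃ N) (f : Ω^ N X x) (g : Ω^ M X x)
    (h : ∀ a, g a = f (fun n => a (e.symm n))) : reindex e (cls f) = cls g := by
  change cls _ = _
  congr 1
  ext a
  exact (h a).symm

end HomotopyGroup

end LoopMaps

/-- The complement of the origin. -/
abbrev Punct (V : Type*) [Zero V] := {v : V // v ≠ 0}

section Punct

variable {N : Type*} [DecidableEq N] [Nonempty N]
  {V W : Type*} [NormedAddCommGroup V] [NormedSpace ℝ V]
  [NormedAddCommGroup W] [NormedSpace ℝ W]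

/-- A linear equivalence restricts to the complements of the origin. -/
def Punct.homeo (A : V ≃L[ℝ] W) : Punct V ≃ₜ Punct W :=
  A.toHomeomorph.subtype (fun v => by simp)

theorem Punct.nonempty_mulEquiv [FiniteDimensional ℝ V] [FiniteDimensional ℝ W]
    (h : Module.finrank ℝ V = Module.finrank ℝ W) (v : Punct V) (w : Punct W) :
    Nonempty (HomotopyGroup N (Punct V) v ≃* HomotopyGroup N (Punct W) w) := by
  obtain ⟨A⟩ := FiniteDimensional.nonempty_continuousLinearEquiv_of_finrank_eq (𝕜 := ℝ) h
  obtain ⟨B, hB⟩ := SeparatingDual.exists_continuousLinearEquiv_apply_eq (R := ℝ)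
    (x := A v) (y := w) (by simpa using v.2) w.2
  exact ⟨HomotopyGroup.equivOfHomeomorph (Punct.homeo (A.trans B)) (Subtype.ext hB)⟩

theorem Punct.nonempty_mulEquiv_sphere (p : Metric.sphere (0 : V) 1) (v : Punct V)
    (hv : (v : V) = p) :
    Nonempty (HomotopyGroup N (Metric.sphere (0 : V) 1) p ≃* HomotopyGroup N (Punct V) v) := by
  let f : C(Metric.sphere (0 : V) 1, Punct V) := ⟨fun q => ⟨q, by
    intro h
    have := q.2
    simp [h] at this⟩, by fun_prop⟩
  have hc : Continuous fun q : Punct V => ‖(q : V)‖⁻¹ • (q : V) :=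
    (continuous_subtype_val.norm.inv₀ (fun q => by simpa using q.2)).smul continuous_subtype_val
  have hs (q : Punct V) : ‖(q : V)‖⁻¹ • (q : V) ∈ Metric.sphere (0 : V) 1 := by
    have : ‖(q : V)‖ ≠ 0 := by simpa using q.2
    simp [norm_smul, this]
  let g : C(Punct V, Metric.sphere (0 : V) 1) := ⟨fun q => ⟨‖(q : V)‖⁻¹ • (q : V), hs q⟩,
    hc.subtype_mk hs⟩
  have hp : ‖(p : V)‖ = 1 := by simp
  have hg : g v = p := Subtype.ext (by simp [g, hv, hp])
  have hf : f p = v := Subtype.ext (by simp [f, hv])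
  refine ⟨HomotopyGroup.equivOfInverse f hf g hg ?_ ?_⟩
  · apply HomotopyGroup.map_id
    intro a
    have : ‖(a : V)‖ = 1 := by simp
    exact Subtype.ext (by simp [g, f, this])
  · intro a
    refine (HomotopyGroup.map_eq_map (x := v) (y := v) (f.comp g) (ContinuousMap.id _)
      (by simp [hf, hg]) rfl (fun t q => ⟨((1 - (t : ℝ)) * ‖(q : V)‖⁻¹ + t) • (q : V), ?_⟩)
      ?_ ?_ ?_ ?_ a).trans (HomotopyGroup.map_id _ _ (fun _ => rfl) a)
    · have h0 : 0 < ‖(q : V)‖⁻¹ := by simpa using q.2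
      refine smul_ne_zero ?_ q.2
      have h1 := t.2.1
      have h2 := t.2.2
      rcases h1.eq_or_lt with h | h
      · rw [← h]; simp [q.2]
      · have := mul_nonneg (sub_nonneg.2 h2) h0.le
        positivity
    · refine Continuous.subtype_mk ?_ _
      have : Continuous fun q : I × Punct V => ‖(q.2 : V)‖⁻¹ :=
        (continuous_subtype_val.comp continuous_snd).norm.inv₀ (fun q => by simpa using q.2.2)
      fun_prop
    · intro a; exact Subtype.ext (by simp [f, g])
    · intro a; exact Subtype.ext (by simp)
    · intro t; exact Subtype.ext (by simp [hv, hp])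

theorem OnePoint.nonempty_mulEquiv_punct [FiniteDimensional ℝ V] [FiniteDimensional ℝ W]
    (h : Module.finrank ℝ V + 1 = Module.finrank ℝ W) (w : Punct W) :
    Nonempty (HomotopyGroup N (OnePoint V) OnePoint.infty ≃* HomotopyGroup N (Punct W) w) := by
  let e := onePointEquivSphereOfFinrankEq (ι := Fin (Module.finrank ℝ W)) (V := V) (by simpa)
  have hp : ‖(e OnePoint.infty : EuclideanSpace ℝ (Fin (Module.finrank ℝ W)))‖ = 1 := by
    simp
  let v : Punct (EuclideanSpace ℝ (Fin (Module.finrank ℝ W))) := ⟨e OnePoint.infty, by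
    intro h; simp [h] at hp⟩
  obtain ⟨E⟩ := Punct.nonempty_mulEquiv_sphere (N := N) (e OnePoint.infty) v rfl
  obtain ⟨E'⟩ := Punct.nonempty_mulEquiv (N := N) (by simp) v w
  exact ⟨((HomotopyGroup.equivOfHomeomorph e rfl).trans E).trans E'⟩

end Punct

theorem Cube.mem_boundary_succ {n : ℕ} {y : Fin (n + 1) → I} :
    y ∈ Cube.boundary (Fin (n + 1)) ↔ (y 0 = 0 ∨ y 0 = 1) ∨ Fin.tail y ∈ Cube.boundary (Fin n) := by
  constructor
  · rintro ⟨i, hi⟩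
    refine Fin.cases (fun h => Or.inl h) (fun j h => Or.inr ⟨j, h⟩) i hi
  · rintro (h | ⟨j, hj⟩)
    · exact ⟨0, h⟩
    · exact ⟨j.succ, hj⟩

theorem continuous_finTail {n : ℕ} {X : Type*} [TopologicalSpace X] :
    Continuous fun y : Fin (n + 1) → X => Fin.tail y :=
  continuous_pi fun i => continuous_apply i.succ


section Suspension

variable {V : Type*} [NormedAddCommGroup V] [NormedSpace ℝ V]

/-- A positive function on the complement of the ray `{(a, 0) | a ≤ 0}` which, together with the
`V`-coordinate, identifies that complement with the convex set `(0, ∞) × V`. -/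
noncomputable def height (y : ℝ × V) : ℝ := y.1 + √(y.1 ^ 2 + ‖y.2‖ ^ 2)

/-- Straight-line interpolation in the coordinates given by `height` and the projection to `V`. -/
noncomputable def mixUp (w v : ℝ × V) (r : ℝ) : ℝ × V :=
  ((((1 - r) * height w + r * height v) ^ 2 - ‖(1 - r) • w.2 + r • v.2‖ ^ 2) /
    (2 * ((1 - r) * height w + r * height v)), (1 - r) • w.2 + r • v.2)

/-- The reflection in `V`. -/
def reflR (y : ℝ × V) : ℝ × V := (-y.1, y.2)

/-- The reflection of `mixUp`. -/
noncomputable def mixDown (w v : ℝ × V) (r : ℝ) : ℝ × V :=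
  reflR (mixUp (reflR w) (reflR v) r)

/-- The complement of the closed ray `{(a, 0) | a ≤ 0}`. -/
def UpSet (y : ℝ × V) : Prop := y.2 ≠ 0 ∨ 0 < y.1

theorem reflR_reflR (y : ℝ × V) : reflR (reflR y) = y := by simp [reflR]

theorem continuous_reflR : Continuous (reflR : ℝ × V → ℝ × V) := by unfold reflR; fun_prop

theorem reflR_ne_zero {y : ℝ × V} (h : y ≠ 0) : reflR y ≠ 0 := by
  intro h'
  apply h
  rw [← reflR_reflR y, h']
  simp [reflR]

theorem UpSet.ne_zero {y : ℝ × V} (h : UpSet y) : y ≠ 0 := by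
  rintro rfl
  simp [UpSet] at h

theorem upSet_or {y : ℝ × V} (h : y ≠ 0) (h' : ¬ (y.2 = 0 ∧ y.1 < 0)) : UpSet y := by
  by_cases h2 : y.2 = 0
  · right
    have : ¬ y.1 < 0 := fun h3 => h' ⟨h2, h3⟩
    have h4 : y.1 ≠ 0 := fun h4 => h (Prod.ext h4 h2)
    exact lt_of_le_of_ne (not_lt.1 this) h4.symm
  · exact Or.inl h2

theorem isOpen_upSet : IsOpen {y : ℝ × V | UpSet y} :=
  (isOpen_ne_fun continuous_snd continuous_const).union
    (isOpen_lt continuous_const continuous_fst)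

theorem continuous_height : Continuous (height : ℝ × V → ℝ) := by unfold height; fun_prop

theorem height_pos {y : ℝ × V} (h : UpSet y) : 0 < height y := by
  unfold height
  rcases h with h | h
  · have h1 : 0 < ‖y.2‖ := norm_pos_iff.2 h
    have : |y.1| < √(y.1 ^ 2 + ‖y.2‖ ^ 2) := by
      rw [← Real.sqrt_sq_eq_abs]
      exact Real.sqrt_lt_sqrt (sq_nonneg _) (by nlinarith)
    linarith [neg_abs_le y.1]
  · positivity

theorem lerp_height_pos {w w' : ℝ × V} (h : UpSet w) (h' : UpSet w') {r : ℝ} (h0 : 0 ≤ r)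
    (h1 : r ≤ 1) : 0 < (1 - r) * height w + r * height w' := by
  have := height_pos h
  have := height_pos h'
  rcases h0.eq_or_lt with rfl | h0
  · simpa
  · have := mul_nonneg (sub_nonneg.2 h1) (height_pos h).le
    positivity

theorem upSet_mixUp {w w' : ℝ × V} (h : UpSet w) (h' : UpSet w') {r : ℝ} (h0 : 0 ≤ r)
    (h1 : r ≤ 1) : UpSet (mixUp w w' r) := by
  have hp := lerp_height_pos h h' h0 h1
  by_cases hv : (1 - r) • w.2 + r • w'.2 = 0
  · right
    simp only [mixUp, hv, norm_zero]
    have := hp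
    rw [zero_pow two_ne_zero, sub_zero]
    exact div_pos (pow_pos hp 2) (by linarith)
  · exact Or.inl hv

theorem mixUp_eq_of_height {y w w' : ℝ × V} {r : ℝ} (h : UpSet y)
    (h1 : (1 - r) * height w + r * height w' = height y) (h2 : (1 - r) • w.2 + r • w'.2 = y.2) :
    mixUp w w' r = y := by
  unfold mixUp
  rw [h1, h2]
  refine Prod.ext ?_ rfl
  have hp := (height_pos h).ne'
  rw [div_eq_iff (by positivity)]
  unfold height
  have := Real.sq_sqrt (show 0 ≤ y.1 ^ 2 + ‖y.2‖ ^ 2 by positivity)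
  linear_combination this

theorem mixUp_zero {w w' : ℝ × V} (h : UpSet w) : mixUp w w' 0 = w :=
  mixUp_eq_of_height h (by ring) (by simp)

theorem mixUp_one {w w' : ℝ × V} (h : UpSet w') : mixUp w w' 1 = w' :=
  mixUp_eq_of_height h (by ring) (by simp)

theorem mixUp_self {w : ℝ × V} (h : UpSet w) (r : ℝ) : mixUp w w r = w :=
  mixUp_eq_of_height h (by ring) (by simp [← add_smul])

theorem ContinuousOn.mixUp {Z : Type*} [TopologicalSpace Z] {s : Set Z}
    {a b : Z → ℝ × V} {r : Z → ℝ}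
    (ha : ContinuousOn a s) (hb : ContinuousOn b s) (hr : ContinuousOn r s)
    (ha' : ∀ z ∈ s, UpSet (a z)) (hb' : ∀ z ∈ s, UpSet (b z))
    (h0 : ∀ z ∈ s, 0 ≤ r z) (h1 : ∀ z ∈ s, r z ≤ 1) :
    ContinuousOn (fun z => mixUp (a z) (b z) (r z)) s := by
  unfold _root_.mixUp
  have ha2 := continuous_height.comp_continuousOn ha
  have hb2 := continuous_height.comp_continuousOn hb
  have h2 : ContinuousOn (fun z => (1 - r z) * height (a z) + r z * height (b z)) s :=
    ((continuousOn_const.sub hr).mul ha2).add (hr.mul hb2)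
  have h3 : ContinuousOn (fun z => (1 - r z) • (a z).2 + r z • (b z).2) s := by fun_prop
  refine ContinuousOn.prodMk (ContinuousOn.div ((h2.pow 2).sub (h3.norm.pow 2))
    (continuousOn_const.mul h2) ?_) h3
  intro z hz
  have := lerp_height_pos (ha' z hz) (hb' z hz) (h0 z hz) (h1 z hz)
  positivity

theorem ContinuousOn.mixDown {Z : Type*} [TopologicalSpace Z] {s : Set Z} {a b : Z → ℝ × V}
    {r : Z → ℝ} (ha : ContinuousOn a s) (hb : ContinuousOn b s) (hr : ContinuousOn r s)
    (ha' : ∀ z ∈ s, UpSet (reflR (a z))) (hb' : ∀ z ∈ s, UpSet (reflR (b z)))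
    (h0 : ∀ z ∈ s, 0 ≤ r z) (h1 : ∀ z ∈ s, r z ≤ 1) :
    ContinuousOn (fun z => mixDown (a z) (b z) (r z)) s :=
  continuous_reflR.comp_continuousOn (ContinuousOn.mixUp (continuous_reflR.comp_continuousOn ha)
    (continuous_reflR.comp_continuousOn hb) hr ha' hb' h0 h1)

/-- The equatorial band in `ℝ × V`. -/
abbrev Band (V : Type*) [Zero V] := {y : ℝ × V // y.2 ≠ 0}

/-- The inclusion of the equator. -/
def Band.incl (v : Punct V) : Band V := ⟨(0, v), v.2⟩

/-- The inclusion of the equator. -/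
def Punct.incl (v : Punct V) : Punct (ℝ × V) := ⟨(0, v), fun h => v.2 (congrArg Prod.snd h)⟩

theorem Band.upSet (h : Band V) : UpSet (h : ℝ × V) := Or.inl h.2

theorem Band.upSet_reflR (h : Band V) : UpSet (reflR (h : ℝ × V)) := Or.inl h.2

theorem reflR_incl (e : Punct V) : reflR (Punct.incl e : ℝ × V) = (Punct.incl e : ℝ × V) := by
  simp [reflR, Punct.incl]

theorem incl_upSet (e : Punct V) : UpSet (Punct.incl e : ℝ × V) := Or.inl e.2

/-- The reduced suspension coordinates on the sphere: the path from the base point to itself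
through the point `h` of the band. -/
noncomputable def suspPath (e : Punct V) (h : ℝ × V) (t : ℝ) : ℝ × V :=
  if t ≤ 1 / 2 then mixDown h (Punct.incl e) (1 - 2 * t) else mixUp h (Punct.incl e) (2 * t - 1)

theorem reflR_suspPath (e : Punct V) (h : Band V) (t : ℝ) :
    reflR (suspPath e h t) = suspPath e (reflR h) (1 - t) := by
  unfold suspPath
  rcases lt_trichotomy t (1 / 2) with ht | rfl | ht
  · rw [if_pos ht.le, if_neg (by linarith), mixDown, reflR_reflR, reflR_incl]
    congr 1; ring
  · norm_num
    rw [mixDown, mixDown, reflR_reflR, reflR_reflR, mixUp_zero (Band.upSet_reflR h),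
      mixUp_zero (Band.upSet h)]
  · rw [if_neg (by linarith), if_pos (by linarith), mixDown, reflR_reflR, reflR_incl]
    congr 2; ring

theorem suspPath_of_le (e : Punct V) (h : ℝ × V) {t : ℝ} (ht : t ≤ 1 / 2) :
    suspPath e h t = mixDown h (Punct.incl e) (1 - 2 * t) := if_pos ht

theorem suspPath_of_ge (e : Punct V) (h : Band V) {t : ℝ} (ht : 1 / 2 ≤ t) :
    suspPath e h t = mixUp h (Punct.incl e) (2 * t - 1) := by
  rcases ht.eq_or_lt with rfl | ht
  · rw [suspPath_of_le _ _ le_rfl]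
    norm_num
    rw [mixDown, mixUp_zero (Band.upSet_reflR h), mixUp_zero (Band.upSet h), reflR_reflR]
  · exact if_neg (not_le.2 ht)

theorem upSet_suspPath (e : Punct V) (h : Band V) {t : ℝ} (ht : 1 / 2 ≤ t) (h1 : t ≤ 1) :
    UpSet (suspPath e h t) := by
  rw [suspPath_of_ge _ _ ht]
  exact upSet_mixUp (Band.upSet h) (incl_upSet e) (by linarith) (by linarith)

theorem upSet_reflR_suspPath (e : Punct V) (h : Band V) {t : ℝ} (ht : t ≤ 1 / 2) (h0 : 0 ≤ t) :
    UpSet (reflR (suspPath e h t)) := by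
  rw [reflR_suspPath]
  exact upSet_suspPath e ⟨reflR h, h.2⟩ (by linarith) (by linarith)

theorem suspPath_ne_zero (e : Punct V) (h : Band V) (t : I) : suspPath e h t ≠ 0 := by
  rcases le_total (t : ℝ) (1 / 2) with ht | ht
  · intro h0
    exact (upSet_reflR_suspPath e h ht t.2.1).ne_zero (by rw [h0]; simp [reflR])
  · exact (upSet_suspPath e h ht t.2.2).ne_zero

theorem suspPath_base (e : Punct V) (t : ℝ) :
    suspPath e (Band.incl e : Band V) t = Punct.incl e := by
  have h : ((Band.incl e : Band V) : ℝ × V) = Punct.incl e := rfl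
  unfold suspPath mixDown
  rw [h, reflR_incl, mixUp_self (incl_upSet e), mixUp_self (incl_upSet e), reflR_incl, ite_self]

theorem suspPath_zero (e : Punct V) (h : ℝ × V) : suspPath e h 0 = Punct.incl e := by
  rw [suspPath_of_le _ _ (by norm_num), mixDown, reflR_incl]
  norm_num
  rw [mixUp_one (incl_upSet e), reflR_incl]

theorem suspPath_one (e : Punct V) (h : ℝ × V) : suspPath e h 1 = Punct.incl e := by
  unfold suspPath
  norm_num
  rw [mixUp_one (incl_upSet e)]

theorem continuous_suspPath (e : Punct V) :
    Continuous fun q : Band V × I => suspPath e (q.1 : ℝ × V) (q.2 : ℝ) := by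
  have hl : IsClosed {q : Band V × I | (q.2 : ℝ) ≤ 1 / 2} :=
    isClosed_le (by fun_prop) continuous_const
  have hu : IsClosed {q : Band V × I | 1 / 2 ≤ (q.2 : ℝ)} :=
    isClosed_le continuous_const (by fun_prop)
  rw [← continuousOn_univ]
  have huniv : (Set.univ : Set (Band V × I)) =
      {q : Band V × I | (q.2 : ℝ) ≤ 1 / 2} ∪ {q : Band V × I | 1 / 2 ≤ (q.2 : ℝ)} := by
    ext q; simpa using le_total _ _
  rw [huniv]
  refine ContinuousOn.union_of_isClosed ?_ ?_ hl hu
  · refine ContinuousOn.congr (f := fun q : Band V × I =>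
      mixDown (q.1 : ℝ × V) (Punct.incl e) (1 - 2 * q.2)) ?_ (fun q hq => suspPath_of_le _ _ hq)
    refine ContinuousOn.mixDown (by fun_prop) continuousOn_const (by fun_prop)
      (fun q _ => Band.upSet_reflR q.1) (fun q _ => by rw [reflR_incl]; exact incl_upSet e) ?_ ?_
    · intro q hq
      simp only [Set.mem_ofPred_eq] at hq
      linarith
    · intro q hq
      linarith [q.2.2.1]
  · refine ContinuousOn.congr (f := fun q : Band V × I =>
      mixUp (q.1 : ℝ × V) (Punct.incl e) (2 * q.2 - 1)) ?_ (fun q hq => suspPath_of_ge _ _ hq)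
    refine ContinuousOn.mixUp (by fun_prop) continuousOn_const (by fun_prop)
      (fun q _ => Band.upSet q.1) (fun q _ => incl_upSet e) ?_ ?_
    · intro q hq
      simp only [Set.mem_ofPred_eq] at hq
      linarith
    · intro q hq
      linarith [q.2.2.2]

variable {n : ℕ}

/-- The suspension of a generalized loop in the band. -/
noncomputable def suspBand (e : Punct V) (g : Ω^ (Fin n) (Band V) (Band.incl e)) :
    Ω^ (Fin (n + 1)) (Punct (ℝ × V)) (Punct.incl e) :=
  ⟨⟨fun y => ⟨suspPath e (g (Fin.tail y)) (y 0), suspPath_ne_zero e _ _⟩,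
    ((continuous_suspPath e).comp (((GenLoop.continuous g).comp continuous_finTail).prodMk
      (continuous_apply 0))).subtype_mk _⟩, by
    intro y hy
    apply Subtype.ext
    change suspPath e (g (Fin.tail y)) (y 0) = _
    rcases Cube.mem_boundary_succ.1 hy with (h | h) | h
    · rw [h]; exact suspPath_zero _ _
    · rw [h]; exact suspPath_one _ _
    · rw [GenLoop.boundary g _ h]; exact suspPath_base _ _⟩

theorem suspBand_coe (e : Punct V) (g : Ω^ (Fin n) (Band V) (Band.incl e)) (y : Fin (n + 1) → I) :
    (suspBand e g y : ℝ × V) = suspPath e (g (Fin.tail y)) (y 0) := rfl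

theorem suspBand_homotopic (e : Punct V) {f g : Ω^ (Fin n) (Band V) (Band.incl e)}
    (h : GenLoop.Homotopic f g) : GenLoop.Homotopic (suspBand e f) (suspBand e g) := by
  obtain ⟨H, hH, h0, h1, hb⟩ := h.exists_homotopy
  refine GenLoop.homotopic_mk (fun t y => ⟨suspPath e (H t (Fin.tail y)) (y 0),
    suspPath_ne_zero e _ _⟩) ?_ ?_ ?_ ?_
  · refine Continuous.subtype_mk ((continuous_suspPath e).comp (Continuous.prodMk
      (hH.comp (f := fun q : I × (Fin (n + 1) → I) => (q.1, Fin.tail q.2)) ?_) ?_)) _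
    · exact continuous_fst.prodMk (continuous_finTail.comp continuous_snd)
    · fun_prop
  · intro y; apply Subtype.ext; simp only [h0]; rfl
  · intro y; apply Subtype.ext; simp only [h1]; rfl
  · intro t y hy
    apply Subtype.ext
    rcases Cube.mem_boundary_succ.1 hy with (h | h) | h
    · simp only [h]; exact suspPath_zero _ _
    · simp only [h]; exact suspPath_one _ _
    · simp only [hb t _ h]; exact suspPath_base _ _

/-- The inclusion of the equator in the band. -/
def Band.inclMap : C(Punct V, Band V) := ⟨Band.incl, by unfold Band.incl; fun_prop⟩

/-- The suspension of a generalized loop. -/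
noncomputable def suspLoop (e : Punct V) (g : Ω^ (Fin n) (Punct V) e) :
    Ω^ (Fin (n + 1)) (Punct (ℝ × V)) (Punct.incl e) :=
  suspBand e (GenLoop.map (x := e) (y := Band.incl e) Band.inclMap rfl g)

theorem suspLoop_coe (e : Punct V) (g : Ω^ (Fin n) (Punct V) e) (y : Fin (n + 1) → I) :
    (suspLoop e g y : ℝ × V) = suspPath e (Band.incl (g (Fin.tail y))) (y 0) := rfl

theorem suspBand_transAt (e : Punct V) (i : Fin n) (f g : Ω^ (Fin n) (Band V) (Band.incl e)) :
    suspBand e (GenLoop.transAt i f g) =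
      GenLoop.transAt i.succ (suspBand e f) (suspBand e g) := by
  apply GenLoop.ext
  intro y
  apply Subtype.ext
  have key (v : I) : Fin.tail (Function.update y i.succ v) = Function.update (Fin.tail y) i v := by
    rw [Fin.tail_update_succ]
  have key' (v : I) : Function.update y i.succ v 0 = y 0 :=
    Function.update_of_ne (Fin.succ_ne_zero i).symm _ _
  rw [suspBand_coe]
  by_cases hc : (y i.succ : ℝ) ≤ 1 / 2
  · have h1 : GenLoop.transAt i f g (Fin.tail y) = _ := if_pos hc
    have h2 : GenLoop.transAt i.succ (suspBand e f) (suspBand e g) y = _ := if_pos hc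
    rw [h1, h2, suspBand_coe, key, key']
    rfl
  · have h1 : GenLoop.transAt i f g (Fin.tail y) = _ := if_neg hc
    have h2 : GenLoop.transAt i.succ (suspBand e f) (suspBand e g) y = _ := if_neg hc
    rw [h1, h2, suspBand_coe, key, key']
    rfl

/-- The suspension homomorphism. -/
noncomputable def suspHom (e : Punct V) : π_ (n + 1) (Punct V) e →*
    π_ (n + 2) (Punct (ℝ × V)) (Punct.incl e) :=
  (HomotopyGroup.homOfLoops (N := Fin (n + 1)) (M := Fin (n + 2)) (x := Band.incl e) (suspBand e)
    (fun _ _ => suspBand_homotopic e) 0 1 (suspBand_transAt e 0)).comp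
    (HomotopyGroup.map (x := e) (y := Band.incl e) Band.inclMap rfl)

theorem suspHom_cls (e : Punct V) (g : Ω^ (Fin (n + 1)) (Punct V) e) :
    suspHom e (HomotopyGroup.cls g) = HomotopyGroup.cls (suspLoop e g) := rfl

end Suspension

section GeneralPosition

variable {V : Type*} [NormedAddCommGroup V] [NormedSpace ℝ V] [FiniteDimensional ℝ V]

theorem exists_directions {A : Type*} [NormedAddCommGroup A] [NormedSpace ℝ A]
    [FiniteDimensional ℝ A] {P : A × ℝ → ℝ × V} (hP : ContDiff ℝ 1 P)
    (hd : Module.finrank ℝ A + 4 < 2 * (Module.finrank ℝ V + 1)) {δ : ℝ} (hδ : 0 < δ) :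
    ∃ a b : V, ‖a‖ < δ ∧ ‖b‖ < δ ∧ ∀ x t t', ∀ l m : ℝ,
      ¬ (l • P (x, t) = (1, a) ∧ m • P (x, t') = (-1, b)) := by
  let Q : A × ℝ × ℝ × ℝ × ℝ → (ℝ × V) × (ℝ × V) := fun q =>
    (q.2.2.2.1 • P (q.1, q.2.1), q.2.2.2.2 • P (q.1, q.2.2.1))
  have hQ : ContDiff ℝ 1 Q := by
    have h1 : ContDiff ℝ 1 fun q : A × ℝ × ℝ × ℝ × ℝ => P (q.1, q.2.1) := hP.comp (by fun_prop)
    have h2 : ContDiff ℝ 1 fun q : A × ℝ × ℝ × ℝ × ℝ => P (q.1, q.2.2.1) := hP.comp (by fun_prop)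
    have h3 : ContDiff ℝ 1 fun q : A × ℝ × ℝ × ℝ × ℝ => q.2.2.2.1 := by fun_prop
    have h4 : ContDiff ℝ 1 fun q : A × ℝ × ℝ × ℝ × ℝ => q.2.2.2.2 := by fun_prop
    exact ContDiff.prodMk (h3.smul h1) (h4.smul h2)
  have hdense := hQ.dense_compl_range_of_finrank_lt_finrank (by
    simp only [Module.finrank_prod, Module.finrank_self]; omega)
  let U : Set ((ℝ × V) × (ℝ × V)) := {q | 0 < q.1.1} ∩ {q | q.2.1 < 0} ∩
    {q | ‖q.1.2‖ < δ * q.1.1} ∩ {q | ‖q.2.2‖ < δ * -q.2.1}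
  have hU : IsOpen U := by
    refine IsOpen.inter (IsOpen.inter (IsOpen.inter ?_ ?_) ?_) ?_ <;>
    exact isOpen_lt (by fun_prop) (by fun_prop)
  obtain ⟨⟨a, b⟩, ⟨⟨⟨h1, h2⟩, h3⟩, h4⟩, h5⟩ :=
    hdense.exists_mem_open hU ⟨((1, 0), (-1, 0)), by simp [U, hδ]⟩ |>.imp (fun _ h => h.symm)
  simp only [Set.mem_ofPred_eq] at h1 h2 h3 h4
  refine ⟨a.1⁻¹ • a.2, (-b.1)⁻¹ • b.2, ?_, ?_, ?_⟩
  · rw [norm_smul, norm_inv, Real.norm_of_nonneg h1.le, inv_mul_lt_iff₀ h1, mul_comm]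
    exact h3
  · have h2' : 0 < -b.1 := by linarith
    rw [norm_smul, norm_inv, Real.norm_of_nonneg h2'.le, inv_mul_lt_iff₀ h2', mul_comm]
    exact h4
  · rintro x t t' l m ⟨e1, e2⟩
    apply h5
    refine ⟨(x, t, t', a.1 * l, -b.1 * m), ?_⟩
    have h2' : -b.1 ≠ 0 := by linarith
    refine Prod.ext ?_ ?_
    · change (a.1 * l) • P (x, t) = a
      rw [mul_smul, e1]
      exact Prod.ext (by simp) (by simp [smul_smul, h1.ne'])
    · change (-b.1 * m) • P (x, t') = b
      rw [mul_smul, e2]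
      exact Prod.ext (by simp) (by rw [Prod.smul_snd, smul_smul, mul_inv_cancel₀ h2', one_smul])

/-- A piecewise linear map moving the rays through `(1, a)` and `(-1, b)` to the vertical axis. -/
noncomputable def shear (a b : V) (y : ℝ × V) : ℝ × V :=
  (y.1, y.2 - max y.1 0 • a - max (-y.1) 0 • b)

theorem norm_shear_sub_le {a b : V} {δ : ℝ} (ha : ‖a‖ ≤ δ) (hb : ‖b‖ ≤ δ) (y : ℝ × V) :
    ‖shear a b y - y‖ ≤ ‖y‖ * (2 * δ) := by
  have h1 : |max y.1 0| ≤ ‖y‖ := by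
    refine le_trans ?_ (norm_fst_le y)
    rw [abs_of_nonneg (le_max_right _ _)]
    exact max_le (le_abs_self _) (abs_nonneg _)
  have h2 : |max (-y.1) 0| ≤ ‖y‖ := by
    refine le_trans ?_ (norm_fst_le y)
    rw [abs_of_nonneg (le_max_right _ _)]
    exact max_le (neg_le_abs _) (abs_nonneg _)
  have h3 : shear a b y - y = (0, -(max y.1 0 • a + max (-y.1) 0 • b)) := by
    refine Prod.ext (by simp [shear]) ?_
    simp only [shear, Prod.snd_sub]
    abel
  have hm : (0 : ℝ) ≤ ‖y‖ * (2 * δ) :=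
    mul_nonneg (norm_nonneg _) (by linarith [norm_nonneg a])
  rw [h3, Prod.norm_mk, norm_zero, norm_neg]
  refine max_le hm ((norm_add_le _ _).trans ?_)
  rw [norm_smul, norm_smul, Real.norm_eq_abs, Real.norm_eq_abs]
  have := mul_le_mul h1 ha (norm_nonneg _) (norm_nonneg _)
  have := mul_le_mul h2 hb (norm_nonneg _) (norm_nonneg _)
  linarith

/-- Any map from `I ^ m × I` to `ℝ × V` can be perturbed so that no fibre of the projection to
`I ^ m` contains both points sent to the upper and points sent to the lower vertical ray. -/
theorem exists_separated (e : Punct V) {m : ℕ} (hm : m + 2 < 2 * Module.finrank ℝ V)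
    (F : C((Fin m → I) × I, ℝ × V)) {ε : ℝ} (hε : 0 < ε) :
    ∃ p : C((Fin m → I) × I, ℝ × V), (∀ q, ‖p q - F q‖ < ε) ∧
      (∀ q, F q = Punct.incl e → p q = Punct.incl e) ∧
      ∀ x t t', ¬ (((p (x, t)).2 = 0 ∧ 0 < (p (x, t)).1) ∧
        ((p (x, t')).2 = 0 ∧ (p (x, t')).1 < 0)) := by
  have he : 0 < ‖(e : V)‖ := norm_pos_iff.2 e.2
  set η := min ε ‖(e : V)‖ / 4 with hη
  have hη0 : 0 < η := by positivity
  have hη1 : 4 * η ≤ ε := by rw [hη]; linarith [min_le_left ε ‖(e : V)‖]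
  have hη2 : 4 * η ≤ ‖(e : V)‖ := by rw [hη]; linarith [min_le_right ε ‖(e : V)‖]
  let pr : (Fin m → ℝ) × ℝ → (Fin m → I) × I := fun q =>
    (fun i => Set.projIcc 0 1 zero_le_one (q.1 i), Set.projIcc 0 1 zero_le_one q.2)
  have hpr : Continuous pr := by
    refine Continuous.prodMk (continuous_pi fun i => continuous_projIcc.comp (by fun_prop))
      (continuous_projIcc.comp (by fun_prop))
  obtain ⟨P, hP, hPF, -⟩ := (F.continuous.comp hpr).exists_contDiff_approx 1
    (continuous_const (y := η)) (fun _ => hη0)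
  let inc : (Fin m → I) × I → (Fin m → ℝ) × ℝ := fun q => (fun i => q.1 i, q.2)
  have hinc : Continuous inc := by fun_prop
  have hprinc (q) : pr (inc q) = q := by
    refine Prod.ext (funext fun i => ?_) ?_
    · exact Set.projIcc_val zero_le_one _
    · exact Set.projIcc_val zero_le_one _
  have hPF' (q) : ‖P (inc q) - F q‖ < η := by
    have := hPF (inc q)
    rwa [Function.comp_apply, hprinc, dist_eq_norm] at this
  obtain ⟨C, hC⟩ : ∃ C, ∀ q, ‖P (inc q)‖ ≤ C := by
    obtain ⟨C, hC⟩ := isCompact_univ.exists_bound_of_continuousOn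
      (hP.continuous.comp hinc).continuousOn
    exact ⟨C, fun q => hC q trivial⟩
  have hC0 : 0 ≤ C := (norm_nonneg _).trans (hC (fun _ => 0, 0))
  set δ := η / (2 * (C + 1)) with hδ
  have hδ0 : 0 < δ := by positivity
  obtain ⟨a, b, ha, hb, hab⟩ := exists_directions (A := Fin m → ℝ) (hP.of_le (by simp))
    (by simp; omega) hδ0
  let G : (Fin m → I) × I → ℝ × V := fun q => shear a b (P (inc q))
  have hG : Continuous G := by
    have : Continuous (shear a b) := by unfold shear; fun_prop
    exact this.comp (hP.continuous.comp hinc)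
  have hGF (q) : ‖G q - F q‖ < 2 * η := by
    have h1 := norm_shear_sub_le ha.le hb.le (P (inc q))
    have h2 : ‖P (inc q)‖ * (2 * δ) ≤ η := by
      have : (C + 1) * (2 * δ) = η := by rw [hδ]; field_simp
      rw [← this]
      exact mul_le_mul_of_nonneg_right (by linarith [hC q]) (by positivity)
    have h3 := norm_sub_le_norm_sub_add_norm_sub (G q) (P (inc q)) (F q)
    have h4 := hPF' q
    change ‖G q - P (inc q)‖ ≤ _ at h1
    linarith
  let χ : (Fin m → I) × I → ℝ := fun q => min 1 (‖F q - Punct.incl e‖ / (‖(e : V)‖ / 2))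
  have hχ : Continuous χ := by
    have : Continuous fun q => ‖F q - (Punct.incl e : ℝ × V)‖ := by fun_prop
    exact continuous_const.min (this.div_const _)
  have hχ0 (q) : 0 ≤ χ q := le_min zero_le_one (by positivity)
  have hχ1 (q) : χ q ≤ 1 := min_le_left _ _
  have hpF (q) : ‖F q + χ q • (G q - F q) - F q‖ < 2 * η := by
    rw [add_sub_cancel_left, norm_smul, Real.norm_of_nonneg (hχ0 q)]
    refine lt_of_le_of_lt ?_ (hGF q)
    exact mul_le_of_le_one_left (norm_nonneg _) (hχ1 q)
  have hray (q) (h : (F q + χ q • (G q - F q)).2 = 0) : F q + χ q • (G q - F q) = G q := by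
    suffices χ q = 1 by rw [this]; simp
    by_contra hne
    have h1 : ‖F q - (Punct.incl e : ℝ × V)‖ / (‖(e : V)‖ / 2) < 1 := by
      by_contra h2
      exact hne (min_eq_left (not_lt.1 h2))
    rw [div_lt_one (by positivity)] at h1
    have h2 := norm_sub_le_norm_sub_add_norm_sub (F q + χ q • (G q - F q)) (F q)
      (Punct.incl e : ℝ × V)
    have h3 := norm_snd_le (F q + χ q • (G q - F q) - (Punct.incl e : ℝ × V))
    rw [Prod.snd_sub, h, zero_sub, norm_neg] at h3
    have h4 := hpF q
    change ‖(e : V)‖ ≤ _ at h3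
    linarith
  refine ⟨⟨fun q => F q + χ q • (G q - F q), by fun_prop⟩, ?_, ?_, ?_⟩
  · intro q
    refine (hpF q).trans_le ?_
    linarith
  · intro q hq
    have : χ q = 0 := by simp [χ, hq]
    change F q + χ q • (G q - F q) = _
    rw [this, zero_smul, add_zero, hq]
  · rintro x t t' ⟨⟨h1, h2⟩, ⟨h3, h4⟩⟩
    change (F (x, t) + χ (x, t) • (G (x, t) - F (x, t))).2 = 0 at h1
    change (F (x, t') + χ (x, t') • (G (x, t') - F (x, t'))).2 = 0 at h3
    change 0 < (F (x, t) + χ (x, t) • (G (x, t) - F (x, t))).1 at h2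
    change (F (x, t') + χ (x, t') • (G (x, t') - F (x, t'))).1 < 0 at h4
    have g1 := hray _ h1
    have g3 := hray _ h3
    rw [g1] at h1 h2
    rw [g3] at h3 h4
    let z := P (inc (x, t))
    let z' := P (inc (x, t'))
    change z.2 - max z.1 0 • a - max (-z.1) 0 • b = 0 at h1
    change z'.2 - max z'.1 0 • a - max (-z'.1) 0 • b = 0 at h3
    change 0 < z.1 at h2
    change z'.1 < 0 at h4
    rw [max_eq_left h2.le, max_eq_right (by linarith), zero_smul, sub_zero, sub_eq_zero] at h1
    rw [max_eq_right h4.le, max_eq_left (by linarith), zero_smul, sub_zero, sub_eq_zero] at h3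
    have h5 : -z'.1 ≠ 0 := by linarith
    refine hab (inc (x, t)).1 (inc (x, t)).2 (inc (x, t')).2 z.1⁻¹ (-z'.1)⁻¹ ⟨?_, ?_⟩
    · change z.1⁻¹ • z = _
      refine Prod.ext (by simp [h2.ne']) ?_
      rw [Prod.smul_snd, h1, smul_smul, inv_mul_cancel₀ h2.ne', one_smul]
    · change (-z'.1)⁻¹ • z' = _
      refine Prod.ext ?_ ?_
      · rw [Prod.smul_fst, smul_eq_mul, inv_neg, neg_mul, inv_mul_cancel₀ h4.ne]
      · rw [Prod.smul_snd, h3, smul_smul, inv_mul_cancel₀ h5, one_smul]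

end GeneralPosition

/-- Projection of the real line to the unit interval. -/
noncomputable def clampI (t : ℝ) : I := Set.projIcc 0 1 zero_le_one t

theorem continuous_clampI : Continuous clampI := continuous_projIcc (h := zero_le_one)

@[fun_prop]
theorem Continuous.clampI {Z : Type*} [TopologicalSpace Z] {f : Z → ℝ} (hf : Continuous f) :
    Continuous fun z => clampI (f z) := continuous_clampI.comp hf

theorem clampI_of_le {t : ℝ} (h : t ≤ 0) : clampI t = 0 := Set.projIcc_of_le_left _ h

theorem clampI_of_ge {t : ℝ} (h : 1 ≤ t) : clampI t = 1 := Set.projIcc_of_right_le _ h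

theorem clampI_coe (t : I) : clampI t = t := Set.projIcc_val _ t

theorem coe_clampI (t : ℝ) : (clampI t : ℝ) = max 0 (min 1 t) := Set.coe_projIcc _ _ _ _

theorem clampI_le_half {t : ℝ} (h : t ≤ 1 / 2) : (clampI t : ℝ) ≤ 1 / 2 := by
  rw [coe_clampI]
  exact max_le (by norm_num) ((min_le_right _ _).trans h)

theorem half_le_clampI {t : ℝ} (h : 1 / 2 ≤ t) : 1 / 2 ≤ (clampI t : ℝ) := by
  rw [coe_clampI]
  exact le_max_of_le_right (le_min (by norm_num) h)

theorem continuous_of_le_ge {Z T : Type*} [TopologicalSpace Z] [TopologicalSpace T] {f : Z → T}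
    {r : Z → ℝ} {c : ℝ} (hr : Continuous r) (h1 : ContinuousOn f {z | r z ≤ c})
    (h2 : ContinuousOn f {z | c ≤ r z}) : Continuous f := by
  rw [← continuousOn_univ]
  have huniv : (Set.univ : Set Z) = {z | r z ≤ c} ∪ {z | c ≤ r z} := by
    ext z; simpa using le_total _ _
  rw [huniv]
  exact h1.union_of_isClosed h2 (isClosed_le hr continuous_const) (isClosed_le continuous_const hr)

section Freudenthal

variable {V : Type*} [NormedAddCommGroup V] [NormedSpace ℝ V]

/-- A function separating the fibres meeting the upper ray from those meeting the lower ray. -/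
theorem exists_urysohn {m : ℕ} {p : C((Fin m → I) × I, ℝ × V)} (h0 : ∀ q, p q ≠ 0)
    (hs : ∀ x t t', ¬ (((p (x, t)).2 = 0 ∧ 0 < (p (x, t)).1) ∧
        ((p (x, t')).2 = 0 ∧ (p (x, t')).1 < 0))) :
    ∃ φ : C((Fin m → I), ℝ), (∀ x, 0 ≤ φ x) ∧ (∀ x, φ x ≤ 1) ∧
      (∀ x t, (p (x, t)).2 = 0 → 0 < (p (x, t)).1 → φ x = 1) ∧
      (∀ x t, (p (x, t)).2 = 0 → (p (x, t)).1 < 0 → φ x = 0) := by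
  let A : Set (Fin m → I) := Prod.fst '' {q | (p q).2 = 0 ∧ 0 ≤ (p q).1}
  let B : Set (Fin m → I) := Prod.fst '' {q | (p q).2 = 0 ∧ (p q).1 ≤ 0}
  have hA : IsClosed A := by
    refine (IsCompact.image (IsClosed.isCompact ?_) continuous_fst).isClosed
    exact (isClosed_eq (continuous_snd.comp p.continuous) continuous_const).inter
      (isClosed_le continuous_const (continuous_fst.comp p.continuous))
  have hB : IsClosed B := by
    refine (IsCompact.image (IsClosed.isCompact ?_) continuous_fst).isClosed
    exact (isClosed_eq (continuous_snd.comp p.continuous) continuous_const).inter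
      (isClosed_le (continuous_fst.comp p.continuous) continuous_const)
  have hd : Disjoint B A := by
    rw [Set.disjoint_left]
    rintro _ ⟨⟨x, t⟩, ⟨h1, h2⟩, rfl⟩ ⟨⟨x', t'⟩, ⟨h3, h4⟩, hx⟩
    obtain rfl : x' = x := hx
    have h5 : (p (x', t)).1 ≠ 0 := fun h => h0 _ (Prod.ext h h1)
    have h6 : (p (x', t')).1 ≠ 0 := fun h => h0 _ (Prod.ext h h3)
    exact hs x' t' t ⟨⟨h3, lt_of_le_of_ne h4 h6.symm⟩, h1, lt_of_le_of_ne h2 h5⟩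
  obtain ⟨φ, hφB, hφA, hφ⟩ := exists_continuous_zero_one_of_isClosed hB hA hd
  exact ⟨φ, fun x => (hφ x).1, fun x => (hφ x).2,
    fun x t h h' => hφA ⟨(x, t), ⟨h, h'.le⟩, rfl⟩,
    fun x t h h' => hφB ⟨(x, t), ⟨h, h'.le⟩, rfl⟩⟩

theorem upSet_reflR_of {m : ℕ} {e : Punct V} {p : C((Fin m → I) × I, ℝ × V)} (h0 : ∀ q, p q ≠ 0)
    (hb : ∀ x, p (x, 0) = Punct.incl e) {φ : (Fin m → I) → ℝ}
    (hφ : ∀ x t, (p (x, t)).2 = 0 → 0 < (p (x, t)).1 → φ x = 1) (x : Fin m → I) {t : ℝ}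
    (ht : t ≤ 1 / 2) : UpSet (reflR (p (x, clampI (2 * t - φ x)))) := by
  refine upSet_or (reflR_ne_zero (h0 _)) ?_
  rintro ⟨h1, h2⟩
  have h3 := hφ x _ h1 (by simpa [reflR] using h2)
  rw [clampI_of_le (by rw [h3]; linarith), hb] at h1
  exact e.2 h1

theorem upSet_of {m : ℕ} {e : Punct V} {p : C((Fin m → I) × I, ℝ × V)} (h0 : ∀ q, p q ≠ 0)
    (hb : ∀ x, p (x, 1) = Punct.incl e) {φ : (Fin m → I) → ℝ}
    (hφ : ∀ x t, (p (x, t)).2 = 0 → (p (x, t)).1 < 0 → φ x = 0) (x : Fin m → I) {t : ℝ}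
    (ht : 1 / 2 ≤ t) : UpSet (p (x, clampI (2 * t - φ x))) := by
  refine upSet_or (h0 _) ?_
  rintro ⟨h1, h2⟩
  have h3 := hφ x _ h1 h2
  rw [clampI_of_ge (by rw [h3]; linarith), hb] at h1
  exact e.2 h1

theorem band_of {m : ℕ} {e : Punct V} {p : C((Fin m → I) × I, ℝ × V)} (h0 : ∀ q, p q ≠ 0)
    (hb0 : ∀ x, p (x, 0) = Punct.incl e) (hb1 : ∀ x, p (x, 1) = Punct.incl e)
    {φ : (Fin m → I) → ℝ}
    (hφ1 : ∀ x t, (p (x, t)).2 = 0 → 0 < (p (x, t)).1 → φ x = 1)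
    (hφ0 : ∀ x t, (p (x, t)).2 = 0 → (p (x, t)).1 < 0 → φ x = 0) (x : Fin m → I) :
    (p (x, clampI (1 - φ x))).2 ≠ 0 := by
  intro h
  have h1 := upSet_reflR_of h0 hb0 hφ1 x (t := 1 / 2) le_rfl
  have h2 := upSet_of h0 hb1 hφ0 x (t := 1 / 2) le_rfl
  rw [show (2 * (1 / 2) - φ x : ℝ) = 1 - φ x by ring] at h1 h2
  rcases h1 with h1 | h1
  · exact h1 h
  · rcases h2 with h2 | h2
    · exact h2 h
    · simp only [reflR] at h1; linarith

variable {n : ℕ}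

theorem continuous_mixDown_mixUp {Z : Type*} [TopologicalSpace Z] {a b : Z → ℝ × V}
    {r s : Z → ℝ} (ha : Continuous a) (hb : Continuous b) (hr : Continuous r) (hs : Continuous s)
    (hr0 : ∀ z, 0 ≤ r z) (hr1 : ∀ z, r z ≤ 1)
    (h1 : ∀ z, s z ≤ 1 / 2 → UpSet (reflR (a z))) (h2 : ∀ z, s z ≤ 1 / 2 → UpSet (reflR (b z)))
    (h3 : ∀ z, 1 / 2 ≤ s z → UpSet (a z)) (h4 : ∀ z, 1 / 2 ≤ s z → UpSet (b z)) {f : Z → ℝ × V}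
    (h5 : ∀ z, s z ≤ 1 / 2 → f z = mixDown (a z) (b z) (r z))
    (h6 : ∀ z, 1 / 2 ≤ s z → f z = mixUp (a z) (b z) (r z)) : Continuous f :=
  continuous_of_le_ge hs
    ((ContinuousOn.mixDown ha.continuousOn hb.continuousOn hr.continuousOn h1 h2
      (fun z _ => hr0 z) (fun z _ => hr1 z)).congr h5)
    ((ContinuousOn.mixUp ha.continuousOn hb.continuousOn hr.continuousOn h3 h4
      (fun z _ => hr0 z) (fun z _ => hr1 z)).congr h6)

/-- Two loops respecting the decomposition of the sphere and agreeing on the middle slice are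
homotopic. -/
theorem homotopic_of_hemispheres (e : Punct V)
    {a b : Ω^ (Fin (n + 1)) (Punct (ℝ × V)) (Punct.incl e)}
    (ha : ∀ y, (y 0 : ℝ) ≤ 1 / 2 → UpSet (reflR (a y : ℝ × V)))
    (hb : ∀ y, (y 0 : ℝ) ≤ 1 / 2 → UpSet (reflR (b y : ℝ × V)))
    (ha' : ∀ y, 1 / 2 ≤ (y 0 : ℝ) → UpSet (a y : ℝ × V))
    (hb' : ∀ y, 1 / 2 ≤ (y 0 : ℝ) → UpSet (b y : ℝ × V))
    (hab : ∀ y, (y 0 : ℝ) = 1 / 2 → a y = b y) : GenLoop.Homotopic a b := by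
  classical
  let H : I → (Fin (n + 1) → I) → ℝ × V := fun r y =>
    if (y 0 : ℝ) ≤ 1 / 2 then mixDown (a y) (b y) r else mixUp (a y) (b y) r
  have hmid (r : I) (y : Fin (n + 1) → I) (hy : 1 / 2 ≤ (y 0 : ℝ)) :
      H r y = mixUp (a y) (b y) r := by
    rcases hy.eq_or_lt with h | h
    · have hu := hab y h.symm
      simp only [H]
      rw [if_pos h.symm.le, hu, mixUp_self (hb' y hy), mixDown, mixUp_self (hb y h.symm.le),
        reflR_reflR]
    · exact if_neg (not_le.2 h)
  have hlow (r : I) (y : Fin (n + 1) → I) (hy : (y 0 : ℝ) ≤ 1 / 2) :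
      H r y = mixDown (a y) (b y) r := if_pos hy
  have hne (r y) : H r y ≠ 0 := by
    rcases le_total (y 0 : ℝ) (1 / 2) with h | h
    · rw [hlow r y h]
      exact reflR_ne_zero (upSet_mixUp (ha y h) (hb y h) r.2.1 r.2.2).ne_zero
    · rw [hmid r y h]
      exact (upSet_mixUp (ha' y h) (hb' y h) r.2.1 r.2.2).ne_zero
  have hH : Continuous fun q : I × (Fin (n + 1) → I) => H q.1 q.2 := by
    have hr : Continuous fun q : I × (Fin (n + 1) → I) => (q.1 : ℝ) := by fun_prop
    have hca : Continuous fun q : I × (Fin (n + 1) → I) => (a q.2 : ℝ × V) :=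
      continuous_subtype_val.comp ((GenLoop.continuous a).comp continuous_snd)
    have hcb : Continuous fun q : I × (Fin (n + 1) → I) => (b q.2 : ℝ × V) :=
      continuous_subtype_val.comp ((GenLoop.continuous b).comp continuous_snd)
    have hy : Continuous fun q : I × (Fin (n + 1) → I) => (q.2 0 : ℝ) := by fun_prop
    exact continuous_mixDown_mixUp hca hcb hr hy (fun q => q.1.2.1) (fun q => q.1.2.2)
      (fun q => ha q.2) (fun q => hb q.2) (fun q => ha' q.2) (fun q => hb' q.2)
      (fun q => hlow q.1 q.2) (fun q => hmid q.1 q.2)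
  refine GenLoop.homotopic_mk (fun r y => ⟨H r y, hne r y⟩) (hH.subtype_mk _) ?_ ?_ ?_
  · intro y
    apply Subtype.ext
    change H 0 y = a y
    rcases le_total (y 0 : ℝ) (1 / 2) with h | h
    · rw [hlow _ y h, Set.Icc.coe_zero, mixDown, mixUp_zero (ha y h), reflR_reflR]
    · rw [hmid _ y h, Set.Icc.coe_zero, mixUp_zero (ha' y h)]
  · intro y
    apply Subtype.ext
    change H 1 y = b y
    rcases le_total (y 0 : ℝ) (1 / 2) with h | h
    · rw [hlow _ y h, Set.Icc.coe_one, mixDown, mixUp_one (hb y h), reflR_reflR]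
    · rw [hmid _ y h, Set.Icc.coe_one, mixUp_one (hb' y h)]
  · intro r y hy
    apply Subtype.ext
    change H r y = _
    have e1 := GenLoop.boundary a y hy
    have e2 := GenLoop.boundary b y hy
    rcases le_total (y 0 : ℝ) (1 / 2) with h | h
    · rw [hlow _ y h, mixDown, e1, e2, reflR_incl, mixUp_self (incl_upSet e), reflR_incl]
    · rw [hmid _ y h, e1, e2, mixUp_self (incl_upSet e)]

/-- Loops in the band can be deformed to the equator. -/
theorem suspBand_homotopic_suspLoop (e : Punct V) (k : Ω^ (Fin n) (Band V) (Band.incl e)) :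
    ∃ g : Ω^ (Fin n) (Punct V) e, GenLoop.Homotopic (suspBand e k) (suspLoop e g) := by
  have hk : Continuous fun x => (k x : ℝ × V) :=
    continuous_subtype_val.comp (GenLoop.continuous k)
  refine ⟨⟨⟨fun x => ⟨(k x : ℝ × V).2, (k x).2⟩, (continuous_snd.comp hk).subtype_mk _⟩,
    fun x hx => Subtype.ext ?_⟩, suspBand_homotopic e ?_⟩
  · change (k x : ℝ × V).2 = e
    rw [GenLoop.boundary k x hx]
    rfl
  refine GenLoop.homotopic_mk (fun r x => ⟨((1 - r) * (k x : ℝ × V).1, (k x : ℝ × V).2), (k x).2⟩)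
    ?_ ?_ ?_ ?_
  · have := hk.comp (continuous_snd (X := I))
    refine Continuous.subtype_mk (Continuous.prodMk (Continuous.mul (by fun_prop)
      (continuous_fst.comp this)) (continuous_snd.comp this)) _
  · intro x; apply Subtype.ext; simp
  · intro x; apply Subtype.ext
    refine Prod.ext ?_ rfl
    change (1 - ((1 : I) : ℝ)) * _ = 0
    simp
  · intro r x hx
    apply Subtype.ext
    rw [GenLoop.boundary k x hx]
    exact Prod.ext (mul_zero _) rfl

theorem exists_norm_lower_bound {Z : Type*} [TopologicalSpace Z] [CompactSpace Z] {E : Type*}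
    [NormedAddCommGroup E] {f : Z → E} (hf : Continuous f) (h0 : ∀ z, f z ≠ 0) :
    ∃ ε > 0, ∀ z, ε ≤ ‖f z‖ := by
  rcases isEmpty_or_nonempty Z with h | h
  · exact ⟨1, one_pos, fun z => h.elim z⟩
  · obtain ⟨z, -, hz⟩ := isCompact_univ.exists_isMinOn Set.univ_nonempty hf.norm.continuousOn
    exact ⟨‖f z‖, norm_pos_iff.2 (h0 z), fun z' => hz trivial⟩

variable [FiniteDimensional ℝ V]

theorem exists_suspLoop_homotopic (e : Punct V) (hn : n + 2 < 2 * Module.finrank ℝ V)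
    (F : Ω^ (Fin (n + 1)) (Punct (ℝ × V)) (Punct.incl e)) :
    ∃ g : Ω^ (Fin n) (Punct V) e, GenLoop.Homotopic (suspLoop e g) F := by
  have hcons : Continuous fun q : (Fin n → I) × I => (Fin.cons q.2 q.1 : Fin (n + 1) → I) := by
    refine continuous_pi fun i => ?_
    refine Fin.cases ?_ (fun j => ?_) i
    · simpa using continuous_snd
    · exact (continuous_apply j).comp continuous_fst
  let F' : C((Fin n → I) × I, ℝ × V) := ⟨fun q => F (Fin.cons q.2 q.1),
    continuous_subtype_val.comp ((GenLoop.continuous F).comp hcons)⟩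
  have hF' (y : Fin (n + 1) → I) : F' (Fin.tail y, y 0) = F y :=
    congrArg (fun z => (F z : ℝ × V)) (Fin.cons_self_tail y)
  obtain ⟨ε, hε, hF0⟩ := exists_norm_lower_bound F'.continuous (fun q => (F _).2)
  obtain ⟨p, hpF, hpe, hs⟩ := exists_separated e hn F' hε
  have hline (q) {r : ℝ} (h0 : 0 ≤ r) (h1 : r ≤ 1) : F' q + r • (p q - F' q) ≠ 0 := by
    intro h
    have h2 : ‖r • (p q - F' q)‖ < ε := by
      rw [norm_smul, Real.norm_of_nonneg h0]
      exact lt_of_le_of_lt (mul_le_of_le_one_left (norm_nonneg _) h1) (hpF q)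
    have h3 : F' q = -(r • (p q - F' q)) := eq_neg_of_add_eq_zero_left h
    have h4 := hF0 q
    rw [h3, norm_neg] at h4
    linarith
  have hp0 (q) : p q ≠ 0 := by simpa using hline q zero_le_one le_rfl
  have hFb (y : Fin (n + 1) → I) (hy : y ∈ Cube.boundary (Fin (n + 1))) :
      F' (Fin.tail y, y 0) = Punct.incl e := by
    rw [hF', GenLoop.boundary F y hy]
  have hpb (x : Fin n → I) (t : I) (h : (t = 0 ∨ t = 1) ∨ x ∈ Cube.boundary (Fin n)) :
      p (x, t) = Punct.incl e := by
    apply hpe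
    have := hFb (Fin.cons t x) (Cube.mem_boundary_succ.2 (by simpa using h))
    simpa using this
  obtain ⟨φ, hφ0, hφ1, hφA, hφB⟩ := exists_urysohn hp0 hs
  have hlow := fun x (t : ℝ) => upSet_reflR_of hp0 (fun x => hpb x 0 (by simp)) hφA x (t := t)
  have hup := fun x (t : ℝ) => upSet_of hp0 (fun x => hpb x 1 (by simp)) hφB x (t := t)
  have hband := band_of hp0 (fun x => hpb x 0 (by simp)) (fun x => hpb x 1 (by simp)) hφA hφB
  have htail : Continuous fun y : Fin (n + 1) → I => Fin.tail y := continuous_finTail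
  let P : Ω^ (Fin (n + 1)) (Punct (ℝ × V)) (Punct.incl e) :=
    ⟨⟨fun y => ⟨p (Fin.tail y, clampI (2 * y 0 - φ (Fin.tail y))), hp0 _⟩, by
      refine Continuous.subtype_mk (p.continuous.comp ?_) _
      have := φ.continuous.comp htail
      exact htail.prodMk (Continuous.clampI (Continuous.sub (by fun_prop) this))⟩, by
      intro y hy
      apply Subtype.ext
      refine hpb _ _ ?_
      rcases Cube.mem_boundary_succ.1 hy with (h | h) | h
      · refine Or.inl (Or.inl (clampI_of_le ?_))
        rw [h]; simpa using hφ0 _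
      · refine Or.inl (Or.inr (clampI_of_ge ?_))
        rw [h]; simp; linarith [hφ1 (Fin.tail y)]
      · exact Or.inr h⟩
  let p' : Ω^ (Fin (n + 1)) (Punct (ℝ × V)) (Punct.incl e) :=
    ⟨⟨fun y => ⟨p (Fin.tail y, y 0), hp0 _⟩, by
      refine Continuous.subtype_mk (p.continuous.comp ?_) _
      exact htail.prodMk (by fun_prop)⟩, fun y hy =>
      Subtype.ext (hpb _ _ (Cube.mem_boundary_succ.1 hy))⟩
  have hc : Continuous fun q : I × (Fin (n + 1) → I) => (Fin.tail q.2, q.2 0) :=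
    (htail.comp continuous_snd).prodMk (by fun_prop)
  have H1 : GenLoop.Homotopic F p' := by
    refine GenLoop.homotopic_mk (fun r y => ⟨F' (Fin.tail y, y 0) +
      (r : ℝ) • (p (Fin.tail y, y 0) - F' (Fin.tail y, y 0)), hline _ r.2.1 r.2.2⟩) ?_ ?_ ?_ ?_
    · have h1 := F'.continuous.comp hc
      have h2 := p.continuous.comp hc
      have h3 : Continuous fun q : I × (Fin (n + 1) → I) => (q.1 : ℝ) := by fun_prop
      exact (h1.add (h3.smul (h2.sub h1))).subtype_mk _
    · intro y; apply Subtype.ext; simp [hF']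
    · intro y; apply Subtype.ext; simp; rfl
    · intro r y hy
      apply Subtype.ext
      simp [hFb y hy, hpb _ _ (Cube.mem_boundary_succ.1 hy)]
  have H2 : GenLoop.Homotopic p' P := by
    refine GenLoop.homotopic_mk (fun r y => ⟨p (Fin.tail y,
      clampI ((1 - r) * y 0 + r * (2 * y 0 - φ (Fin.tail y)))), hp0 _⟩) ?_ ?_ ?_ ?_
    · refine Continuous.subtype_mk (p.continuous.comp ?_) _
      refine (htail.comp continuous_snd).prodMk ?_
      have := φ.continuous.comp (htail.comp (continuous_snd (X := I)))
      refine Continuous.clampI (Continuous.add (by fun_prop) (Continuous.mul (by fun_prop)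
        (Continuous.sub (by fun_prop) this)))
    · intro y; apply Subtype.ext; simp [clampI_coe]; rfl
    · intro y; apply Subtype.ext; simp; rfl
    · intro r y hy
      apply Subtype.ext
      refine hpb _ _ ?_
      rcases Cube.mem_boundary_succ.1 hy with (h | h) | h
      · refine Or.inl (Or.inl (clampI_of_le ?_))
        rw [h]
        simpa using mul_nonneg r.2.1 (hφ0 _)
      · refine Or.inl (Or.inr (clampI_of_ge ?_))
        rw [h]; simp
        nlinarith [hφ1 (Fin.tail y), r.2.1]
      · exact Or.inr h
  let k : Ω^ (Fin n) (Band V) (Band.incl e) :=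
    ⟨⟨fun x => ⟨p (x, clampI (1 - φ x)), hband x⟩, by fun_prop⟩, fun x hx => by
      apply Subtype.ext
      exact hpb _ _ (Or.inr hx)⟩
  obtain ⟨g, hg⟩ := suspBand_homotopic_suspLoop e k
  refine ⟨g, hg.symm.trans (GenLoop.Homotopic.trans ?_ (H1.trans H2).symm)⟩
  refine homotopic_of_hemispheres e ?_ ?_ ?_ ?_ ?_
  · exact fun y hy => upSet_reflR_suspPath e _ hy (y 0).2.1
  · exact fun y hy => hlow _ _ hy
  · exact fun y hy => upSet_suspPath e _ hy (y 0).2.2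
  · exact fun y hy => hup _ _ hy
  · intro y hy
    apply Subtype.ext
    rw [suspBand_coe, suspPath_of_ge _ _ hy.symm.le, hy]
    norm_num
    rw [mixUp_zero (Band.upSet _)]
    change p (_, _) = p (_, _)
    rw [hy]
    norm_num

theorem homotopic_const_of_suspLoop (e : Punct V) (hn : n + 3 < 2 * Module.finrank ℝ V)
    (g : Ω^ (Fin n) (Punct V) e) (h : GenLoop.Homotopic (suspLoop e g) GenLoop.const) :
    GenLoop.Homotopic g GenLoop.const := by
  obtain ⟨H, hH, h0, h1, hb⟩ := h.exists_homotopy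
  have hcons : Continuous fun q : (Fin (n + 1) → I) × I =>
      (Fin.cons q.2 (Fin.tail q.1) : Fin (n + 1) → I) := by
    refine continuous_pi fun i => ?_
    refine Fin.cases ?_ (fun j => ?_) i
    · simpa using continuous_snd
    · simp only [Fin.cons_succ]
      exact (continuous_apply j.succ).comp continuous_fst
  have hx0 : Continuous fun q : (Fin (n + 1) → I) × I => q.1 0 := by fun_prop
  let F' : C((Fin (n + 1) → I) × I, ℝ × V) := ⟨fun q => H (q.1 0) (Fin.cons q.2 (Fin.tail q.1)),
    continuous_subtype_val.comp (hH.comp (hx0.prodMk hcons))⟩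
  have hg : Continuous fun x => (g x : V) := continuous_subtype_val.comp (GenLoop.continuous g)
  obtain ⟨ε₁, hε₁, hF0⟩ := exists_norm_lower_bound F'.continuous (fun q => (H _ _).2)
  obtain ⟨ε₂, hε₂, hg0⟩ := exists_norm_lower_bound hg (fun q => (g _).2)
  have hS : Continuous fun q : (Fin n → I) × I => suspPath e (Band.incl (g q.1)) (q.2 : ℝ) := by
    refine (continuous_suspPath e).comp (Continuous.prodMk (Band.inclMap.continuous.comp
      ((GenLoop.continuous g).comp continuous_fst)) continuous_snd)
  obtain ⟨ε₃, hε₃, hlo⟩ : ∃ ε > 0, ∀ x (t : I), (t : ℝ) ≤ 1 / 2 → ∀ w : ℝ × V,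
      ‖w - suspPath e (Band.incl (g x)) t‖ < ε → UpSet (reflR w) := by
    have hK : IsCompact ((fun q : (Fin n → I) × I => suspPath e (Band.incl (g q.1)) (q.2 : ℝ)) ''
        {q | (q.2 : ℝ) ≤ 1 / 2}) :=
      (IsClosed.isCompact (isClosed_le (by fun_prop) continuous_const)).image hS
    obtain ⟨ε, hε, hsub⟩ := hK.exists_thickening_subset_open
      (isOpen_upSet.preimage (continuous_reflR (V := V))) (by
        rintro _ ⟨⟨x, t⟩, ht, rfl⟩
        exact upSet_reflR_suspPath e _ ht t.2.1)
    refine ⟨ε, hε, fun x t ht w hw => hsub (Metric.mem_thickening_iff.2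
      ⟨_, ⟨(x, t), ht, rfl⟩, by rwa [dist_eq_norm]⟩)⟩
  obtain ⟨ε₄, hε₄, hhi⟩ : ∃ ε > 0, ∀ x (t : I), 1 / 2 ≤ (t : ℝ) → ∀ w : ℝ × V,
      ‖w - suspPath e (Band.incl (g x)) t‖ < ε → UpSet w := by
    have hK : IsCompact ((fun q : (Fin n → I) × I => suspPath e (Band.incl (g q.1)) (q.2 : ℝ)) ''
        {q | 1 / 2 ≤ (q.2 : ℝ)}) :=
      (IsClosed.isCompact (isClosed_le continuous_const (by fun_prop))).image hS
    obtain ⟨ε, hε, hsub⟩ := hK.exists_thickening_subset_open isOpen_upSet (by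
        rintro _ ⟨⟨x, t⟩, ht, rfl⟩
        exact upSet_suspPath e _ ht t.2.2)
    refine ⟨ε, hε, fun x t ht w hw => hsub (Metric.mem_thickening_iff.2
      ⟨_, ⟨(x, t), ht, rfl⟩, by rwa [dist_eq_norm]⟩)⟩
  obtain ⟨p, hpF, hpe, hs⟩ := exists_separated e (by omega) F'
    (ε := min (min ε₁ ε₂) (min ε₃ ε₄)) (by positivity)
  have hp0 (q) : p q ≠ 0 := by
    intro h
    have h1 := (hpF q).trans_le ((min_le_left _ _).trans (min_le_left _ _))
    rw [h, zero_sub, norm_neg] at h1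
    linarith [hF0 q]
  have hpb (x : Fin (n + 1) → I) (t : I)
      (h : (t = 0 ∨ t = 1) ∨ (Fin.tail x ∈ Cube.boundary (Fin n) ∨ x 0 = 1)) :
      p (x, t) = Punct.incl e := by
    apply hpe
    rcases h with h | h | h
    · exact congrArg Subtype.val (hb _ _ (Cube.mem_boundary_succ.2 (Or.inl (by simpa using h))))
    · exact congrArg Subtype.val (hb _ _ (Cube.mem_boundary_succ.2 (Or.inr (by simpa using h))))
    · change (H (x 0) _ : ℝ × V) = _
      rw [h, h1]
      rfl
  have hpS (x : Fin n → I) (t : I) : ‖p (Fin.cons 0 x, t) - suspPath e (Band.incl (g x)) t‖ <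
      min (min ε₁ ε₂) (min ε₃ ε₄) := by
    have := hpF (Fin.cons 0 x, t)
    have h2 : F' (Fin.cons 0 x, t) = suspPath e (Band.incl (g x)) t := by
      change (H 0 (Fin.cons t x) : ℝ × V) = _
      rw [h0, suspLoop_coe]
      simp
    rwa [h2] at this
  obtain ⟨φ, hφ0, hφ1, hφA, hφB⟩ := exists_urysohn hp0 hs
  have hband := band_of hp0 (fun x => hpb x 0 (by simp)) (fun x => hpb x 1 (by simp)) hφA hφB
  have hcons' (s : I) : Continuous fun x : Fin n → I => (Fin.cons s x : Fin (n + 1) → I) := by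
    refine continuous_pi fun i => ?_
    refine Fin.cases ?_ (fun j => ?_) i
    · simpa using continuous_const
    · simpa using (continuous_apply j)
  have hcons'' : Continuous fun q : I × (Fin n → I) => (Fin.cons q.1 q.2 : Fin (n + 1) → I) := by
    refine continuous_pi fun i => ?_
    refine Fin.cases ?_ (fun j => ?_) i
    · simpa using continuous_fst
    · exact (continuous_apply j).comp continuous_snd
  have hmid (r : I) (x : Fin n → I) :
      (p (Fin.cons 0 x, clampI (1 - ((1 - r) * φ (Fin.cons 0 x) + r / 2)))).2 ≠ 0 := by
    intro hz
    set t := clampI (1 - ((1 - r) * φ (Fin.cons 0 x) + r / 2)) with ht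
    have hr0 := r.2.1
    have hne : (p (Fin.cons 0 x, t)).1 ≠ 0 := fun h => hp0 _ (Prod.ext h hz)
    rcases lt_or_gt_of_ne hne with hlt | hgt
    · have h2 := hφB _ _ hz hlt
      have h3 : 1 / 2 ≤ (t : ℝ) := by
        refine half_le_clampI ?_
        rw [h2]; linarith [r.2.2]
      have h4 := hhi x t h3 _ ((hpS x t).trans_le ((min_le_right _ _).trans (min_le_right _ _)))
      rcases h4 with h4 | h4
      · exact h4 hz
      · linarith
    · have h2 := hφA _ _ hz hgt
      have h3 : (t : ℝ) ≤ 1 / 2 := by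
        refine clampI_le_half ?_
        rw [h2]; linarith [r.2.2]
      have h4 := hlo x t h3 _ ((hpS x t).trans_le ((min_le_right _ _).trans (min_le_left _ _)))
      rcases h4 with h4 | h4
      · exact h4 hz
      · simp only [reflR] at h4; linarith
  have hb2 (x : Fin n → I) (hx : x ∈ Cube.boundary (Fin n)) (s t : I) :
      p (Fin.cons s x, t) = Punct.incl e := hpb _ _ (Or.inr (Or.inl (by simpa using hx)))
  let k : Ω^ (Fin n) (Punct V) e :=
    ⟨⟨fun x => ⟨(p (Fin.cons 0 x, clampI (1 - φ (Fin.cons 0 x)))).2, hband _⟩, by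
      have := φ.continuous.comp (hcons' 0)
      refine Continuous.subtype_mk
        (continuous_snd.comp (p.continuous.comp ((hcons' 0).prodMk ?_))) _
      exact Continuous.clampI (continuous_const.sub this)⟩, fun x hx => by
      apply Subtype.ext
      exact congrArg Prod.snd (hb2 x hx _ _)⟩
  let k' : Ω^ (Fin n) (Punct V) e :=
    ⟨⟨fun x => ⟨(p (Fin.cons 0 x, clampI (1 / 2))).2, by
      have := hmid 1 x
      norm_num at this ⊢
      exact this⟩, by
      exact Continuous.subtype_mk (continuous_snd.comp (p.continuous.comp ((hcons' 0).prodMk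
        continuous_const))) _⟩, fun x hx => by
      apply Subtype.ext
      exact congrArg Prod.snd (hb2 x hx _ _)⟩
  have H1 : GenLoop.Homotopic k GenLoop.const := by
    refine GenLoop.homotopic_mk (fun s x => ⟨(p (Fin.cons s x, clampI (1 - φ (Fin.cons s x)))).2,
      hband _⟩) ?_ ?_ ?_ ?_
    · have := φ.continuous.comp hcons''
      refine Continuous.subtype_mk (continuous_snd.comp (p.continuous.comp (hcons''.prodMk ?_))) _
      exact Continuous.clampI (continuous_const.sub this)
    · exact fun x => rfl
    · intro x
      apply Subtype.ext
      exact congrArg Prod.snd (hpb _ _ (Or.inr (Or.inr rfl)))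
    · intro s x hx
      apply Subtype.ext
      exact congrArg Prod.snd (hb2 x hx _ _)
  have H2 : GenLoop.Homotopic k k' := by
    refine GenLoop.homotopic_mk (fun r x => ⟨_, hmid r x⟩) ?_ ?_ ?_ ?_
    · have h2 := (hcons' 0).comp (continuous_snd (X := I))
      have := φ.continuous.comp h2
      refine Continuous.subtype_mk (continuous_snd.comp (p.continuous.comp (h2.prodMk ?_))) _
      refine Continuous.clampI (continuous_const.sub (Continuous.add (Continuous.mul (by fun_prop)
        this) (by fun_prop)))
    · intro x; apply Subtype.ext; simp; rfl
    · intro x; apply Subtype.ext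
      simp only [k', Set.Icc.coe_one]
      change (p _).2 = (p _).2
      congr 4
      ring
    · intro r x hx
      apply Subtype.ext
      exact congrArg Prod.snd (hb2 x hx _ _)
  have hclose (x) : ‖(k' x : V) - g x‖ < ε₂ := by
    have h3 := (hpS x (clampI (1 / 2))).trans_le ((min_le_left _ _).trans (min_le_right _ _))
    have h4 : ((clampI (1 / 2) : I) : ℝ) = 1 / 2 :=
      le_antisymm (clampI_le_half le_rfl) (half_le_clampI le_rfl)
    rw [h4, suspPath_of_ge _ _ le_rfl] at h3
    norm_num at h3
    rw [mixUp_zero (Band.upSet _)] at h3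
    refine lt_of_le_of_lt ?_ h3
    have h5 := norm_snd_le (p (Fin.cons 0 x, clampI (1 / 2)) - (Band.incl (g x) : ℝ × V))
    norm_num at h5
    refine le_trans (le_of_eq ?_) h5
    simp [k', Band.incl]
  have H3 : GenLoop.Homotopic g k' := by
    refine GenLoop.homotopic_mk (fun r x => ⟨g x + (r : ℝ) • ((k' x : V) - g x), ?_⟩) ?_ ?_ ?_ ?_
    · intro h
      have h2 : ‖(r : ℝ) • ((k' x : V) - g x)‖ < ε₂ := by
        rw [norm_smul, Real.norm_of_nonneg r.2.1]
        exact lt_of_le_of_lt (mul_le_of_le_one_left (norm_nonneg _) r.2.2) (hclose x)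
      have h3 : (g x : V) = -((r : ℝ) • ((k' x : V) - g x)) := eq_neg_of_add_eq_zero_left h
      have h4 := hg0 x
      rw [h3, norm_neg] at h4
      linarith
    · have h1 := hg.comp (continuous_snd (X := I))
      have h2 :=
        (continuous_subtype_val.comp (GenLoop.continuous k')).comp (continuous_snd (X := I))
      exact (h1.add (Continuous.smul (by fun_prop) (h2.sub h1))).subtype_mk _
    · intro x; apply Subtype.ext; simp
    · intro x; apply Subtype.ext; simp
    · intro r x hx
      apply Subtype.ext
      change (g x : V) + (r : ℝ) • ((k' x : V) - g x) = e
      rw [GenLoop.boundary g x hx, GenLoop.boundary k' x hx]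
      simp
  exact H3.trans (H2.symm.trans H1)

theorem suspHom_surjective (e : Punct V) (hn : n + 3 < 2 * Module.finrank ℝ V) :
    Function.Surjective (suspHom (n := n) e) := by
  intro a
  obtain ⟨F, rfl⟩ := HomotopyGroup.cls_surj a
  obtain ⟨g, hg⟩ := exists_suspLoop_homotopic e (by omega) F
  exact ⟨HomotopyGroup.cls g, by rw [suspHom_cls, HomotopyGroup.cls_eq_iff]; exact hg⟩

theorem suspHom_injective (e : Punct V) (hn : n + 4 < 2 * Module.finrank ℝ V) :
    Function.Injective (suspHom (n := n) e) := by
  rw [injective_iff_map_eq_one]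
  intro a ha
  obtain ⟨g, rfl⟩ := HomotopyGroup.cls_surj a
  rw [suspHom_cls, HomotopyGroup.cls_eq_one_iff] at ha
  rw [HomotopyGroup.cls_eq_one_iff]
  exact homotopic_const_of_suspLoop e (by omega) g ha

end Freudenthal

section Hopf

open Complex ComplexConjugate

/-- The quadratic Hopf map on `ℂ × ℂ`. -/
noncomputable def hopfFun (q : ℂ × ℂ) : ℝ × ℂ := ((normSq q.1 - normSq q.2) / 2, q.1 * conj q.2)

/-- The Euclidean inner product on `ℝ × ℂ`. -/
noncomputable def dotRC (b c : ℝ × ℂ) : ℝ := b.1 * c.1 + (b.2 * conj c.2).re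

theorem dotRC_self (b : ℝ × ℂ) : dotRC b b = b.1 ^ 2 + normSq b.2 := by
  simp [dotRC, normSq_apply]; ring

theorem dotRC_self_pos {b : ℝ × ℂ} (h : b ≠ 0) : 0 < dotRC b b := by
  rw [dotRC_self]
  rcases eq_or_ne b.2 0 with h2 | h2
  · have : b.1 ≠ 0 := fun h1 => h (Prod.ext h1 h2)
    have := normSq_nonneg b.2
    positivity
  · have := normSq_pos.2 h2
    positivity

theorem dotRC_hopfFun_self (q : ℂ × ℂ) :
    dotRC (hopfFun q) (hopfFun q) = ((normSq q.1 + normSq q.2) / 2) ^ 2 := by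
  rw [dotRC_self]
  simp only [hopfFun, normSq_mul, normSq_conj]
  ring

theorem sqrt_dotRC_hopfFun_self (q : ℂ × ℂ) :
    √(dotRC (hopfFun q) (hopfFun q)) = (normSq q.1 + normSq q.2) / 2 := by
  rw [dotRC_hopfFun_self, Real.sqrt_sq]
  have := normSq_nonneg q.1
  have := normSq_nonneg q.2
  positivity

theorem hopfFun_ne_zero {q : ℂ × ℂ} (h : q ≠ 0) : hopfFun q ≠ 0 := by
  intro h0
  have h1 := dotRC_hopfFun_self q
  rw [h0] at h1
  have h2 := normSq_nonneg q.1
  have h3 := normSq_nonneg q.2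
  have h4 : (normSq q.1 + normSq q.2) / 2 = 0 := by
    rw [← pow_eq_zero_iff two_ne_zero, ← h1]; simp [dotRC]
  exact h (Prod.ext (normSq_eq_zero.1 (by linarith)) (normSq_eq_zero.1 (by linarith)))

/-- The Hopf map. -/
noncomputable def hopf : C(Punct (ℂ × ℂ), Punct (ℝ × ℂ)) :=
  ⟨fun q => ⟨hopfFun q, hopfFun_ne_zero q.2⟩, by
    unfold hopfFun
    have := continuous_normSq
    have := continuous_conj
    fun_prop⟩

theorem hopf_coe (q : Punct (ℂ × ℂ)) : (hopf q : ℝ × ℂ) = hopfFun q := rfl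

theorem hopfFun_smul (u : ℂ) (q : ℂ × ℂ) : hopfFun (u • q) = normSq u • hopfFun q := by
  refine Prod.ext ?_ ?_
  · simp [hopfFun]; ring
  · simp only [hopfFun, Prod.smul_fst, Prod.smul_snd, smul_eq_mul, map_mul, real_smul,
      normSq_eq_conj_mul_self]
    ring

/-- The scaled projection onto the Hopf fibre over `b`. -/
noncomputable def spinProj (b : ℝ × ℂ) (q : ℂ × ℂ) : ℂ × ℂ :=
  (((√(dotRC b b) + b.1 : ℝ) * q.1 + b.2 * q.2) / 2,
    (conj b.2 * q.1 + (√(dotRC b b) - b.1 : ℝ) * q.2) / 2)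

/-- The scaling factor of `spinProj`. -/
noncomputable def spinFactor (b : ℝ × ℂ) (q : ℂ × ℂ) : ℝ :=
  (√(dotRC b b) * ((normSq q.1 + normSq q.2) / 2) + dotRC b (hopfFun q)) / 2

theorem hopfFun_spinProj (b : ℝ × ℂ) (q : ℂ × ℂ) :
    hopfFun (spinProj b q) = spinFactor b q • b := by
  obtain ⟨b0, β⟩ := b
  obtain ⟨z, w⟩ := q
  have hN : √(dotRC (b0, β) (b0, β)) ^ 2 = b0 ^ 2 + β.re ^ 2 + β.im ^ 2 := by
    rw [Real.sq_sqrt (by rw [dotRC_self]; have := normSq_nonneg β; positivity), dotRC_self,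
      normSq_apply]
    ring
  simp only [spinProj, spinFactor, hopfFun]
  set N := √(dotRC (b0, β) (b0, β))
  have hc2 : conj (2 : ℂ) = 2 := map_ofNat _ 2
  refine Prod.ext ?_ (Complex.ext ?_ ?_)
  · simp [normSq_apply, dotRC]
    linear_combination ((z.re ^ 2 + z.im ^ 2 - w.re ^ 2 - w.im ^ 2)/8) * hN
  · simp [dotRC, normSq_apply, hc2]
    linear_combination ((z.re * w.re + z.im * w.im)/4) * hN
  · simp [dotRC, normSq_apply, hc2]
    linear_combination ((z.im * w.re - z.re * w.im)/4) * hN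

theorem spinFactor_pos {b : ℝ × ℂ} {q : ℂ × ℂ} (h : 0 < dotRC b (hopfFun q)) :
    0 < spinFactor b q := by
  unfold spinFactor
  have := normSq_nonneg q.1
  have := normSq_nonneg q.2
  positivity

/-- The parallel transport of `q` to the Hopf fibre over `b`. -/
noncomputable def hopfTransport (b : ℝ × ℂ) (q : ℂ × ℂ) : ℂ × ℂ :=
  (((√(spinFactor b q))⁻¹ : ℝ) : ℂ) • spinProj b q

theorem hopfFun_hopfTransport {b : ℝ × ℂ} {q : ℂ × ℂ} (h : 0 < dotRC b (hopfFun q)) :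
    hopfFun (hopfTransport b q) = b := by
  have h1 := spinFactor_pos h
  have h2 : 0 < √(spinFactor b q) := Real.sqrt_pos.2 h1
  rw [hopfTransport, hopfFun_smul, hopfFun_spinProj, smul_smul, normSq_ofReal]
  have : (√(spinFactor b q))⁻¹ * (√(spinFactor b q))⁻¹ * spinFactor b q = 1 := by
    nth_rewrite 3 [← Real.mul_self_sqrt h1.le]
    field_simp
  rw [this, one_smul]

theorem hopfTransport_self {q : ℂ × ℂ} (h : q ≠ 0) : hopfTransport (hopfFun q) q = q := by
  have h0 := dotRC_self_pos (hopfFun_ne_zero h)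
  rw [dotRC_hopfFun_self] at h0
  have h1 := normSq_nonneg q.1
  have h2 := normSq_nonneg q.2
  set N := (normSq q.1 + normSq q.2) / 2 with hN
  have h3 : 0 < N := by
    refine lt_of_le_of_ne (by positivity) fun h3 => ?_
    rw [← h3] at h0
    norm_num at h0
  have h4 : spinFactor (hopfFun q) q = N ^ 2 := by
    rw [spinFactor, sqrt_dotRC_hopfFun_self, dotRC_hopfFun_self, ← hN]
    ring
  rw [hopfTransport, h4, Real.sqrt_sq h3.le, spinProj, sqrt_dotRC_hopfFun_self, ← hN]
  have e1 : N + (hopfFun q).1 = normSq q.1 := by rw [hN]; simp only [hopfFun]; ring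
  have e2 : N - (hopfFun q).1 = normSq q.2 := by rw [hN]; simp only [hopfFun]; ring
  rw [e1, e2]
  have h5 : (N : ℂ) ≠ 0 := by exact_mod_cast h3.ne'
  have h6 : (N : ℂ) = (conj q.1 * q.1 + conj q.2 * q.2) / 2 := by
    rw [hN]; push_cast; rw [normSq_eq_conj_mul_self, normSq_eq_conj_mul_self]
  refine Prod.ext ?_ ?_
  · simp only [hopfFun, Prod.smul_fst, smul_eq_mul]
    rw [ofReal_inv, inv_mul_eq_iff_eq_mul₀ h5, h6, normSq_eq_conj_mul_self]
    ring
  · simp only [hopfFun, Prod.smul_snd, smul_eq_mul]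
    rw [ofReal_inv, inv_mul_eq_iff_eq_mul₀ h5, h6, normSq_eq_conj_mul_self, map_mul, conj_conj]
    ring

theorem continuous_dotRC {Z : Type*} [TopologicalSpace Z] {b c : Z → ℝ × ℂ} (hb : Continuous b)
    (hc : Continuous c) : Continuous fun z => dotRC (b z) (c z) := by
  unfold dotRC
  have h := continuous_conj.comp (continuous_snd.comp hc)
  exact ((continuous_fst.comp hb).mul (continuous_fst.comp hc)).add
    (continuous_re.comp ((continuous_snd.comp hb).mul h))

theorem continuous_hopfFun {Z : Type*} [TopologicalSpace Z] {q : Z → ℂ × ℂ} (hq : Continuous q) :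
    Continuous fun z => hopfFun (q z) := by
  unfold hopfFun
  have := continuous_normSq
  have := continuous_conj
  fun_prop

theorem continuous_hopfTransport {Z : Type*} [TopologicalSpace Z] {b : Z → ℝ × ℂ} {q : Z → ℂ × ℂ}
    (hb : Continuous b) (hq : Continuous q) (h : ∀ z, 0 < dotRC (b z) (hopfFun (q z))) :
    Continuous fun z => hopfTransport (b z) (q z) := by
  have h1 := (continuous_dotRC hb hb).sqrt
  have h2 := continuous_dotRC hb (continuous_hopfFun hq)
  have h3 : Continuous fun z => √(spinFactor (b z) (q z)) := by
    unfold spinFactor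
    have := continuous_normSq
    refine Continuous.sqrt ?_
    fun_prop
  have h4 : Continuous fun z => spinProj (b z) (q z) := by
    unfold spinProj
    have := continuous_conj
    have := continuous_ofReal
    fun_prop
  exact (continuous_ofReal.comp (h3.inv₀ fun z =>
    (Real.sqrt_pos.2 (spinFactor_pos (h z))).ne')).smul h4

variable {Y : Type*} [PseudoMetricSpace Y] [CompactSpace Y]

theorem exists_dotRC_pos (H : C(Y × I, Punct (ℝ × ℂ))) : ∃ N : ℕ, 0 < N ∧ ∀ y, ∀ t t' : I,
    |(t : ℝ) - t'| ≤ 1 / N → 0 < dotRC (H (y, t)) (H (y, t')) := by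
  have hc : Continuous fun z : Y × I × I => dotRC (H (z.1, z.2.1)) (H (z.1, z.2.2)) :=
    continuous_dotRC (by fun_prop) (by fun_prop)
  have hd : Continuous fun z : Y × I => dotRC (H z) (H z) :=
    continuous_dotRC (by fun_prop) (by fun_prop)
  obtain ⟨ε, hε, hlow⟩ := exists_norm_lower_bound hd (fun z => (dotRC_self_pos (H z).2).ne')
  obtain ⟨δ, hδ, hu⟩ := Metric.uniformContinuous_iff.1
    (CompactSpace.uniformContinuous_of_continuous hc) ε hε
  obtain ⟨N, hN⟩ := exists_nat_one_div_lt hδ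
  refine ⟨N + 1, N.succ_pos, fun y t t' ht => ?_⟩
  have h1 := @hu (y, t, t') (y, t', t') (by
    simp only [Prod.dist_eq, dist_self]
    rw [max_eq_left dist_nonneg, max_eq_right dist_nonneg, Subtype.dist_eq, Real.dist_eq]
    push_cast at ht
    linarith)
  have h2 := hlow (y, t')
  rw [Real.norm_of_nonneg (dotRC_self_pos (H _).2).le] at h2
  rw [Real.dist_eq, abs_lt] at h1
  linarith

/-- The truncation of the time interval at `k / N`. -/
noncomputable def truncI (N k : ℕ) (t : I) : I := min t (clampI ((k : ℝ) / N))

theorem continuous_truncI (N k : ℕ) : Continuous (truncI N k) := by unfold truncI; fun_prop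

theorem abs_truncI_sub_lt {N : ℕ} (hN : 0 < N) (k : ℕ) (t : I) :
    |(truncI N (k + 1) t : ℝ) - truncI N k t| ≤ 1 / N := by
  have h1 : ∀ k : ℕ, ((truncI N k t : I) : ℝ) = min (t : ℝ) ((k : ℝ) / N) := by
    intro k
    have : (0 : ℝ) ≤ k / N := by positivity
    have h2 := t.2.1
    have h3 := t.2.2
    have h4 := coe_clampI ((k : ℝ) / N)
    rw [truncI]
    rcases le_total t (clampI ((k : ℝ) / N)) with h | h
    · rw [min_eq_left h]
      have h' : (t : ℝ) ≤ clampI ((k : ℝ) / N) := h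
      grind
    · rw [min_eq_right h]
      have h' : (clampI ((k : ℝ) / N) : ℝ) ≤ t := h
      grind
  rw [h1, h1]
  push_cast
  have : (0 : ℝ) < 1 / N := by positivity
  rw [add_div]
  grind

theorem truncI_zero (N : ℕ) (t : I) : truncI N 0 t = 0 := by
  simp [truncI, clampI_of_le]

theorem truncI_self {N : ℕ} (hN : 0 < N) (t : I) : truncI N N t = t := by
  rw [truncI, clampI_of_ge (by rw [div_self (by positivity)]), min_eq_left (show t ≤ 1 from t.2.2)]

theorem truncI_apply_zero (N k : ℕ) : truncI N k 0 = 0 := by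
  rw [truncI, min_eq_left (show (0 : I) ≤ clampI _ from (clampI _).2.1)]

theorem exists_hopf_lift (H : C(Y × I, Punct (ℝ × ℂ))) (q : C(Y, Punct (ℂ × ℂ)))
    (h0 : ∀ y, hopf (q y) = H (y, 0)) : ∃ Λ : C(Y × I, Punct (ℂ × ℂ)),
      (∀ z, hopf (Λ z) = H z) ∧ (∀ y, Λ (y, 0) = q y) ∧
        ∀ y, (∀ t, H (y, t) = H (y, 0)) → ∀ t, Λ (y, t) = q y := by
  obtain ⟨N, hN, hpos⟩ := exists_dotRC_pos H
  have key (k : ℕ) : ∃ Λ : C(Y × I, Punct (ℂ × ℂ)),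
      (∀ y t, hopf (Λ (y, t)) = H (y, truncI N k t)) ∧ (∀ y, Λ (y, 0) = q y) ∧
        ∀ y, (∀ t, H (y, t) = H (y, 0)) → ∀ t, Λ (y, t) = q y := by
    induction k with
    | zero => exact ⟨⟨fun z => q z.1, by fun_prop⟩, fun y t => by rw [truncI_zero]; exact h0 y,
        fun y => rfl, fun y _ t => rfl⟩
    | succ k ih =>
      obtain ⟨Λ, h1, h2, h3⟩ := ih
      have hp (z : Y × I) : 0 < dotRC (H (z.1, truncI N (k + 1) z.2)) (hopfFun (Λ z)) := by
        rw [← hopf_coe, show Λ z = Λ (z.1, z.2) from rfl, h1]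
        exact hpos _ _ _ (abs_truncI_sub_lt hN k z.2)
      have hlift (z : Y × I) := hopfFun_hopfTransport (hp z)
      have hne (z : Y × I) : hopfTransport (H (z.1, truncI N (k + 1) z.2)) (Λ z) ≠ 0 := by
        intro h
        have := hlift z
        rw [h] at this
        exact (H _).2 (this.symm.trans (by simp [hopfFun]))
      have hself (y : Y) (t : I) (h : H (y, truncI N (k + 1) t) = H (y, truncI N k t)) :
          hopfTransport (H (y, truncI N (k + 1) t)) (Λ (y, t)) = Λ (y, t) := by
        rw [h, ← h1]
        exact hopfTransport_self (Λ (y, t)).2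
      refine ⟨⟨fun z => ⟨_, hne z⟩, Continuous.subtype_mk (continuous_hopfTransport ?_
        (by fun_prop) hp) _⟩, ?_, ?_, ?_⟩
      · have := (continuous_truncI N (k + 1)).comp (continuous_snd (X := Y))
        exact continuous_subtype_val.comp (H.continuous.comp (continuous_fst.prodMk this))
      · intro y t
        exact Subtype.ext (hlift (y, t))
      · intro y
        apply Subtype.ext
        rw [← h2]
        exact hself y 0 (by rw [truncI_apply_zero, truncI_apply_zero])
      · intro y hy t
        apply Subtype.ext
        rw [← h3 y hy t]
        exact hself y t (by rw [hy, hy (truncI N k t)])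
  obtain ⟨Λ, h1, h2, h3⟩ := key N
  exact ⟨Λ, fun z => by rw [show Λ z = Λ (z.1, z.2) from rfl, h1, truncI_self hN], h2, h3⟩

/-- A nowhere vanishing function on a cube has a logarithm. -/
theorem exists_log {m : ℕ} (u : C(Fin m → I, ℂ)) (hu : ∀ x, u x ≠ 0) (x₀ : Fin m → I)
    (h : u x₀ = 1) : ∃ θ : C(Fin m → I, ℂ), (∀ x, exp (θ x) = u x) ∧ θ x₀ = 0 := by
  let pr : (Fin m → ℝ) → Fin m → I := fun x i => clampI (x i)
  have hpr : Continuous pr := continuous_pi fun i => Continuous.clampI (continuous_apply i)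
  let inc : (Fin m → I) → Fin m → ℝ := fun x i => x i
  have hinc : Continuous inc := by fun_prop
  have hpi (x) : pr (inc x) = x := funext fun i => clampI_coe _
  let f : C(Fin m → ℝ, {z : ℂ // z ≠ 0}) := ⟨fun x => ⟨u (pr x), hu _⟩, by fun_prop⟩
  obtain ⟨θ, ⟨h1, h2⟩, -⟩ := isCoveringMap_exp.existsUnique_continuousMap_lifts
    (f := f) (a₀ := inc x₀) (e₀ := (0 : ℂ)) (by
      apply Subtype.ext
      simp [f, hpi, h])
  refine ⟨⟨fun x => θ (inc x), by fun_prop⟩, fun x => ?_, ?_⟩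
  · have := congrArg Subtype.val (congrFun h2 (inc x))
    simpa [f, hpi] using this
  · simpa using h1

theorem eq_of_exp_eq_one {γ : I → ℂ} (hγ : Continuous γ) (h : ∀ s, exp (γ s) = 1) : γ 0 = γ 1 := by
  have := isCoveringMap_exp.eq_of_comp_eq hγ (continuous_const (y := γ 0)) (by
    ext s
    simp [h]) 0 rfl
  exact (congrFun this 1).symm

end Hopf

section HopfExact

open Complex ComplexConjugate

/-- The scalar relating two points of a Hopf fibre. -/
noncomputable def phase (q q' : ℂ × ℂ) : ℂ :=
  (q'.1 * conj q.1 + q'.2 * conj q.2) / ((normSq q.1 + normSq q.2 : ℝ) : ℂ)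

theorem normSq_add_normSq_pos {q : ℂ × ℂ} (h : q ≠ 0) : 0 < normSq q.1 + normSq q.2 := by
  have h1 := normSq_nonneg q.1
  have h2 := normSq_nonneg q.2
  refine lt_of_le_of_ne (by positivity) fun h0 => h (Prod.ext ?_ ?_)
  · exact normSq_eq_zero.1 (by linarith)
  · exact normSq_eq_zero.1 (by linarith)

theorem phase_self {q : ℂ × ℂ} (h : q ≠ 0) : phase q q = 1 := by
  have h1 := (normSq_add_normSq_pos h).ne'
  rw [phase, mul_conj, mul_conj, ← ofReal_add, div_self (by exact_mod_cast h1)]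

theorem phase_smul {q q' : ℂ × ℂ} (h : q ≠ 0) (hq : hopfFun q = hopfFun q') :
    phase q q' • q = q' := by
  have h0 := (normSq_add_normSq_pos h).ne'
  have hs : normSq q.1 + normSq q.2 = normSq q'.1 + normSq q'.2 := by
    have h1 := sqrt_dotRC_hopfFun_self q
    rw [hq, sqrt_dotRC_hopfFun_self] at h1
    linarith
  have hd : (normSq q.1 - normSq q.2) / 2 = (normSq q'.1 - normSq q'.2) / 2 := congrArg Prod.fst hq
  have h2 : q.1 * conj q.2 = q'.1 * conj q'.2 := congrArg Prod.snd hq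
  have h3 : conj q.1 * q.2 = conj q'.1 * q'.2 := by
    have := congrArg conj h2
    simpa using this
  have ha : q.1 * conj q.1 = q'.1 * conj q'.1 := by
    rw [mul_conj, mul_conj]; norm_cast; linarith
  have hb : q.2 * conj q.2 = q'.2 * conj q'.2 := by
    rw [mul_conj, mul_conj]; norm_cast; linarith
  have hz : ((normSq q.1 + normSq q.2 : ℝ) : ℂ) ≠ 0 := by exact_mod_cast h0
  have he : ((normSq q.1 + normSq q.2 : ℝ) : ℂ) = q.1 * conj q.1 + q.2 * conj q.2 := by
    rw [mul_conj, mul_conj]; norm_cast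
  refine Prod.ext ?_ ?_
  · rw [Prod.smul_fst, phase, smul_eq_mul, div_mul_eq_mul_div, div_eq_iff hz, he]
    linear_combination q'.2 * h2 - q'.1 * hb
  · rw [Prod.smul_snd, phase, smul_eq_mul, div_mul_eq_mul_div, div_eq_iff hz, he]
    linear_combination q'.1 * h3 - q'.2 * ha

theorem normSq_phase {q q' : ℂ × ℂ} (h : q ≠ 0) (hq : hopfFun q = hopfFun q') :
    normSq (phase q q') = 1 := by
  have h1 := hopfFun_smul (phase q q') q
  rw [phase_smul h hq, ← hq] at h1
  have h2 : (normSq (phase q q') - 1) • hopfFun q = 0 := by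
    rw [sub_smul, one_smul, ← h1, sub_self]
  rcases smul_eq_zero.1 h2 with h3 | h3
  · linarith
  · exact absurd h3 (hopfFun_ne_zero h)

theorem hopfFun_exp_smul (t : ℝ) (q : ℂ × ℂ) : hopfFun (exp (t * Complex.I) • q) = hopfFun q := by
  rw [hopfFun_smul, normSq_eq_norm_sq, norm_exp_ofReal_mul_I]
  simp

/-- Rotation of a nonzero vector by an angle. -/
noncomputable def Punct.rot (t : ℝ) (q : Punct (ℂ × ℂ)) : Punct (ℂ × ℂ) :=
  ⟨exp (t * Complex.I) • (q : ℂ × ℂ), smul_ne_zero (exp_ne_zero _) q.2⟩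

theorem Punct.rot_coe (t : ℝ) (q : Punct (ℂ × ℂ)) :
    (Punct.rot t q : ℂ × ℂ) = exp (t * Complex.I) • (q : ℂ × ℂ) := rfl

theorem hopf_rot (t : ℝ) (q : Punct (ℂ × ℂ)) : hopf (Punct.rot t q) = hopf q :=
  Subtype.ext (hopfFun_exp_smul _ _)

theorem Punct.rot_zero (q : Punct (ℂ × ℂ)) : Punct.rot 0 q = q :=
  Subtype.ext (by simp [Punct.rot_coe])

theorem Punct.rot_rot (s t : ℝ) (q : Punct (ℂ × ℂ)) :
    Punct.rot s (Punct.rot t q) = Punct.rot (s + t) q :=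
  Subtype.ext (by rw [rot_coe, rot_coe, rot_coe, smul_smul, ← exp_add]; congr 2; push_cast; ring)

theorem Punct.rot_eq_iff {s t : ℝ} {q : Punct (ℂ × ℂ)} :
    Punct.rot s q = Punct.rot t q ↔ exp (s * Complex.I) = exp (t * Complex.I) := by
  rw [Subtype.ext_iff, rot_coe, rot_coe]
  exact ⟨fun h => smul_left_injective _ q.2 h, fun h => by rw [h]⟩

@[fun_prop]
theorem Continuous.punctRot {Z : Type*} [TopologicalSpace Z] {t : Z → ℝ} {q : Z → Punct (ℂ × ℂ)}
    (ht : Continuous t) (hq : Continuous q) : Continuous fun z => Punct.rot (t z) (q z) := by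
  refine Continuous.subtype_mk ?_ _
  have := continuous_ofReal
  fun_prop

/-- Two lifts of a map from a cube along the Hopf map differ by an angle. -/
theorem exists_angle {m : ℕ} (Q Λ : C(Fin m → I, Punct (ℂ × ℂ))) (h : ∀ x, hopf (Q x) = hopf (Λ x))
    {x₀ : Fin m → I} (h0 : Q x₀ = Λ x₀) :
    ∃ θ : C(Fin m → I, ℝ), (∀ x, Punct.rot (θ x) (Q x) = Λ x) ∧ θ x₀ = 0 := by
  have hh (x) : hopfFun (Q x) = hopfFun (Λ x) := congrArg Subtype.val (h x)
  let u : C(Fin m → I, ℂ) := ⟨fun x => phase (Q x) (Λ x), by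
    unfold phase
    have := continuous_normSq
    have := continuous_conj
    have := continuous_ofReal
    refine Continuous.div (by fun_prop) (by fun_prop) fun x => ?_
    exact_mod_cast (normSq_add_normSq_pos (Q x).2).ne'⟩
  have hu (x) : normSq (u x) = 1 := normSq_phase (Q x).2 (hh x)
  obtain ⟨θ, h1, h2⟩ := exists_log u (fun x h => by simpa [h] using hu x) x₀ (by
    simp only [u, ContinuousMap.coe_mk, h0]
    exact phase_self (Λ x₀).2)
  have hre (x) : (θ x).re = 0 := by
    have h3 := hu x
    rw [← h1, normSq_eq_norm_sq, norm_exp,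
      pow_eq_one_iff_of_nonneg (Real.exp_nonneg _) two_ne_zero] at h3
    exact Real.exp_eq_one_iff _ |>.1 h3
  refine ⟨⟨fun x => (θ x).im, by fun_prop⟩, fun x => Subtype.ext ?_, by simp [h2]⟩
  have h4 : (((θ x).im : ℝ) : ℂ) * Complex.I = θ x := Complex.ext (by simp [hre]) (by simp)
  rw [Punct.rot_coe, ContinuousMap.coe_mk, h4, h1]
  exact phase_smul (Q x).2 (hh x)

theorem eq_of_exp_I_eq_one {γ : I → ℝ} (hγ : Continuous γ)
    (h : ∀ s, exp (γ s * Complex.I) = 1) : γ 0 = γ 1 := by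
  have := eq_of_exp_eq_one (γ := fun s => γ s * Complex.I) (by fun_prop) h
  exact_mod_cast mul_right_cancel₀ I_ne_zero this

theorem eq_zero_of_mem_boundary {m : ℕ} (hm : 2 ≤ m) (θ : C(Fin m → I, ℝ))
    (h : ∀ x ∈ Cube.boundary (Fin m), exp (θ x * Complex.I) = 1) (h0 : θ 0 = 0) :
    ∀ x ∈ Cube.boundary (Fin m), θ x = 0 := by
  rintro x ⟨i, hi⟩
  obtain ⟨j, hj⟩ : ∃ j : Fin m, j ≠ i := by
    have : Nontrivial (Fin m) := Fin.nontrivial_iff_two_le.2 hm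
    exact exists_ne i
  have h1 := eq_of_exp_I_eq_one (γ := fun s => θ fun k => if k = i then x i else s * x k)
    (θ.continuous.comp (continuous_pi fun k => by split_ifs <;> fun_prop))
    (fun s => h _ ⟨i, by simpa using hi⟩)
  have h2 := eq_of_exp_I_eq_one (γ := fun s => θ fun k => if k = i then s * x i else 0)
    (θ.continuous.comp (continuous_pi fun k => by split_ifs <;> fun_prop))
    (fun s => h _ ⟨j, by simp [hj]⟩)
  have e1 : (fun k => if k = i then x i else 1 * x k) = x := by
    funext k; split_ifs with hk <;> simp [hk]
  have e2 : (fun k => if k = i then x i else 0 * x k) = fun k => if k = i then 1 * x i else 0 := by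
    funext k; split_ifs <;> simp
  have e3 : (fun k => if k = i then 0 * x i else 0) = (0 : Fin m → I) := by
    funext k; split_ifs <;> simp
  simp only [e1, e2] at h1
  simp only [e3, h0] at h2
  rw [← h1, ← h2]

/-- The base point of `ℂ × ℂ`. -/
noncomputable def hopfBase : Punct (ℂ × ℂ) := ⟨(1, 1), by simp⟩

theorem hopf_hopfBase : hopf hopfBase = Punct.incl (⟨1, one_ne_zero⟩ : Punct ℂ) :=
  Subtype.ext (Prod.ext (by simp [hopf_coe, hopfFun, hopfBase, Punct.incl])
    (by simp [hopf_coe, hopfFun, hopfBase, Punct.incl]))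

/-- Lifting along the Hopf map relative to the boundary of a cube of dimension at least two. -/
theorem exists_hopf_lift_rel {m : ℕ} (hm : 2 ≤ m) (H : C((Fin m → I) × I, Punct (ℝ × ℂ)))
    (q : C(Fin m → I, Punct (ℂ × ℂ))) (h0 : ∀ x, hopf (q x) = H (x, 0))
    (hqb : ∀ x ∈ Cube.boundary (Fin m), q x = hopfBase)
    (hb : ∀ x ∈ Cube.boundary (Fin m), ∀ t, H (x, t) = hopf hopfBase)
    (h1 : ∀ x, H (x, 1) = hopf hopfBase) :
    ∃ Λ : C((Fin m → I) × I, Punct (ℂ × ℂ)), (∀ z, hopf (Λ z) = H z) ∧ (∀ x, Λ (x, 0) = q x) ∧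
      (∀ x ∈ Cube.boundary (Fin m), ∀ t, Λ (x, t) = hopfBase) ∧ ∀ x, Λ (x, 1) = hopfBase := by
  obtain ⟨Λ, e1, e2, e3⟩ := exists_hopf_lift H q h0
  have e4 : ∀ x ∈ Cube.boundary (Fin m), ∀ t, Λ (x, t) = hopfBase := fun x hx t => by
    rw [e3 x (fun t => by rw [hb x hx, hb x hx]) t, hqb x hx]
  have z0 : (0 : Fin m → I) ∈ Cube.boundary (Fin m) := ⟨⟨0, by omega⟩, Or.inl rfl⟩
  obtain ⟨θ, t1, t2⟩ := exists_angle (ContinuousMap.const _ hopfBase)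
    ⟨fun x => Λ (x, 1), by fun_prop⟩ (fun x => by simp [e1, h1]) (x₀ := 0) (by simp [e4 0 z0])
  have t3 := eq_zero_of_mem_boundary hm θ (fun x hx => by
    have := t1 x
    simp only [ContinuousMap.const_apply, ContinuousMap.coe_mk, e4 x hx] at this
    have h5 := Punct.rot_eq_iff.1 (this.trans (Punct.rot_zero _).symm)
    simpa using h5) t2
  refine ⟨⟨fun z => Punct.rot (-(z.2 * θ z.1)) (Λ z), by fun_prop⟩, fun z => ?_, fun x => ?_,
    fun x hx t => ?_, fun x => ?_⟩
  · simp [hopf_rot, e1]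
  · simp [Punct.rot_zero, e2]
  · simp [t3 x hx, Punct.rot_zero, e4 x hx]
  · have := t1 x
    simp only [ContinuousMap.const_apply, ContinuousMap.coe_mk] at this
    simp [← this, Punct.rot_rot, Punct.rot_zero]

open HomotopyGroup

theorem hopf_map_surjective {m : ℕ} (hm : 2 ≤ m) : Function.Surjective
    (HomotopyGroup.map (N := Fin (m + 1)) (x := hopfBase)
      (y := Punct.incl (⟨1, one_ne_zero⟩ : Punct ℂ))
      hopf hopf_hopfBase) := by
  intro a
  obtain ⟨f, rfl⟩ := cls_surj a
  have hb : ∀ y ∈ Cube.boundary (Fin (m + 1)), f y = hopf hopfBase := fun y hy =>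
    (f.2 y hy).trans hopf_hopfBase.symm
  have hc : Continuous fun z : (Fin m → I) × I => f (Fin.cons z.2 z.1 : Fin (m + 1) → I) :=
    (GenLoop.continuous f).comp (continuous_pi (Fin.cases (by simpa using continuous_snd)
      (fun j => by
        simp only [Fin.cons_succ]
        exact (continuous_apply j).comp continuous_fst)))
  obtain ⟨Λ, e1, e2, e3, e4⟩ := exists_hopf_lift_rel hm
    ⟨fun z => f (Fin.cons z.2 z.1 : Fin (m + 1) → I), hc⟩ (ContinuousMap.const _ hopfBase)
    (fun x => (hb _ (Cube.mem_boundary_succ.2 (Or.inl (Or.inl rfl)))).symm)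
    (fun x _ => rfl)
    (fun x hx t => hb _ (Cube.mem_boundary_succ.2 (Or.inr (by simpa using hx))))
    (fun x => hb _ (Cube.mem_boundary_succ.2 (Or.inl (Or.inr rfl))))
  let g : Ω^ (Fin (m + 1)) (Punct (ℂ × ℂ)) hopfBase :=
    ⟨⟨fun y => Λ (Fin.tail y, y 0), Λ.continuous.comp
      (continuous_finTail.prodMk (continuous_apply 0))⟩, by
      intro y hy
      rcases Cube.mem_boundary_succ.1 hy with (h | h) | h
      · simp [h, e2]
      · simp [h, e4]
      · exact e3 _ h _⟩
  refine ⟨cls g, ?_⟩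
  rw [map_cls]
  congr 1
  ext1 y
  refine (e1 (Fin.tail y, y 0)).trans ?_
  simp

theorem hopf_map_injective {m : ℕ} (hm : 1 ≤ m) : Function.Injective
    (HomotopyGroup.map (N := Fin (m + 1)) (x := hopfBase)
      (y := Punct.incl (⟨1, one_ne_zero⟩ : Punct ℂ))
      hopf hopf_hopfBase) := by
  rw [injective_iff_map_eq_one]
  intro a ha
  obtain ⟨q, rfl⟩ := cls_surj a
  rw [map_cls, cls_eq_one_iff] at ha
  obtain ⟨H, c, h0, h1, hb⟩ := ha.exists_homotopy
  obtain ⟨Λ, e1, e2, e3, e4⟩ := exists_hopf_lift_rel (m := m + 1) (by omega)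
    ⟨fun z => H z.2 z.1, c.comp continuous_swap⟩ q.1 (fun x => (h0 x).symm)
    q.2 (fun x hx t => (hb t x hx).trans hopf_hopfBase.symm)
    (fun x => (h1 x).trans hopf_hopfBase.symm)
  rw [cls_eq_one_iff]
  exact GenLoop.homotopic_mk (fun t x => Λ (x, t)) (by fun_prop) e2 e4 (fun t x hx => e3 x hx t)

end HopfExact

section Degree

open Complex ComplexConjugate HomotopyGroup

/-- The base point of the punctured complex plane. -/
noncomputable def oneC : Punct ℂ := ⟨1, one_ne_zero⟩

/-- The loop winding `k` times around the origin. -/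
noncomputable def windLoop (k : ℤ) : Ω^ (Fin 1) (Punct ℂ) oneC :=
  ⟨⟨fun y => ⟨exp (2 * Real.pi * Complex.I * k * (y 0 : ℝ)), exp_ne_zero _⟩, by
    refine Continuous.subtype_mk ?_ _
    have := continuous_ofReal
    fun_prop⟩, by
    rintro y ⟨i, hi⟩
    obtain rfl : i = 0 := Subsingleton.elim _ _
    apply Subtype.ext
    rcases hi with hi | hi
    · simp [hi, oneC]
    · simp only [hi, oneC, ContinuousMap.coe_mk]
      exact exp_eq_one_iff.2 ⟨k, by push_cast; ring⟩⟩

theorem windLoop_coe (k : ℤ) (y : Fin 1 → I) :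
    (windLoop k y : ℂ) = exp (2 * Real.pi * Complex.I * k * (y 0 : ℝ)) := rfl

theorem cls_eq_windLoop {f : Ω^ (Fin 1) (Punct ℂ) oneC} (θ : (Fin 1 → I) → ℂ) (hc : Continuous θ)
    (h : ∀ y, exp (θ y) = f y) (k : ℤ) (h0 : θ 0 = 0) (h1 : θ 1 = 2 * Real.pi * Complex.I * k) :
    cls f = cls (windLoop k) := by
  rw [cls_eq_iff]
  have hb : ∀ y ∈ Cube.boundary (Fin 1), θ y = 2 * Real.pi * Complex.I * k * (y 0 : ℝ) := by
    rintro y ⟨i, hi⟩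
    obtain rfl : i = 0 := Subsingleton.elim _ _
    rcases hi with hi | hi
    · obtain rfl : y = 0 := funext fun j => by rw [Subsingleton.elim j 0, hi]; rfl
      simp [h0]
    · obtain rfl : y = 1 := funext fun j => by rw [Subsingleton.elim j 0, hi]; rfl
      simp [h1]
  refine GenLoop.homotopic_mk (fun s y => ⟨exp ((1 - (s : ℝ)) * θ y +
    (s : ℝ) * (2 * Real.pi * Complex.I * k * (y 0 : ℝ))), exp_ne_zero _⟩) ?_ ?_ ?_ ?_
  · refine Continuous.subtype_mk ?_ _
    have := continuous_ofReal
    fun_prop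
  · intro y
    exact Subtype.ext (by simp [h])
  · intro y
    exact Subtype.ext (by simp [windLoop_coe])
  · intro t y hy
    rw [← f.2 y hy]
    refine Subtype.ext ?_
    rw [← hb y hy]
    refine Eq.trans ?_ (h y)
    ring_nf

theorem cls_windLoop_add (k l : ℤ) :
    cls (windLoop (k + l)) = cls (windLoop k) * cls (windLoop l) := by
  rw [← cls_transAt (0 : Fin 1)]
  symm
  refine cls_eq_windLoop (fun y => 2 * Real.pi * Complex.I *
    (l * (clampI (2 * y 0) : ℝ) + k * (clampI (2 * y 0 - 1) : ℝ))) ?_ ?_ _ ?_ ?_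
  · have := continuous_ofReal
    fun_prop
  · intro y
    rw [GenLoop.transAt_apply]
    split_ifs with h
    · rw [windLoop_coe, clampI_of_le (t := 2 * y 0 - 1) (by linarith)]
      simp [clampI]
      ring_nf
    · rw [windLoop_coe, clampI_of_ge (t := 2 * y 0) (by linarith)]
      simp only [clampI, Function.update_self]
      rw [show 2 * Real.pi * Complex.I * ((l : ℂ) * ((1 : I) : ℝ) +
        k * (Set.projIcc 0 1 zero_le_one (2 * y 0 - 1 : ℝ) : ℝ)) =
        2 * Real.pi * Complex.I * k * (Set.projIcc 0 1 zero_le_one (2 * y 0 - 1 : ℝ) : ℝ) +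
        l * (2 * Real.pi * Complex.I) by simp; ring, exp_add, exp_int_mul_two_pi_mul_I, mul_one]
  · simp [clampI_of_le]
  · rw [clampI_of_ge (by norm_num), clampI_of_ge (by norm_num)]
    simp
    ring

theorem isCyclic_pi_one : IsCyclic (HomotopyGroup (Fin 1) (Punct ℂ) oneC) := by
  let F : Multiplicative ℤ →* HomotopyGroup (Fin 1) (Punct ℂ) oneC :=
    MonoidHom.mk' (fun k => cls (windLoop k.toAdd)) fun a b => cls_windLoop_add _ _
  refine isCyclic_of_surjective F fun a => ?_
  obtain ⟨f, rfl⟩ := cls_surj a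
  have hf (y) (hy : y ∈ Cube.boundary (Fin 1)) : (f y : ℂ) = 1 := congrArg Subtype.val (f.2 y hy)
  have hfc := GenLoop.continuous f
  obtain ⟨θ, h1, h0⟩ := exists_log ⟨fun y => (f y : ℂ), by fun_prop⟩ (fun y => (f y).2) 0
    (hf 0 ⟨0, Or.inl rfl⟩)
  obtain ⟨k, hk⟩ := exp_eq_one_iff.1 ((h1 1).trans (hf 1 ⟨0, Or.inr rfl⟩))
  exact ⟨Multiplicative.ofAdd k, (cls_eq_windLoop θ θ.continuous h1 k h0
    (by rw [hk]; ring)).symm⟩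

/-- The boundary winding number of a lift of a two-dimensional loop along the Hopf map. -/
def HasWinding (f : Ω^ (Fin 2) (Punct (ℝ × ℂ)) (Punct.incl oneC)) (k : ℤ) : Prop :=
  ∃ (Λ : C(Fin 2 → I, Punct (ℂ × ℂ))) (ϑ : C(I, ℝ)), (∀ y, hopf (Λ y) = f y) ∧
    (∀ y, y 0 = 0 → Λ y = hopfBase) ∧ (∀ y, y 1 = 0 → Λ y = hopfBase) ∧
    (∀ y, y 1 = 1 → Λ y = hopfBase) ∧ (∀ y, y 0 = 1 → Λ y = Punct.rot (ϑ (y 1)) hopfBase) ∧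
    ϑ 0 = 0 ∧ ϑ 1 = 2 * Real.pi * k

theorem exists_hasWinding (f : Ω^ (Fin 2) (Punct (ℝ × ℂ)) (Punct.incl oneC)) :
    ∃ k, HasWinding f k := by
  have hb : ∀ y ∈ Cube.boundary (Fin 2), f y = hopf hopfBase := fun y hy =>
    (f.2 y hy).trans hopf_hopfBase.symm
  have hc : Continuous fun z : (Fin 1 → I) × I => f ![z.2, z.1 0] :=
    (GenLoop.continuous f).comp (by fun_prop)
  obtain ⟨Λ, e1, e2, e3⟩ := exists_hopf_lift ⟨_, hc⟩ (ContinuousMap.const _ hopfBase)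
    (fun x => (hb _ ⟨0, Or.inl rfl⟩).symm)
  have e4 (x : Fin 1 → I) (hx : x 0 = 0 ∨ x 0 = 1) (t : I) : Λ (x, t) = hopfBase :=
    e3 x (fun t => (hb _ ⟨1, by simpa using hx⟩).trans (hb _ ⟨1, by simpa using hx⟩).symm) t
  obtain ⟨θ, t1, t2⟩ := exists_angle (ContinuousMap.const _ hopfBase)
    ⟨fun x => Λ (x, 1), by fun_prop⟩ (fun x => by
      simp only [ContinuousMap.const_apply, ContinuousMap.coe_mk, e1]
      exact (hb _ ⟨0, Or.inr rfl⟩).symm) (x₀ := 0) (by simp [e4])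
  have t3 := t1 1
  simp only [ContinuousMap.const_apply, ContinuousMap.coe_mk, e4 1 (Or.inr rfl)] at t3
  have t4 := Punct.rot_eq_iff.1 (t3.trans (Punct.rot_zero _).symm)
  simp only [ofReal_zero, zero_mul, exp_zero] at t4
  obtain ⟨k, hk⟩ := exp_eq_one_iff.1 t4
  refine ⟨k, ⟨fun y => Λ (fun _ => y 1, y 0), by fun_prop⟩, ⟨fun x => θ fun _ => x, by fun_prop⟩,
    fun y => ?_, fun y hy => ?_, fun y hy => e4 _ (Or.inl hy) _, fun y hy => e4 _ (Or.inr hy) _,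
    fun y hy => ?_, t2, ?_⟩
  · simp only [ContinuousMap.coe_mk, e1]
    congr 1
    ext i; fin_cases i <;> rfl
  · simp only [ContinuousMap.coe_mk, hy, e2]; rfl
  · simp only [ContinuousMap.coe_mk, hy]; exact (t1 _).symm
  · have h5 : (θ 1 : ℂ) = 2 * Real.pi * k := by
      have := mul_right_cancel₀ I_ne_zero (hk.trans (by ring :
        (k : ℂ) * (2 * Real.pi * Complex.I) = (2 * Real.pi * k) * Complex.I))
      exact this
    exact_mod_cast h5

theorem HasWinding.of_cls_eq {f g : Ω^ (Fin 2) (Punct (ℝ × ℂ)) (Punct.incl oneC)} {k : ℤ}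
    (h : HasWinding f k) (hfg : cls f = cls g) : HasWinding g k := by
  obtain ⟨Λ, ϑ, h1, h2, h3, h4, h5, h6, h7⟩ := h
  obtain ⟨H, c, g0, g1, gb⟩ := (cls_eq_iff.1 hfg).exists_homotopy
  obtain ⟨M, e1, e2, e3⟩ := exists_hopf_lift ⟨fun z => H z.2 z.1, c.comp continuous_swap⟩ Λ
    (fun x => (h1 x).trans (g0 x).symm)
  have e4 (y : Fin 2 → I) (i : Fin 2) (hy : y i = 0 ∨ y i = 1) : M (y, 1) = Λ y :=
    e3 y (fun t => (gb t y ⟨i, hy⟩).trans (gb 0 y ⟨i, hy⟩).symm) 1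
  refine ⟨⟨fun y => M (y, 1), by fun_prop⟩, ϑ, fun y => (e1 _).trans (g1 y),
    fun y hy => (e4 y 0 (Or.inl hy)).trans (h2 y hy),
    fun y hy => (e4 y 1 (Or.inl hy)).trans (h3 y hy),
    fun y hy => (e4 y 1 (Or.inr hy)).trans (h4 y hy),
    fun y hy => (e4 y 0 (Or.inr hy)).trans (h5 y hy), h6, h7⟩

theorem HasWinding.unique {f : Ω^ (Fin 2) (Punct (ℝ × ℂ)) (Punct.incl oneC)} {k l : ℤ}
    (h : HasWinding f k) (h' : HasWinding f l) : k = l := by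
  obtain ⟨Λ, ϑ, h1, h2, h3, h4, h5, h6, h7⟩ := h
  obtain ⟨Λ', ϑ', h1', h2', h3', h4', h5', h6', h7'⟩ := h'
  obtain ⟨θ, t1, t2⟩ := exists_angle Λ Λ' (fun y => by rw [h1, h1']) (x₀ := 0)
    (by rw [h2 0 rfl, h2' 0 rfl])
  have side (y) (e : Λ y = hopfBase) (e' : Λ' y = hopfBase) : exp (θ y * Complex.I) = 1 := by
    have := t1 y
    rw [e, e'] at this
    have := Punct.rot_eq_iff.1 (this.trans (Punct.rot_zero _).symm)
    simpa using this
  have a1 := eq_of_exp_I_eq_one (γ := fun s => θ ![s, 0]) (by fun_prop)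
    (fun s => side _ (h3 _ rfl) (h3' _ rfl))
  have a2 := eq_of_exp_I_eq_one (γ := fun s => θ ![0, s]) (by fun_prop)
    (fun s => side _ (h2 _ rfl) (h2' _ rfl))
  have a3 := eq_of_exp_I_eq_one (γ := fun s => θ ![s, 1]) (by fun_prop)
    (fun s => side _ (h4 _ rfl) (h4' _ rfl))
  have a4 := eq_of_exp_I_eq_one (γ := fun s => θ ![1, s] + ϑ s - ϑ' s) (by fun_prop) (fun s => by
    have := t1 ![1, s]
    rw [h5 _ rfl, h5' _ rfl, Punct.rot_rot, Punct.rot_eq_iff] at this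
    simp only [Matrix.cons_val_one, Matrix.cons_val_fin_one] at this
    rw [ofReal_sub, sub_mul, exp_sub, this, div_self (exp_ne_zero _)])
  have a5 : θ ![0, 0] = 0 := (congrArg θ (by ext i; fin_cases i <;> rfl)).trans t2
  have h8 : 2 * Real.pi * k = 2 * Real.pi * l := by linarith
  have := mul_left_cancel₀ (by positivity) h8
  exact_mod_cast this

theorem HasWinding.transAt {f g : Ω^ (Fin 2) (Punct (ℝ × ℂ)) (Punct.incl oneC)} {k l : ℤ}
    (h : HasWinding f k) (h' : HasWinding g l) : HasWinding (GenLoop.transAt 1 f g) (k + l) := by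
  obtain ⟨Λ, ϑ, h1, h2, h3, h4, h5, h6, h7⟩ := h
  obtain ⟨Λ', ϑ', h1', h2', h3', h4', h5', h6', h7'⟩ := h'
  refine ⟨⟨fun y => if (y 1 : ℝ) ≤ 1 / 2 then Λ ![y 0, clampI (2 * y 1)]
      else Λ' ![y 0, clampI (2 * y 1 - 1)], ?_⟩,
    ⟨fun x => ϑ (clampI (2 * x)) + ϑ' (clampI (2 * x - 1)), by fun_prop⟩,
    ?_, ?_, ?_, ?_, ?_, ?_, ?_⟩
  · refine Continuous.if_le (by fun_prop) (by fun_prop) (by fun_prop) (by fun_prop) fun y hy => ?_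
    rw [hy, h4 _ (by simpa using clampI_of_ge (by norm_num)),
      h3' _ (by simpa using clampI_of_le (by norm_num))]
  · intro y
    have e (s : ℝ) : ![y 0, clampI s] = Function.update y 1 (Set.projIcc 0 1 zero_le_one s) := by
      ext i; fin_cases i <;> simp [clampI]
    rw [GenLoop.transAt_apply]
    change hopf (ite _ _ _) = _
    split_ifs
    · rw [h1, e]
    · rw [h1', e]
  · intro y hy
    simp only [ContinuousMap.coe_mk]
    split_ifs
    · exact h2 _ (by simpa using hy)
    · exact h2' _ (by simpa using hy)
  · intro y hy
    simp only [ContinuousMap.coe_mk, hy]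
    rw [if_pos (by simp)]
    exact h3 _ (by simpa using clampI_of_le (by simp))
  · intro y hy
    simp only [ContinuousMap.coe_mk, hy]
    rw [if_neg (by norm_num)]
    exact h4' _ (by simpa using clampI_of_ge (by norm_num))
  · intro y hy
    simp only [ContinuousMap.coe_mk]
    split_ifs with h
    · rw [h5 _ (by simpa using hy), clampI_of_le (t := 2 * y 1 - 1) (by linarith), h6']
      simp
    · rw [h5' _ (by simpa using hy), clampI_of_ge (t := 2 * y 1) (by linarith), h7,
        Punct.rot_eq_iff]
      simp only [Matrix.cons_val_one, Matrix.cons_val_fin_one]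
      rw [show ((2 * Real.pi * k + ϑ' (clampI (2 * y 1 - 1)) : ℝ) : ℂ) * Complex.I =
        ϑ' (clampI (2 * y 1 - 1)) * Complex.I + k * (2 * Real.pi * Complex.I) by push_cast; ring,
        exp_add, exp_int_mul_two_pi_mul_I, mul_one]
  · simp [clampI_of_le, h6, h6']
  · simp only [ContinuousMap.coe_mk]
    rw [clampI_of_ge (by norm_num), clampI_of_ge (by norm_num), h7, h7']
    push_cast; ring

theorem exists_hasWinding_one : ∃ f, HasWinding f 1 := by
  let a : (Fin 2 → I) → ℂ := fun y =>
    (1 - (y 0 : ℝ)) + (y 0 : ℝ) * exp (((2 * Real.pi * (y 1 : ℝ) : ℝ) : ℂ) * Complex.I)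
  let d : (Fin 2 → I) → ℝ := fun y => y 0 * (1 - y 0) * (y 1 * (1 - y 1))
  have ac : Continuous a := by
    have := continuous_ofReal
    fun_prop
  have dc : Continuous d := by fun_prop
  have e2 : exp ((2 * Real.pi : ℝ) * Complex.I) = 1 := by
    push_cast; exact exp_two_pi_mul_I
  have a0 (y) (h : y 0 = 0) : a y = 1 ∧ d y = 0 := by simp [a, d, h]
  have a1 (y) (h : y 1 = 0) : a y = 1 ∧ d y = 0 := by simp [a, d, h]
  have a2 (y) (h : y 1 = 1) : a y = 1 ∧ d y = 0 := by
    refine ⟨?_, by simp [d, h]⟩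
    simp only [a, h, Set.Icc.coe_one, mul_one, e2]
    ring
  have a3 (y) (h : y 0 = 1) :
      a y = exp (((2 * Real.pi * (y 1 : ℝ) : ℝ) : ℂ) * Complex.I) ∧ d y = 0 := by
    simp [a, d, h]
  have hne (y) : (a y, a y + d y) ≠ (0 : ℂ × ℂ) := by
    intro h
    have h1 : a y = 0 := congrArg Prod.fst h
    have h2 : a y + d y = 0 := congrArg Prod.snd h
    rw [h1, zero_add, ofReal_eq_zero] at h2
    simp only [d, mul_eq_zero, sub_eq_zero] at h2
    rcases h2 with (h2 | h2) | (h2 | h2)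
    · rw [(a0 y (Subtype.ext h2)).1] at h1; exact one_ne_zero h1
    · rw [(a3 y (Subtype.ext h2.symm)).1] at h1; exact exp_ne_zero _ h1
    · rw [(a1 y (Subtype.ext h2)).1] at h1; exact one_ne_zero h1
    · rw [(a2 y (Subtype.ext h2.symm)).1] at h1; exact one_ne_zero h1
  let Λ : C(Fin 2 → I, Punct (ℂ × ℂ)) := ⟨fun y => ⟨(a y, a y + d y), hne y⟩, by
    refine Continuous.subtype_mk ?_ _
    have := continuous_ofReal
    fun_prop⟩
  have hΛ (y) (h : a y = 1 ∧ d y = 0) : Λ y = hopfBase :=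
    Subtype.ext (by simp [Λ, h.1, h.2, hopfBase])
  have hΛ1 (y) (h : y 0 = 1) : Λ y = Punct.rot (2 * Real.pi * (y 1 : ℝ)) hopfBase :=
    Subtype.ext (by rw [Punct.rot_coe]; simp [Λ, (a3 y h).1, (a3 y h).2, hopfBase])
  refine ⟨⟨hopf.comp Λ, ?_⟩, Λ, ⟨fun x => 2 * Real.pi * (x : ℝ), by fun_prop⟩, fun y => rfl,
    fun y h => hΛ y (a0 y h), fun y h => hΛ y (a1 y h), fun y h => hΛ y (a2 y h), hΛ1,
    by simp, by simp⟩
  rintro y ⟨i, hi⟩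
  rw [ContinuousMap.comp_apply]
  fin_cases i
  · rcases hi with hi | hi
    · rw [hΛ y (a0 y hi)]; exact hopf_hopfBase
    · rw [hΛ1 y hi, hopf_rot]; exact hopf_hopfBase
  · rcases hi with hi | hi
    · rw [hΛ y (a1 y hi)]; exact hopf_hopfBase
    · rw [hΛ y (a2 y hi)]; exact hopf_hopfBase

theorem not_forall_isSquare_pi_two :
    ¬ ∀ a : HomotopyGroup (Fin 2) (Punct (ℝ × ℂ)) (Punct.incl oneC), IsSquare a := by
  intro h
  obtain ⟨f, hf⟩ := exists_hasWinding_one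
  obtain ⟨b, hb⟩ := h (cls f)
  obtain ⟨g, rfl⟩ := cls_surj b
  obtain ⟨k, hk⟩ := exists_hasWinding g
  rw [← cls_transAt 1] at hb
  have := (hf.of_cls_eq hb).unique (hk.transAt hk)
  omega

end Degree

section Stems

open HomotopyGroup Module

theorem isCyclic_susp {V : Type*} [NormedAddCommGroup V] [NormedSpace ℝ V] [FiniteDimensional ℝ V]
    {n : ℕ} (e : Punct V) (hn : n + 3 < 2 * finrank ℝ V)
    (h : IsCyclic (HomotopyGroup (Fin (n + 1)) (Punct V) e)) :
    IsCyclic (HomotopyGroup (Fin (n + 2)) (Punct (ℝ × V)) (Punct.incl e)) :=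
  isCyclic_of_surjective (suspHom (n := n) e) (suspHom_surjective e hn)

theorem not_forall_isSquare_susp {V : Type*} [NormedAddCommGroup V] [NormedSpace ℝ V]
    [FiniteDimensional ℝ V] {n : ℕ} (e : Punct V) (hn : n + 4 < 2 * finrank ℝ V)
    (h : ¬ ∀ a : HomotopyGroup (Fin (n + 1)) (Punct V) e, IsSquare a) :
    ¬ ∀ a : HomotopyGroup (Fin (n + 2)) (Punct (ℝ × V)) (Punct.incl e), IsSquare a := by
  intro h'
  refine h fun a => ?_
  obtain ⟨b, hb⟩ := h' (suspHom (n := n) e a)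
  obtain ⟨c, rfl⟩ := suspHom_surjective (n := n) e (by omega) b
  exact ⟨c, suspHom_injective (n := n) e hn (by rw [hb, map_mul])⟩

theorem isCyclic_pi_two :
    IsCyclic (HomotopyGroup (Fin 2) (Punct (ℝ × ℂ)) (Punct.incl oneC)) :=
  isCyclic_susp (n := 0) oneC (by simp [Complex.finrank_real_complex]) isCyclic_pi_one

theorem isCyclic_pi_three : IsCyclic
    (HomotopyGroup (Fin 3) (Punct (ℝ × ℝ × ℂ)) (Punct.incl (Punct.incl oneC))) :=
  isCyclic_susp (n := 1) _ (by simp [Complex.finrank_real_complex])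
    isCyclic_pi_two

/-- The base point of `ℝ × ℝ × ℝ × ℝ × ℝ × ℂ`. -/
noncomputable def oneSeven : Punct (ℝ × ℝ × ℝ × ℝ × ℝ × ℂ) :=
  Punct.incl (Punct.incl (Punct.incl (Punct.incl (Punct.incl oneC))))

theorem isCyclic_pi_six :
    IsCyclic (HomotopyGroup (Fin 6) (Punct (ℝ × ℝ × ℝ × ℝ × ℝ × ℂ)) oneSeven) :=
  isCyclic_susp (n := 4) _ (by simp [Complex.finrank_real_complex]) <|
  isCyclic_susp (n := 3) _ (by simp [Complex.finrank_real_complex]) <|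
  isCyclic_susp (n := 2) _ (by simp [Complex.finrank_real_complex])
    isCyclic_pi_three

theorem not_forall_isSquare_pi_six :
    ¬ ∀ a : HomotopyGroup (Fin 6) (Punct (ℝ × ℝ × ℝ × ℝ × ℝ × ℂ)) oneSeven, IsSquare a :=
  not_forall_isSquare_susp (n := 4) _
    (by simp [Complex.finrank_real_complex]) <|
  not_forall_isSquare_susp (n := 3) _
    (by simp [Complex.finrank_real_complex]) <|
  not_forall_isSquare_susp (n := 2) _
    (by simp [Complex.finrank_real_complex]) <|
  not_forall_isSquare_susp (n := 1) _
    (by simp [Complex.finrank_real_complex]) not_forall_isSquare_pi_two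

theorem nonempty_hopf_mulEquiv {m : ℕ} (hm : 2 ≤ m) (w : Punct (ℝ × ℝ × ℂ)) :
    Nonempty (HomotopyGroup (Fin (m + 1)) (Punct (ℝ × ℂ)) (Punct.incl oneC) ≃*
      HomotopyGroup (Fin (m + 1)) (Punct (ℝ × ℝ × ℂ)) w) := by
  obtain ⟨e⟩ := Punct.nonempty_mulEquiv (N := Fin (m + 1)) (V := ℂ × ℂ) (W := ℝ × ℝ × ℂ)
    (by simp [Complex.finrank_real_complex]) hopfBase w
  exact ⟨(MulEquiv.ofBijective _
    ⟨hopf_map_injective (m := m) (by omega), hopf_map_surjective hm⟩).symm.trans e⟩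

theorem isCyclic_pi_four (w : Punct (ℝ × ℝ × ℂ)) :
    IsCyclic (HomotopyGroup (Fin 4) (Punct (ℝ × ℝ × ℂ)) w) := by
  obtain ⟨e⟩ := nonempty_hopf_mulEquiv le_rfl (Punct.incl (Punct.incl oneC))
  have := isCyclic_pi_three
  have h3 : IsCyclic (HomotopyGroup (Fin 3) (Punct (ℝ × ℂ)) (Punct.incl oneC)) :=
    isCyclic_of_surjective e.symm e.symm.surjective
  have h4 := isCyclic_susp (n := 2) _
    (by simp [Complex.finrank_real_complex]) h3
  obtain ⟨e'⟩ := Punct.nonempty_mulEquiv (N := Fin 4) (V := ℝ × ℝ × ℂ) rfl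
    (Punct.incl (Punct.incl oneC)) w
  exact isCyclic_of_surjective e' e'.surjective

end Stems

section Reflections

open HomotopyGroup ComplexConjugate

variable {V : Type*} [NormedAddCommGroup V] [NormedSpace ℝ V]

theorem mixUp_linearIsometry (A : V →ₗᵢ[ℝ] V) (w w' : ℝ × V) (r : ℝ) :
    mixUp (w.1, A w.2) (w'.1, A w'.2) r = ((mixUp w w' r).1, A (mixUp w w' r).2) := by
  have h (w : ℝ × V) : height (w.1, A w.2) = height w := by simp [height]
  have hA : (1 - r) • A w.2 + r • A w'.2 = A ((1 - r) • w.2 + r • w'.2) := by simp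
  simp only [mixUp, h, hA, A.norm_map]

theorem suspPath_linearIsometry (A : V →ₗᵢ[ℝ] V) (e : Punct V) (he : A e = e) (w : ℝ × V) (t : ℝ) :
    suspPath e (w.1, A w.2) t = ((suspPath e w t).1, A (suspPath e w t).2) := by
  have h (r : ℝ) := mixUp_linearIsometry A w (Punct.incl e) r
  have h' (r : ℝ) := mixUp_linearIsometry A (reflR w) (Punct.incl e) r
  have e1 : (((Punct.incl e : ℝ × V)).1, A ((Punct.incl e : ℝ × V)).2) = (Punct.incl e : ℝ × V) :=
    Prod.ext rfl he
  rw [e1] at h h'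
  unfold suspPath
  split_ifs
  · simp only [mixDown, reflR_incl]
    exact congrArg reflR (h' _)
  · exact h _

/-- The self-map of the punctured space induced by an injective linear map. -/
def Punct.mapOfInjective (A : V →L[ℝ] V) (hA : ∀ v, A v = 0 → v = 0) : C(Punct V, Punct V) :=
  ⟨fun v => ⟨A v, fun h => v.2 (hA _ h)⟩, by fun_prop⟩

theorem Punct.mapOfInjective_coe (A : V →L[ℝ] V) (hA : ∀ v, A v = 0 → v = 0) (v : Punct V) :
    (Punct.mapOfInjective A hA v : V) = A v := rfl

/-- The reflection of the suspension. -/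
def Punct.reflect : C(Punct (ℝ × V), Punct (ℝ × V)) :=
  ⟨fun v => ⟨reflR v, reflR_ne_zero v.2⟩, Continuous.subtype_mk
    (continuous_reflR.comp continuous_subtype_val) _⟩

theorem Punct.reflect_incl (e : Punct V) : Punct.reflect (Punct.incl e) = Punct.incl e :=
  Subtype.ext (reflR_incl e)

theorem map_reflect_suspHom {n : ℕ} (e : Punct V) (a : HomotopyGroup (Fin (n + 1)) (Punct V) e) :
    HomotopyGroup.map (x := Punct.incl e) (y := Punct.incl e) Punct.reflect (Punct.reflect_incl e)
      (suspHom e a) = (suspHom e a)⁻¹ := by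
  obtain ⟨g, rfl⟩ := cls_surj a
  rw [suspHom_cls, map_cls, ← cls_symmAt 0]
  congr 1
  ext1 y
  apply Subtype.ext
  rw [GenLoop.map_apply, GenLoop.symmAt_apply, suspLoop_coe]
  refine (reflR_suspPath e (Band.incl (g (Fin.tail y))) (y 0)).trans ?_
  have h1 : (Fin.tail fun j => if j = 0 then σ (y 0) else y j) = Fin.tail y := by
    ext j; simp [Fin.tail]
  rw [h1]
  simp [reflR, Band.incl]

/-- Conjugation on `ℝ × ℂ`. -/
noncomputable def conjRC : (ℝ × ℂ) →ₗᵢ[ℝ] (ℝ × ℂ) where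
  toFun v := (v.1, conj v.2)
  map_add' v w := by simp
  map_smul' c v := by simp
  norm_map' v := by simp [Prod.norm_def]

theorem conjRC_apply (v : ℝ × ℂ) : conjRC v = (v.1, conj v.2) := rfl

/-- Conjugation on the punctured space `ℝ × ℂ`. -/
noncomputable def Punct.conjRC : C(Punct (ℝ × ℂ), Punct (ℝ × ℂ)) :=
  Punct.mapOfInjective _root_.conjRC.toContinuousLinearMap fun v h => by
    have h1 : ‖_root_.conjRC v‖ = 0 := by rw [show _root_.conjRC v = 0 from h, norm_zero]
    rwa [LinearIsometry.norm_map, norm_eq_zero] at h1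

theorem Punct.conjRC_base : Punct.conjRC (Punct.incl oneC) = Punct.incl oneC :=
  Subtype.ext (Prod.ext rfl (by simp [conjRC, mapOfInjective_coe, conjRC_apply, incl, oneC]))

/-- Simultaneous rotation of the imaginary parts. -/
noncomputable def rotIm (t : ℝ) (q : ℂ × ℂ) : ℂ × ℂ :=
  (⟨q.1.re, Real.cos t * q.1.im - Real.sin t * q.2.im⟩,
    ⟨q.2.re, Real.sin t * q.1.im + Real.cos t * q.2.im⟩)

theorem rotIm_ne_zero (t : ℝ) {q : ℂ × ℂ} (h : q ≠ 0) : rotIm t q ≠ 0 := by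
  intro h0
  have h1 := congrArg (fun q : ℂ × ℂ => q.1.re) h0
  have h2 := congrArg (fun q : ℂ × ℂ => q.2.re) h0
  have h3 := congrArg (fun q : ℂ × ℂ => q.1.im) h0
  have h4 := congrArg (fun q : ℂ × ℂ => q.2.im) h0
  simp only [rotIm, Prod.fst_zero, Prod.snd_zero, Complex.zero_re, Complex.zero_im] at h1 h2 h3 h4
  have h5 := Real.cos_sq_add_sin_sq t
  refine h (Prod.ext (Complex.ext h1 ?_) (Complex.ext h2 ?_))
  · simp only [Prod.fst_zero, Complex.zero_im]
    linear_combination Real.cos t * h3 + Real.sin t * h4 - q.1.im * h5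
  · simp only [Prod.snd_zero, Complex.zero_im]
    linear_combination Real.cos t * h4 - Real.sin t * h3 - q.2.im * h5

theorem continuous_complex_mk {Z : Type*} [TopologicalSpace Z] {f g : Z → ℝ} (hf : Continuous f)
    (hg : Continuous g) : Continuous fun z => (⟨f z, g z⟩ : ℂ) :=
  Complex.equivRealProdCLM.symm.continuous.comp (hf.prodMk hg)

theorem continuous_rotIm {Z : Type*} [TopologicalSpace Z] {t : Z → ℝ} {q : Z → ℂ × ℂ}
    (ht : Continuous t) (hq : Continuous q) : Continuous fun z => rotIm (t z) (q z) := by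
  unfold rotIm
  have := Complex.continuous_im
  have := Complex.continuous_re
  exact (continuous_complex_mk (by fun_prop) (by fun_prop)).prodMk
    (continuous_complex_mk (by fun_prop) (by fun_prop))

/-- `rotIm` on the punctured space. -/
noncomputable def Punct.rotIm (t : ℝ) : C(Punct (ℂ × ℂ), Punct (ℂ × ℂ)) :=
  ⟨fun q => ⟨_root_.rotIm t q, rotIm_ne_zero t q.2⟩, by
    refine Continuous.subtype_mk (continuous_rotIm ?_ ?_) _ <;> fun_prop⟩

theorem Punct.rotIm_base (t : ℝ) : Punct.rotIm t hopfBase = hopfBase :=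
  Subtype.ext (Prod.ext (Complex.ext
      (by simp [rotIm, _root_.rotIm, hopfBase])
    (by simp [rotIm, _root_.rotIm, hopfBase])) (Complex.ext
      (by simp [rotIm, _root_.rotIm, hopfBase])
    (by simp [rotIm, _root_.rotIm, hopfBase])))

theorem hopf_rotIm_pi (q : Punct (ℂ × ℂ)) :
    hopf (Punct.rotIm Real.pi q) = Punct.conjRC (hopf q) := by
  have h (q : ℂ × ℂ) : rotIm Real.pi q = (conj q.1, conj q.2) :=
    Prod.ext (Complex.ext (by simp [rotIm]) (by simp [rotIm]))
      (Complex.ext (by simp [rotIm]) (by simp [rotIm]))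
  apply Subtype.ext
  change hopfFun (rotIm Real.pi q) = conjRC (hopfFun q)
  rw [h, conjRC_apply]
  simp [hopfFun, Complex.normSq_conj]

theorem map_conjRC (a : HomotopyGroup (Fin 3) (Punct (ℝ × ℂ)) (Punct.incl oneC)) :
    HomotopyGroup.map (x := Punct.incl oneC) (y := Punct.incl oneC) Punct.conjRC
      Punct.conjRC_base a = a := by
  obtain ⟨b, rfl⟩ := hopf_map_surjective (m := 2) le_rfl a
  have h1 := map_eq_map (x := hopfBase) (y := hopfBase) (ContinuousMap.id _) (Punct.rotIm Real.pi)
    rfl (Punct.rotIm_base _) (fun t q => Punct.rotIm (t * Real.pi) q) (by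
      refine Continuous.subtype_mk (continuous_rotIm ?_ ?_) _ <;> fun_prop)
    (fun q => by
      apply Subtype.ext
      change rotIm (0 * Real.pi) q = q
      refine Prod.ext (Complex.ext ?_ ?_) (Complex.ext ?_ ?_) <;> simp [rotIm])
    (fun q => by simp) (fun t => Punct.rotIm_base _) b
  rw [map_id (x := hopfBase) (ContinuousMap.id _) rfl (fun _ => rfl)] at h1
  conv_rhs => rw [h1]
  obtain ⟨f, rfl⟩ := cls_surj b
  exact congrArg cls (GenLoop.ext _ _ fun y => (hopf_rotIm_pi (f y)).symm)

/-- A path of reflections from `1 × conj` to the reflection in the suspension coordinate. -/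
noncomputable def swing (t : ℝ) (y : ℝ × ℝ × ℂ) : ℝ × ℝ × ℂ :=
  (Real.cos t * y.1 + Real.sin t * y.2.2.im, y.2.1,
    ⟨y.2.2.re, Real.sin t * y.1 - Real.cos t * y.2.2.im⟩)

theorem swing_swing (t : ℝ) (y : ℝ × ℝ × ℂ) : swing t (swing t y) = y := by
  have h5 := Real.cos_sq_add_sin_sq t
  refine Prod.ext ?_ (Prod.ext rfl (Complex.ext rfl ?_))
  · simp only [swing]
    linear_combination y.1 * h5
  · simp only [swing]
    linear_combination y.2.2.im * h5

theorem swing_ne_zero (t : ℝ) {y : ℝ × ℝ × ℂ} (h : y ≠ 0) : swing t y ≠ 0 := by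
  intro h0
  apply h
  rw [← swing_swing t y, h0]
  refine Prod.ext ?_ (Prod.ext rfl (Complex.ext rfl ?_)) <;> simp [swing]

theorem continuous_swing {Z : Type*} [TopologicalSpace Z] {t : Z → ℝ} {y : Z → ℝ × ℝ × ℂ}
    (ht : Continuous t) (hy : Continuous y) : Continuous fun z => swing (t z) (y z) := by
  unfold swing
  have := Complex.continuous_im
  have := Complex.continuous_re
  exact Continuous.prodMk (by fun_prop) (Continuous.prodMk (by fun_prop)
    (continuous_complex_mk (by fun_prop) (by fun_prop)))

/-- `swing` on the punctured space. -/
noncomputable def Punct.swing (t : ℝ) : C(Punct (ℝ × ℝ × ℂ), Punct (ℝ × ℝ × ℂ)) :=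
  ⟨fun q => ⟨_root_.swing t q, swing_ne_zero t q.2⟩, by
    refine Continuous.subtype_mk (continuous_swing ?_ ?_) _ <;> fun_prop⟩

theorem Punct.swing_base (t : ℝ) :
    Punct.swing t (Punct.incl (Punct.incl oneC)) = Punct.incl (Punct.incl oneC) := by
  apply Subtype.ext
  change _root_.swing t (0, 0, 1) = (0, 0, 1)
  refine Prod.ext ?_ (Prod.ext rfl (Complex.ext rfl ?_)) <;> simp [_root_.swing]

theorem map_swing_zero_suspHom (a : HomotopyGroup (Fin 3) (Punct (ℝ × ℂ)) (Punct.incl oneC)) :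
    HomotopyGroup.map (x := Punct.incl (Punct.incl oneC)) (y := Punct.incl (Punct.incl oneC))
      (Punct.swing 0) (Punct.swing_base 0) (suspHom (n := 2) (Punct.incl oneC) a) =
    suspHom (n := 2) (Punct.incl oneC) a := by
  conv_rhs => rw [← map_conjRC a]
  obtain ⟨g, rfl⟩ := cls_surj a
  rw [map_cls, suspHom_cls, suspHom_cls, map_cls]
  congr 1
  ext1 y
  apply Subtype.ext
  rw [suspLoop_coe, GenLoop.map_apply]
  have h := suspPath_linearIsometry conjRC (Punct.incl oneC)
    (congrArg Subtype.val Punct.conjRC_base) (Band.incl (g (Fin.tail y))) (y 0)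
  refine Eq.trans ?_ h.symm
  change _root_.swing 0 (suspPath (Punct.incl oneC) (Band.incl (g (Fin.tail y))) (y 0)) = _
  rw [conjRC_apply]
  refine Prod.ext ?_ (Prod.ext rfl (Complex.ext rfl ?_)) <;> simp [_root_.swing]

theorem mul_self_pi_four_base
    (a : HomotopyGroup (Fin 4) (Punct (ℝ × ℝ × ℂ)) (Punct.incl (Punct.incl oneC))) : a * a = 1 := by
  obtain ⟨b, rfl⟩ := suspHom_surjective (n := 2) (Punct.incl oneC)
    (by simp [Complex.finrank_real_complex]) a
  have h1 := map_eq_map (x := Punct.incl (Punct.incl oneC)) (y := Punct.incl (Punct.incl oneC))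
    (Punct.swing 0) Punct.reflect (Punct.swing_base 0) (Punct.reflect_incl _)
    (fun t q => Punct.swing (t * Real.pi) q) (by
      refine Continuous.subtype_mk (continuous_swing ?_ ?_) _ <;> fun_prop)
    (fun q => by simp)
    (fun q => by
      apply Subtype.ext
      change swing (1 * Real.pi) q = reflR q
      refine Prod.ext ?_ (Prod.ext rfl (Complex.ext rfl ?_)) <;> simp [swing, reflR])
    (fun t => Punct.swing_base _) (suspHom (n := 2) (Punct.incl oneC) b)
  rw [map_swing_zero_suspHom, map_reflect_suspHom] at h1
  nth_rewrite 1 [h1]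
  exact inv_mul_cancel _

theorem mul_self_pi_four (w : Punct (ℝ × ℝ × ℂ))
    (a : HomotopyGroup (Fin 4) (Punct (ℝ × ℝ × ℂ)) w) : a * a = 1 := by
  obtain ⟨e⟩ := Punct.nonempty_mulEquiv (N := Fin 4) (V := ℝ × ℝ × ℂ) rfl w
    (Punct.incl (Punct.incl oneC))
  exact e.injective (by rw [map_mul, mul_self_pi_four_base, map_one])

end Reflections

section Collapse

variable {V Z : Type*}

open Classical in
/-- The map collapsing the complement of the image of `β` to the point at infinity. -/
noncomputable def OnePoint.collapse (β : V → Z) (z : Z) : OnePoint V :=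
  if h : ∃ e, β e = z then (h.choose : OnePoint V) else OnePoint.infty

theorem OnePoint.collapse_eq_coe_iff {β : V → Z} (hβ : Function.Injective β) {z : Z} {e : V} :
    OnePoint.collapse β z = e ↔ β e = z := by
  unfold OnePoint.collapse
  split_ifs with h
  · rw [OnePoint.coe_eq_coe]
    exact ⟨fun h' => h' ▸ h.choose_spec, fun h' => hβ (h.choose_spec.trans h'.symm)⟩
  · exact ⟨fun h' => absurd h' (OnePoint.infty_ne_coe _), fun h' => absurd ⟨e, h'⟩ h⟩

theorem OnePoint.collapse_apply {β : V → Z} (hβ : Function.Injective β) (e : V) :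
    OnePoint.collapse β (β e) = e :=
  (OnePoint.collapse_eq_coe_iff hβ).2 rfl

theorem OnePoint.collapse_eq_infty_iff {β : V → Z} {z : Z} :
    OnePoint.collapse β z = OnePoint.infty ↔ z ∉ Set.range β := by
  unfold OnePoint.collapse
  split_ifs with h
  · exact ⟨fun h' => absurd h' (OnePoint.coe_ne_infty _), fun h' => absurd h h'⟩
  · exact ⟨fun _ => h, fun _ => rfl⟩

theorem OnePoint.continuous_collapse [TopologicalSpace V] [TopologicalSpace Z] [T2Space Z]
    {β : V → Z} (hβ : IsOpenEmbedding β) : Continuous (OnePoint.collapse β) := by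
  refine continuous_def.2 fun s hs => ?_
  rw [OnePoint.isOpen_def] at hs
  by_cases h : OnePoint.infty ∈ s
  · have : (OnePoint.collapse β ⁻¹' s)ᶜ = β '' ((↑) ⁻¹' s : Set V)ᶜ := by
      ext z
      by_cases hz : z ∈ Set.range β
      · obtain ⟨e, rfl⟩ := hz
        simp [OnePoint.collapse_apply hβ.injective, hβ.injective.eq_iff]
      · simp only [Set.mem_compl_iff, Set.mem_preimage, OnePoint.collapse_eq_infty_iff.2 hz, h,
          not_true_eq_false, false_iff]
        exact fun ⟨e, _, he⟩ => hz ⟨e, he⟩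
    rw [← isClosed_compl_iff, this]
    exact ((hs.1 h).image hβ.continuous).isClosed
  · have : OnePoint.collapse β ⁻¹' s = β '' ((↑) ⁻¹' s : Set V) := by
      ext z
      by_cases hz : z ∈ Set.range β
      · obtain ⟨e, rfl⟩ := hz
        simp [OnePoint.collapse_apply hβ.injective, hβ.injective.eq_iff]
      · simp only [Set.mem_preimage, OnePoint.collapse_eq_infty_iff.2 hz, h, false_iff]
        exact fun ⟨e, _, he⟩ => hz ⟨e, he⟩
    rw [this]
    exact hβ.isOpenMap _ hs.2

/-- The homeomorphism of a normed space onto its open unit ball, as a map to the space. -/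
noncomputable def ballMap {V : Type*} [NormedAddCommGroup V] [NormedSpace ℝ V] (e : V) : V :=
  Homeomorph.unitBall e

variable [NormedAddCommGroup V] [NormedSpace ℝ V]

theorem isOpenEmbedding_ballMap : IsOpenEmbedding (ballMap : V → V) :=
  Metric.isOpen_ball.isOpenEmbedding_subtypeVal.comp Homeomorph.unitBall.isOpenEmbedding

theorem injective_ballMap : Function.Injective (ballMap : V → V) :=
  isOpenEmbedding_ballMap.injective

theorem norm_ballMap_lt (e : V) : ‖ballMap e‖ < 1 :=
  mem_ball_zero_iff.1 (Homeomorph.unitBall e).2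

theorem mem_range_ballMap {x : V} : x ∈ Set.range (ballMap : V → V) ↔ ‖x‖ < 1 := by
  refine ⟨fun ⟨e, he⟩ => he ▸ norm_ballMap_lt e, fun h => ?_⟩
  exact ⟨Homeomorph.unitBall.symm ⟨x, mem_ball_zero_iff.2 h⟩, by simp [ballMap]⟩

theorem ballMap_eq_smul (e : V) : ∃ k : ℝ, 0 < k ∧ ballMap e = k • e :=
  ⟨(√(1 + ‖e‖ ^ 2))⁻¹, by positivity, by
    rw [ballMap, Homeomorph.unitBall_apply_coe, OpenPartialHomeomorph.univUnitBall_apply]⟩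

theorem OnePoint.collapse_ballMap_eq_infty_iff {x : V} :
    OnePoint.collapse ballMap x = OnePoint.infty ↔ 1 ≤ ‖x‖ := by
  rw [OnePoint.collapse_eq_infty_iff, mem_range_ballMap, not_lt]

theorem OnePoint.continuous_collapse_ballMap :
    Continuous (OnePoint.collapse ballMap : V → OnePoint V) :=
  OnePoint.continuous_collapse isOpenEmbedding_ballMap

/-- Translate by `-a`, then collapse the complement of the unit ball. -/
noncomputable def OnePoint.zoom (a : V) (A : OnePoint V) : OnePoint V :=
  A.elim OnePoint.infty fun e => OnePoint.collapse ballMap (e - a)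

@[simp] theorem OnePoint.zoom_infty (a : V) :
    OnePoint.zoom a OnePoint.infty = OnePoint.infty := rfl

@[simp] theorem OnePoint.zoom_coe (a e : V) :
    OnePoint.zoom a (e : OnePoint V) = OnePoint.collapse ballMap (e - a) := rfl

theorem OnePoint.zoom_eq_coe_iff {a : V} {A : OnePoint V} {e : V} :
    OnePoint.zoom a A = e ↔ A = ((a + ballMap e : V) : OnePoint V) := by
  induction A using OnePoint.rec with
  | infty => simp
  | coe x =>
    rw [OnePoint.zoom_coe, OnePoint.collapse_eq_coe_iff injective_ballMap, OnePoint.coe_eq_coe,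
      eq_sub_iff_add_eq', eq_comm]

theorem OnePoint.zoom_ne_infty {a : V} {A : OnePoint V} (h : OnePoint.zoom a A ≠ OnePoint.infty) :
    ∃ e : V, A = e ∧ ‖e - a‖ < 1 := by
  induction A using OnePoint.rec with
  | infty => simp at h
  | coe x =>
    refine ⟨x, rfl, ?_⟩
    rwa [OnePoint.zoom_coe, ne_eq, OnePoint.collapse_ballMap_eq_infty_iff, not_le] at h

theorem OnePoint.continuous_zoom [FiniteDimensional ℝ V] {T : Type*} [TopologicalSpace T]
    {a : T → V} (ha : Continuous a) {R : ℝ} (hR : ∀ t, ‖a t‖ ≤ R) :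
    Continuous fun p : T × OnePoint V => OnePoint.zoom (a p.1) p.2 := by
  rw [continuous_iff_continuousAt]
  rintro ⟨t, A⟩
  induction A using OnePoint.rec with
  | infty =>
    have hc : IsClosed ((↑) '' Metric.closedBall (0 : V) (R + 1) : Set (OnePoint V)) :=
      (((ProperSpace.isCompact_closedBall _ _).image OnePoint.continuous_coe)).isClosed
    refine continuousAt_const.congr (f := fun _ => OnePoint.infty) ?_
    have : ∀ᶠ p : T × OnePoint V in 𝓝 (t, OnePoint.infty),
        p.2 ∈ ((↑) '' Metric.closedBall (0 : V) (R + 1) : Set (OnePoint V))ᶜ :=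
      continuous_snd.continuousAt.eventually (hc.isOpen_compl.mem_nhds (by simp))
    filter_upwards [this] with p hp
    by_contra hne
    obtain ⟨e, he, h1⟩ := OnePoint.zoom_ne_infty (Ne.symm hne)
    refine hp ⟨e, mem_closedBall_zero_iff.2 ?_, he.symm⟩
    have := norm_add_le (e - a p.1) (a p.1)
    rw [sub_add_cancel] at this
    linarith [hR p.1]
  | coe x =>
    have hemb : IsOpenEmbedding (Prod.map id (↑) : T × V → T × OnePoint V) :=
      IsOpenEmbedding.id.prodMap OnePoint.isOpenEmbedding_coe
    refine (hemb.continuousAt_iff (x := (t, x))).1 (Continuous.continuousAt ?_)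
    exact OnePoint.continuous_collapse_ballMap.comp
      (continuous_snd.sub (ha.comp continuous_fst))

/-- The map `OnePoint V × OnePoint W → OnePoint (V × W)` collapsing the axes at infinity. -/
noncomputable def OnePoint.smash {V W : Type*} (p : OnePoint V × OnePoint W) : OnePoint (V × W) :=
  OnePoint.collapse (Prod.map (↑) (↑)) p

theorem OnePoint.continuous_smash {V W : Type*} [TopologicalSpace V] [TopologicalSpace W]
    [T2Space V] [T2Space W] [LocallyCompactSpace V] [LocallyCompactSpace W] :
    Continuous (OnePoint.smash : OnePoint V × OnePoint W → OnePoint (V × W)) :=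
  OnePoint.continuous_collapse (OnePoint.isOpenEmbedding_coe.prodMap OnePoint.isOpenEmbedding_coe)

theorem OnePoint.smash_eq_coe_iff {V W : Type*} {p : OnePoint V × OnePoint W} {e : V × W} :
    OnePoint.smash p = e ↔ p = ((e.1 : OnePoint V), (e.2 : OnePoint W)) := by
  rw [OnePoint.smash, OnePoint.collapse_eq_coe_iff
    (OnePoint.coe_injective.prodMap OnePoint.coe_injective), eq_comm]
  rfl

theorem OnePoint.smash_ne_infty {V W : Type*} {p : OnePoint V × OnePoint W}
    (h : OnePoint.smash p ≠ OnePoint.infty) :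
    p.1 ≠ OnePoint.infty ∧ p.2 ≠ OnePoint.infty := by
  obtain ⟨e, he⟩ := OnePoint.ne_infty_iff_exists.1 h
  rw [OnePoint.smash_eq_coe_iff.1 he.symm]
  simp

end Collapse

/-- The one-point compactification of `ℂ × ℝ`, a 3-sphere. -/
abbrev SphThree : Type := OnePoint (ℂ × ℝ)

/-- The one-point compactification of `(ℂ × ℝ) × (ℂ × ℝ)`, a 6-sphere. -/
abbrev SphSix : Type := OnePoint ((ℂ × ℝ) × (ℂ × ℝ))

section PairMap

/-- The map from pairs of points of the 3-sphere to the 6-sphere which records a pair as seen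
in small balls around `(α, 0)` and `(-α, 0)`. -/
noncomputable def pairMap (α : ℂ) (A B : SphThree) : SphSix :=
  OnePoint.smash (OnePoint.zoom ((α, 0) : ℂ × ℝ) A, OnePoint.zoom ((-α, 0) : ℂ × ℝ) B)

theorem pairMap_infty_left (α : ℂ) (B : SphThree) :
    pairMap α OnePoint.infty B = OnePoint.infty := by
  by_contra h
  exact (OnePoint.smash_ne_infty h).1 rfl

theorem pairMap_infty_right (α : ℂ) (A : SphThree) :
    pairMap α A OnePoint.infty = OnePoint.infty := by
  by_contra h
  exact (OnePoint.smash_ne_infty h).2 rfl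

theorem pairMap_eq_coe_iff {α : ℂ} {A B : SphThree} {e : (ℂ × ℝ) × (ℂ × ℝ)} :
    pairMap α A B = e ↔ A = (((α, 0) + ballMap e.1 : ℂ × ℝ) : SphThree) ∧
      B = (((-α, 0) + ballMap e.2 : ℂ × ℝ) : SphThree) := by
  rw [pairMap, OnePoint.smash_eq_coe_iff, Prod.mk.injEq, OnePoint.zoom_eq_coe_iff,
    OnePoint.zoom_eq_coe_iff]

theorem Continuous.pairMap {T : Type*} [TopologicalSpace T] {α : T → ℂ} {A B : T → SphThree}
    (hα : Continuous α) (hn : ∀ t, ‖α t‖ = 2) (hA : Continuous A) (hB : Continuous B) :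
    Continuous fun t => pairMap (α t) (A t) (B t) := by
  have h1 := OnePoint.continuous_zoom (a := fun t => ((α t, 0) : ℂ × ℝ)) (by fun_prop)
    (R := 2) (fun t => by simp [Prod.norm_def, hn t])
  have h2 := OnePoint.continuous_zoom (a := fun t => ((-α t, 0) : ℂ × ℝ)) (by fun_prop)
    (R := 2) (fun t => by simp [Prod.norm_def, hn t])
  exact OnePoint.continuous_smash.comp
    ((h1.comp (continuous_id.prodMk hA)).prodMk (h2.comp (continuous_id.prodMk hB)))

theorem pairMap_eq_infty_of_smul_eq {α : ℂ} (hα : ‖α‖ = 2) {e e' : ℂ × ℝ} {k k' : ℝ}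
    (hk : 0 < k) (hk' : 0 < k') (h : k • e.1 = k' • e'.1) :
    pairMap α e e' = OnePoint.infty := by
  by_contra hne
  obtain ⟨h1, h2⟩ := OnePoint.smash_ne_infty hne
  obtain ⟨x, hx, h1⟩ := OnePoint.zoom_ne_infty (A := (e : SphThree)) h1
  obtain ⟨x', hx', h2⟩ := OnePoint.zoom_ne_infty (A := (e' : SphThree)) h2
  obtain rfl := OnePoint.coe_injective hx
  obtain rfl := OnePoint.coe_injective hx'
  have h1 : ‖e.1 - α‖ < 1 := (norm_fst_le (e - ((α, 0) : ℂ × ℝ))).trans_lt h1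
  have h2 : ‖e'.1 - -α‖ < 1 := (norm_fst_le (e' - ((-α, 0) : ℂ × ℝ))).trans_lt h2
  have h3 : (k + k') • α = k' • (e'.1 - -α) - k • (e.1 - α) := by
    rw [smul_sub, smul_sub, h, smul_neg, add_smul]; ring
  have h4 := norm_sub_le (k' • (e'.1 - -α)) (k • (e.1 - α))
  rw [← h3, norm_smul, norm_smul, norm_smul, hα, Real.norm_of_nonneg hk.le,
    Real.norm_of_nonneg hk'.le, Real.norm_of_nonneg (by positivity)] at h4
  nlinarith

theorem pairMap_self {α : ℂ} (hα : ‖α‖ = 2) (A : SphThree) :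
    pairMap α A A = OnePoint.infty := by
  induction A using OnePoint.rec with
  | infty => exact pairMap_infty_left _ _
  | coe x => exact pairMap_eq_infty_of_smul_eq hα one_pos one_pos rfl

theorem pairMap_collapse {α : ℂ} (hα : ‖α‖ = 2) (w : ℂ) (t t' : ℝ) :
    pairMap α (OnePoint.collapse ballMap (w, t)) (OnePoint.collapse ballMap (w, t')) =
      OnePoint.infty := by
  by_cases h1 : OnePoint.collapse ballMap (w, t) = OnePoint.infty
  · rw [h1, pairMap_infty_left]
  by_cases h2 : OnePoint.collapse ballMap (w, t') = OnePoint.infty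
  · rw [h2, pairMap_infty_right]
  obtain ⟨e, he⟩ := OnePoint.ne_infty_iff_exists.1 h1
  obtain ⟨e', he'⟩ := OnePoint.ne_infty_iff_exists.1 h2
  have g := (OnePoint.collapse_eq_coe_iff injective_ballMap).1 he.symm
  have g' := (OnePoint.collapse_eq_coe_iff injective_ballMap).1 he'.symm
  obtain ⟨k, hk, hke⟩ := ballMap_eq_smul e
  obtain ⟨k', hk', hke'⟩ := ballMap_eq_smul e'
  rw [← he, ← he']
  refine pairMap_eq_infty_of_smul_eq hα hk hk' ?_
  have hleft := congrArg Prod.fst (hke.symm.trans g)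
  have hright := congrArg Prod.fst (hke'.symm.trans g')
  exact hleft.trans hright.symm

/-- The exchange of the two factors on the 6-sphere. -/
noncomputable def swapSix : SphSix ≃ₜ SphSix :=
  (Homeomorph.prodComm (ℂ × ℝ) (ℂ × ℝ)).onePointCongr

@[simp] theorem swapSix_infty : swapSix OnePoint.infty = OnePoint.infty := rfl

theorem swapSix_coe (e : (ℂ × ℝ) × (ℂ × ℝ)) :
    swapSix (e : SphSix) = ((e.2, e.1) : (ℂ × ℝ) × (ℂ × ℝ)) := rfl

theorem swapSix_swapSix (A : SphSix) : swapSix (swapSix A) = A := by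
  induction A using OnePoint.rec <;> rfl

theorem swapSix_pairMap (α : ℂ) (A B : SphThree) :
    swapSix (pairMap α A B) = pairMap (-α) B A := by
  by_cases h : pairMap α A B = OnePoint.infty
  · by_cases h' : pairMap (-α) B A = OnePoint.infty
    · rw [h, h', swapSix_infty]
    · obtain ⟨e, he⟩ := OnePoint.ne_infty_iff_exists.1 h'
      have g := pairMap_eq_coe_iff.1 he.symm
      rw [neg_neg] at g
      rw [pairMap_eq_coe_iff (e := (e.2, e.1)) |>.2 ⟨g.2, g.1⟩] at h
      exact absurd h (OnePoint.coe_ne_infty _)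
  · obtain ⟨e, he⟩ := OnePoint.ne_infty_iff_exists.1 h
    have g := pairMap_eq_coe_iff.1 he.symm
    rw [← he, swapSix_coe, eq_comm, pairMap_eq_coe_iff, neg_neg]
    exact ⟨g.2, g.1⟩

end PairMap

section LinkMap

/-- The ring coordinate: the solid torus around the circle of radius two in `ℂ × ℝ`, mapped to
its meridian disc rotated by the angle. -/
noncomputable def linkW (u : ℂ) (s : ℝ) : ℂ :=
  u / (max ‖u‖ 1 : ℝ) * ⟨‖u‖ - 2, s⟩

/-- A map from `ℂ × ℝ × ℝ` to the 3-sphere representing the generator of the fourth homotopy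
group. -/
noncomputable def linkMap (u : ℂ) (s t : ℝ) : SphThree :=
  if 1 ≤ ‖u‖ then OnePoint.collapse ballMap (linkW u s, t) else OnePoint.infty

theorem linkW_of_le {u : ℂ} (hu : 1 ≤ ‖u‖) (s : ℝ) : linkW u s = u / ‖u‖ * ⟨‖u‖ - 2, s⟩ := by
  rw [linkW, max_eq_left hu]

theorem norm_linkW {u : ℂ} (hu : 1 ≤ ‖u‖) (s : ℝ) : ‖linkW u s‖ = ‖(⟨‖u‖ - 2, s⟩ : ℂ)‖ := by
  have : ‖u‖ ≠ 0 := by positivity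
  rw [linkW_of_le hu, norm_mul, norm_div, Complex.norm_real, norm_norm, div_self this, one_mul]

theorem linkMap_eq_infty_of_abs_le {u : ℂ} {s t : ℝ} (h : 1 ≤ |‖u‖ - 2| ∨ 1 ≤ |s| ∨ 1 ≤ |t|) :
    linkMap u s t = OnePoint.infty := by
  unfold linkMap
  split_ifs with hu
  · rw [OnePoint.collapse_ballMap_eq_infty_iff, Prod.norm_def, le_max_iff]
    rcases h with h | h | h
    · left; rw [norm_linkW hu]; exact h.trans (Complex.abs_re_le_norm ⟨‖u‖ - 2, s⟩)
    · left; rw [norm_linkW hu]; exact h.trans (Complex.abs_im_le_norm ⟨‖u‖ - 2, s⟩)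
    · right; exact h
  · rfl

theorem linkMap_eq_coe_iff {u : ℂ} {s t : ℝ} {e : ℂ × ℝ} :
    linkMap u s t = e ↔ 1 ≤ ‖u‖ ∧ ballMap e = (linkW u s, t) := by
  unfold linkMap
  split_ifs with hu
  · rw [OnePoint.collapse_eq_coe_iff injective_ballMap]; simp [hu]
  · simp [hu]

theorem Continuous.linkMap {T : Type*} [TopologicalSpace T] {u : T → ℂ} {s t : T → ℝ}
    (hu : Continuous u) (hs : Continuous s) (ht : Continuous t) :
    Continuous fun x => linkMap (u x) (s x) (t x) := by
  have hw : Continuous fun x => linkW (u x) (s x) := by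
    unfold linkW
    refine Continuous.mul (hu.div (by fun_prop) fun x => ?_)
      (continuous_complex_mk (by fun_prop) hs)
    have : (1 : ℝ) ≤ max ‖u x‖ 1 := le_max_right _ _
    exact_mod_cast (by positivity : (max ‖u x‖ 1 : ℝ) ≠ 0)
  refine Continuous.if_le (OnePoint.continuous_collapse_ballMap.comp (hw.prodMk ht))
    continuous_const continuous_const hu.norm fun x hx => ?_
  rw [OnePoint.collapse_ballMap_eq_infty_iff, Prod.norm_def, le_max_iff]
  left
  rw [norm_linkW hx.le]
  refine le_trans ?_ (Complex.abs_re_le_norm _)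
  rw [← hx]; norm_num

theorem pairMap_linkMap {α : ℂ} (hα : ‖α‖ = 2) (u : ℂ) (s t t' : ℝ) :
    pairMap α (linkMap u s t) (linkMap u s t') = OnePoint.infty := by
  unfold linkMap
  split_ifs
  · exact pairMap_collapse hα _ _ _
  · exact pairMap_infty_left _ _

theorem linkW_sub {u : ℂ} (hu : 1 ≤ ‖u‖) (s s' : ℝ) :
    linkW u s - linkW u s' = u / ‖u‖ * ((s - s' : ℝ) * Complex.I) := by
  rw [linkW_of_le hu, linkW_of_le hu, ← mul_sub]
  congr 1
  apply Complex.ext <;> simp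

theorem linkW_inj {u u' : ℂ} {s c s' c' : ℝ} (hu : 1 ≤ ‖u‖) (hu' : 1 ≤ ‖u'‖) (hc : 0 < c)
    (hc' : 0 < c') (h : linkW u s = linkW u' s') (h' : linkW u (s - c) = linkW u' (s' - c')) :
    u = u' ∧ s = s' ∧ c = c' := by
  have n0 : (‖u‖ : ℂ) ≠ 0 := by exact_mod_cast (by positivity : ‖u‖ ≠ 0)
  have n0' : (‖u'‖ : ℂ) ≠ 0 := by exact_mod_cast (by positivity : ‖u'‖ ≠ 0)
  have n1 : u / ‖u‖ ≠ 0 := div_ne_zero (by rintro rfl; simp at n0) n0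
  have h1 : linkW u s - linkW u (s - c) = linkW u' s' - linkW u' (s' - c') := by rw [h, h']
  rw [linkW_sub hu, linkW_sub hu', sub_sub_cancel, sub_sub_cancel] at h1
  have h2 := congrArg norm h1
  simp only [norm_mul, norm_div, Complex.norm_real, norm_norm, Complex.norm_I, mul_one,
    div_self (by positivity : ‖u‖ ≠ 0), div_self (by positivity : ‖u'‖ ≠ 0), one_mul,
    Real.norm_of_nonneg hc.le, Real.norm_of_nonneg hc'.le] at h2
  subst h2
  have h3 : u / ‖u‖ = u' / ‖u'‖ := mul_right_cancel₀
    (mul_ne_zero (by exact_mod_cast hc.ne') Complex.I_ne_zero) h1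
  rw [linkW_of_le hu, linkW_of_le hu', ← h3] at h
  have h4 := mul_left_cancel₀ n1 h
  have h5 : ‖u‖ = ‖u'‖ := by have := congrArg Complex.re h4; simpa using this
  refine ⟨?_, by simpa using congrArg Complex.im h4, rfl⟩
  rw [h5] at h3
  exact (div_left_inj' n0').1 h3

theorem exists_linkW {a b : ℂ} (hab : a ≠ b) (ha : ‖a‖ < 1) (hb : ‖b‖ < 1) :
    ∃ (u : ℂ) (s c : ℝ), 1 ≤ ‖u‖ ∧ ‖u‖ < 3 ∧ 0 < c ∧ c < 2 ∧ |s| < 1 ∧ |s - c| < 1 ∧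
      linkW u (s - c) = a ∧ linkW u s = b := by
  set c := ‖b - a‖ with hcdef
  have hc : 0 < c := norm_pos_iff.2 (sub_ne_zero.2 hab.symm)
  have hcC : (c : ℂ) ≠ 0 := by exact_mod_cast hc.ne'
  have hc2 : c < 2 := by linarith [norm_sub_le b a]
  set ω : ℂ := (b - a) / (c * Complex.I) with hω
  have hω1 : ‖ω‖ = 1 := by
    rw [hω, norm_div, norm_mul, Complex.norm_I, mul_one, Complex.norm_real, Real.norm_of_nonneg
      hc.le, ← hcdef, div_self hc.ne']
  have hω0 : ω ≠ 0 := by rw [← norm_ne_zero_iff, hω1]; exact one_ne_zero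
  have hba : b - a = ω * (c * Complex.I) := by
    rw [hω, div_mul_cancel₀ _ (mul_ne_zero hcC Complex.I_ne_zero)]
  set z : ℂ := b / ω with hz
  have hz1 : ‖z‖ < 1 := by rw [hz, norm_div, hω1, div_one]; exact hb
  have hzr := (abs_lt.1 ((Complex.abs_re_le_norm z).trans_lt hz1))
  have hzc : z - c * Complex.I = a / ω := by
    rw [hz, eq_div_iff hω0, sub_mul, div_mul_cancel₀ _ hω0, mul_comm _ ω, ← hba]; ring
  have hu : ‖((2 + z.re : ℝ) : ℂ) * ω‖ = 2 + z.re := by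
    rw [norm_mul, hω1, mul_one, Complex.norm_real, Real.norm_of_nonneg (by linarith)]
  have hu1 : 1 ≤ ‖((2 + z.re : ℝ) : ℂ) * ω‖ := by rw [hu]; linarith
  have hne : ((2 + z.re : ℝ) : ℂ) ≠ 0 := by
    exact_mod_cast (by linarith : (0 : ℝ) < 2 + z.re).ne'
  refine ⟨(2 + z.re : ℝ) * ω, z.im, c, hu1, by rw [hu]; linarith, hc, hc2,
    (Complex.abs_im_le_norm z).trans_lt hz1, ?_, ?_, ?_⟩
  · have : z.im - c = (a / ω).im := by rw [← hzc]; simp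
    rw [this]
    refine (Complex.abs_im_le_norm _).trans_lt ?_
    rwa [norm_div, hω1, div_one]
  · rw [linkW_of_le hu1, hu, mul_div_cancel_left₀ _ hne]
    have : (⟨2 + z.re - 2, z.im - c⟩ : ℂ) = a / ω := by
      rw [← hzc]; apply Complex.ext <;> simp
    rw [this, mul_div_cancel₀ _ hω0]
  · rw [linkW_of_le hu1, hu, mul_div_cancel_left₀ _ hne]
    have : (⟨2 + z.re - 2, z.im⟩ : ℂ) = z := by apply Complex.ext <;> simp
    rw [this, hz, mul_div_cancel₀ _ hω0]

end LinkMap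

section LinkLoop

theorem linkLoop_aux {v : Fin 4 → I} (hv : v ∈ Cube.boundary (Fin 4)) :
    linkMap ⟨8 * v 0 - 4, 8 * v 1 - 4⟩ (2 * v 2 - 1) (2 * v 3 - 1) = OnePoint.infty := by
  obtain ⟨i, hi⟩ := hv
  apply linkMap_eq_infty_of_abs_le
  have key : ∀ r : ℝ, ∀ u : ℂ, (|r| = 4) → |r| ≤ ‖u‖ → 1 ≤ |‖u‖ - 2| := fun r u h h' =>
    le_abs.2 (Or.inl (by linarith))
  fin_cases i
  · left
    refine key (8 * v 0 - 4) _ ?_ (Complex.abs_re_le_norm (⟨8 * v 0 - 4, 8 * v 1 - 4⟩ : ℂ))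
    rcases hi with hi | hi <;> (simp only [Fin.zero_eta] at hi; rw [hi]; norm_num)
  · left
    refine key (8 * v 1 - 4) _ ?_ (Complex.abs_im_le_norm (⟨8 * v 0 - 4, 8 * v 1 - 4⟩ : ℂ))
    rcases hi with hi | hi <;> (simp only [Fin.mk_one] at hi; rw [hi]; norm_num)
  · right; left
    rcases hi with hi | hi <;> (simp only [Fin.reduceFinMk] at hi; rw [hi]; norm_num)
  · right; right
    rcases hi with hi | hi <;> (simp only [Fin.reduceFinMk] at hi; rw [hi]; norm_num)

/-- The loop given by `linkMap`. -/
noncomputable def linkLoop : GenLoop (Fin 4) SphThree OnePoint.infty :=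
  ⟨⟨fun v => linkMap ⟨8 * v 0 - 4, 8 * v 1 - 4⟩ (2 * v 2 - 1) (2 * v 3 - 1),
    Continuous.linkMap (continuous_complex_mk (by fun_prop) (by fun_prop)) (by fun_prop)
      (by fun_prop)⟩, fun _ hv => linkLoop_aux hv⟩

theorem linkLoop_apply (v : Fin 4 → I) :
    linkLoop v = linkMap ⟨8 * v 0 - 4, 8 * v 1 - 4⟩ (2 * v 2 - 1) (2 * v 3 - 1) := rfl

/-- A homotopy of loops from `linkLoop` to the constant loop. -/
structure IsLinkNull (H : I → (Fin 4 → I) → SphThree) : Prop where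
  cont : Continuous fun q : I × (Fin 4 → I) => H q.1 q.2
  zero : ∀ v, H 0 v = linkLoop v
  one : ∀ v, H 1 v = OnePoint.infty
  bd : ∀ s, ∀ v ∈ Cube.boundary (Fin 4), H s v = OnePoint.infty

/-- A family of maps on the six-dimensional cube built from a null homotopy of `linkLoop`. -/
noncomputable def linkPhi (H : I → (Fin 4 → I) → SphThree) (α : ℂ) (l : I) (y : Fin 6 → I) :
    SphSix :=
  pairMap α
    (H (clampI (2 * y 3 - 1)) ![y 0, y 1, clampI (y 2 - l * min (2 * (y 3 : ℝ)) 1), y 4])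
    (H (clampI (2 * y 3 - 1)) ![y 0, y 1, y 2, y 5])

variable {H : I → (Fin 4 → I) → SphThree}

theorem IsLinkNull.comp (hH : IsLinkNull H) {T : Type*} [TopologicalSpace T] {s a b c d : T → I}
    (hs : Continuous s) (ha : Continuous a) (hb : Continuous b) (hc : Continuous c)
    (hd : Continuous d) : Continuous fun x => H (s x) ![a x, b x, c x, d x] := by
  refine hH.cont.comp (f := fun x => (s x, ![a x, b x, c x, d x])) (hs.prodMk ?_)
  refine continuous_pi fun i => ?_
  fin_cases i <;> simpa

theorem IsLinkNull.continuous_linkPhi (hH : IsLinkNull H) {α : ℂ} (hα : ‖α‖ = 2) :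
    Continuous fun q : I × (Fin 6 → I) => linkPhi H α q.1 q.2 :=
  Continuous.pairMap continuous_const (fun _ => hα)
    (hH.comp (by fun_prop) (by fun_prop) (by fun_prop) (by fun_prop) (by fun_prop))
    (hH.comp (by fun_prop) (by fun_prop) (by fun_prop) (by fun_prop) (by fun_prop))

theorem linkPhi_eq_infty_left {α : ℂ} {l : I} {y : Fin 6 → I}
    (h : H (clampI (2 * y 3 - 1)) ![y 0, y 1, clampI (y 2 - l * min (2 * (y 3 : ℝ)) 1), y 4] =
      OnePoint.infty) : linkPhi H α l y = OnePoint.infty := by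
  rw [linkPhi, h, pairMap_infty_left]

theorem linkPhi_eq_infty_right {α : ℂ} {l : I} {y : Fin 6 → I}
    (h : H (clampI (2 * y 3 - 1)) ![y 0, y 1, y 2, y 5] =
      OnePoint.infty) : linkPhi H α l y = OnePoint.infty := by
  rw [linkPhi, h, pairMap_infty_right]

theorem IsLinkNull.linkPhi_boundary (hH : IsLinkNull H) {α : ℂ} (hα : ‖α‖ = 2) (l : I)
    {y : Fin 6 → I} (hy : y ∈ Cube.boundary (Fin 6)) : linkPhi H α l y = OnePoint.infty := by
  obtain ⟨i, hi⟩ := hy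
  fin_cases i
  · exact linkPhi_eq_infty_right (hH.bd _ _ ⟨0, by simpa using hi⟩)
  · exact linkPhi_eq_infty_right (hH.bd _ _ ⟨1, by simpa using hi⟩)
  · exact linkPhi_eq_infty_right (hH.bd _ _ ⟨2, by simpa using hi⟩)
  · rcases hi with hi | hi
    · simp only [Fin.reduceFinMk] at hi
      have e1 : clampI (2 * y 3 - 1) = 0 := clampI_of_le (by rw [hi]; norm_num)
      have e2 : (y 2 : ℝ) - l * min (2 * (y 3 : ℝ)) 1 = y 2 := by rw [hi]; norm_num
      rw [linkPhi, e1, e2, clampI_coe, hH.zero, hH.zero, linkLoop_apply, linkLoop_apply]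
      exact pairMap_linkMap hα _ _ _ _
    · simp only [Fin.reduceFinMk] at hi
      have e1 : clampI (2 * y 3 - 1) = 1 := clampI_of_ge (by rw [hi]; norm_num)
      exact linkPhi_eq_infty_right (by rw [e1, hH.one])
  · exact linkPhi_eq_infty_left (hH.bd _ _ ⟨3, by simpa using hi⟩)
  · exact linkPhi_eq_infty_right (hH.bd _ _ ⟨3, by simpa using hi⟩)

/-- The loops `linkPhi`. -/
noncomputable def IsLinkNull.loop (hH : IsLinkNull H) {α : ℂ} (hα : ‖α‖ = 2) (l : I) :
    GenLoop (Fin 6) SphSix OnePoint.infty :=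
  ⟨⟨linkPhi H α l, (hH.continuous_linkPhi hα).comp (continuous_const.prodMk continuous_id)⟩,
    fun _ hy => hH.linkPhi_boundary hα l hy⟩

theorem IsLinkNull.loop_apply (hH : IsLinkNull H) {α : ℂ} (hα : ‖α‖ = 2) (l : I)
    (y : Fin 6 → I) : hH.loop hα l y = linkPhi H α l y := rfl

theorem IsLinkNull.cls_loop (hH : IsLinkNull H) {α : ℂ} (hα : ‖α‖ = 2) :
    HomotopyGroup.cls (hH.loop hα 0) = HomotopyGroup.cls (hH.loop hα 1) :=
  HomotopyGroup.cls_eq_iff.2 (GenLoop.homotopic_mk (fun l y => linkPhi H α l y)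
    (hH.continuous_linkPhi hα) (fun _ => rfl) (fun _ => rfl)
    fun l _ hy => hH.linkPhi_boundary hα l hy)

theorem IsLinkNull.linkPhi_one_spec (hH : IsLinkNull H) {α : ℂ} {y : Fin 6 → I}
    (h : linkPhi H α 1 y ≠ OnePoint.infty) :
    (y 3 : ℝ) < 1 / 2 ∧ 0 < (y 2 : ℝ) - 2 * y 3 ∧
    linkPhi H α 1 y = pairMap α
      (linkMap ⟨8 * y 0 - 4, 8 * y 1 - 4⟩ ((2 * y 2 - 1) - 4 * y 3) (2 * y 4 - 1))
      (linkMap ⟨8 * y 0 - 4, 8 * y 1 - 4⟩ (2 * y 2 - 1) (2 * y 5 - 1)) := by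
  have hp : 0 < (y 2 : ℝ) - (1 : I) * min (2 * (y 3 : ℝ)) 1 := by
    by_contra hn
    refine h (linkPhi_eq_infty_left (hH.bd _ _ ⟨2, Or.inl ?_⟩))
    exact clampI_of_le (not_lt.1 hn)
  have h3 : (y 3 : ℝ) < 1 / 2 := by
    by_contra hn
    rw [min_eq_right (by linarith)] at hp
    have := (y 2).2.2
    simp only [Set.Icc.coe_one] at hp
    linarith
  rw [min_eq_left (by linarith), Set.Icc.coe_one, one_mul] at hp
  refine ⟨h3, hp, ?_⟩
  have e1 : clampI (2 * y 3 - 1) = 0 := clampI_of_le (by linarith)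
  have e2 : ((clampI ((y 2 : ℝ) - (1 : I) * min (2 * (y 3 : ℝ)) 1) : I) : ℝ) = y 2 - 2 * y 3 := by
    rw [coe_clampI, min_eq_left (a := 2 * (y 3 : ℝ)) (by linarith), Set.Icc.coe_one, one_mul,
      min_eq_right (by linarith [(y 2).2.2, (y 3).2.1]), max_eq_right hp.le]
  rw [linkPhi, e1, hH.zero, hH.zero, linkLoop_apply, linkLoop_apply]
  simp only [Matrix.cons_val, e2]
  congr 2
  ring

theorem IsLinkNull.linkPhi_one_injOn (hH : IsLinkNull H) {α : ℂ} (hα : ‖α‖ = 2)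
    {y y' : Fin 6 → I} (h : linkPhi H α 1 y ≠ OnePoint.infty)
    (hyy : linkPhi H α 1 y = linkPhi H α 1 y') : y = y' := by
  obtain ⟨-, -, h1⟩ := hH.linkPhi_one_spec h
  obtain ⟨-, -, h1'⟩ := hH.linkPhi_one_spec (hyy ▸ h)
  have pos : ∀ y : Fin 6 → I, linkPhi H α 1 y ≠ OnePoint.infty → (0 : ℝ) < 4 * y 3 := by
    intro y h
    have : y 3 ≠ 0 := fun h' => h (hH.linkPhi_boundary hα 1 ⟨3, Or.inl h'⟩)
    have : (y 3 : ℝ) ≠ 0 := fun h' => this (Subtype.ext h')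
    have := lt_of_le_of_ne (y 3).2.1 this.symm
    linarith
  obtain ⟨e, he⟩ := OnePoint.ne_infty_iff_exists.1 h
  obtain ⟨a, b⟩ := pairMap_eq_coe_iff.1 (h1.symm.trans he.symm)
  obtain ⟨a', b'⟩ := pairMap_eq_coe_iff.1 (h1'.symm.trans (hyy.symm.trans he.symm))
  obtain ⟨hu, a⟩ := linkMap_eq_coe_iff.1 a
  obtain ⟨-, b⟩ := linkMap_eq_coe_iff.1 b
  obtain ⟨hu', a'⟩ := linkMap_eq_coe_iff.1 a'
  obtain ⟨-, b'⟩ := linkMap_eq_coe_iff.1 b'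
  obtain ⟨a1, a2⟩ := Prod.mk.inj (a.symm.trans a')
  obtain ⟨b1, b2⟩ := Prod.mk.inj (b.symm.trans b')
  obtain ⟨c1, c2, c3⟩ := linkW_inj hu hu' (pos y h) (pos y' (hyy ▸ h)) b1 a1
  have d0 := congrArg Complex.re c1
  have d1 := congrArg Complex.im c1
  simp only at d0 d1
  ext i
  fin_cases i <;> simp only [Fin.zero_eta, Fin.mk_one, Fin.reduceFinMk] <;> linarith

theorem IsLinkNull.linkPhi_one_surj (hH : IsLinkNull H) (z : SphSix) :
    ∃ y, linkPhi H 2 1 y = z := by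
  induction z using OnePoint.rec with
  | infty => exact ⟨0, hH.linkPhi_boundary (by simp) 1 ⟨0, Or.inl rfl⟩⟩
  | coe e =>
  obtain ⟨P, Q⟩ := e
  set eA : ℂ × ℝ := (2, 0) + ballMap P with heA
  set eB : ℂ × ℝ := (-2, 0) + ballMap Q with heB
  have rA : 0 < (ballMap eA).1.re := by
    obtain ⟨k, hk, h⟩ := ballMap_eq_smul eA
    have := (Complex.abs_re_le_norm _).trans_lt
      ((norm_fst_le (ballMap P)).trans_lt (norm_ballMap_lt P))
    rw [h, heA]
    simp only [Prod.smul_fst, Prod.fst_add, Complex.real_smul, Complex.re_ofReal_mul,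
      Complex.add_re, Complex.re_ofNat]
    exact mul_pos hk (by linarith [(abs_lt.1 this).1])
  have rB : (ballMap eB).1.re < 0 := by
    obtain ⟨k, hk, h⟩ := ballMap_eq_smul eB
    have := (Complex.abs_re_le_norm _).trans_lt
      ((norm_fst_le (ballMap Q)).trans_lt (norm_ballMap_lt Q))
    rw [h, heB]
    simp only [Prod.smul_fst, Prod.fst_add, Complex.real_smul, Complex.re_ofReal_mul,
      Complex.add_re, Complex.neg_re, Complex.re_ofNat]
    exact mul_neg_of_pos_of_neg hk (by linarith [(abs_lt.1 this).2])
  obtain ⟨u, s, c, hu, hu3, hc, hc2, hs, hsc, ha, hb⟩ := exists_linkW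
    (a := (ballMap eA).1) (b := (ballMap eB).1) (fun h => by rw [h] at rA; linarith)
    ((norm_fst_le _).trans_lt (norm_ballMap_lt _)) ((norm_fst_le _).trans_lt (norm_ballMap_lt _))
  have tA := abs_lt.1 ((norm_snd_le _).trans_lt (norm_ballMap_lt eA))
  have tB := abs_lt.1 ((norm_snd_le _).trans_lt (norm_ballMap_lt eB))
  have ur := abs_lt.1 ((Complex.abs_re_le_norm _).trans_lt hu3)
  have ui := abs_lt.1 ((Complex.abs_im_le_norm _).trans_lt hu3)
  rw [abs_lt] at hs hsc
  have hI : ∀ r : ℝ, 0 ≤ r → r ≤ 1 → ∃ x : I, (x : ℝ) = r := fun r h h' => ⟨⟨r, h, h'⟩, rfl⟩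
  obtain ⟨y0, h0⟩ := hI ((u.re + 4) / 8) (by linarith) (by linarith)
  obtain ⟨y1, h1⟩ := hI ((u.im + 4) / 8) (by linarith) (by linarith)
  obtain ⟨y2, h2⟩ := hI ((s + 1) / 2) (by linarith) (by linarith)
  obtain ⟨p, hp⟩ := hI ((s - c + 1) / 2) (by linarith) (by linarith)
  obtain ⟨y3, h3⟩ := hI (c / 4) (by linarith) (by linarith)
  obtain ⟨y4, h4⟩ := hI (((ballMap eA).2 + 1) / 2) (by linarith) (by linarith)
  obtain ⟨y5, h5⟩ := hI (((ballMap eB).2 + 1) / 2) (by linarith) (by linarith)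
  refine ⟨![y0, y1, y2, y3, y4, y5], ?_⟩
  have e1 : clampI (2 * y3 - 1) = 0 := clampI_of_le (by linarith)
  have e2 : (y2 : ℝ) - (1 : I) * min (2 * (y3 : ℝ)) 1 = p := by
    rw [min_eq_left (by linarith), Set.Icc.coe_one]; linarith
  rw [linkPhi]
  simp only [Matrix.cons_val]
  rw [e1, e2, clampI_coe, hH.zero, hH.zero, linkLoop_apply, linkLoop_apply, pairMap_eq_coe_iff,
    linkMap_eq_coe_iff, linkMap_eq_coe_iff]
  simp only [Matrix.cons_val, h0, h1, h2, hp, h4, h5]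
  have eu : (⟨8 * ((u.re + 4) / 8) - 4, 8 * ((u.im + 4) / 8) - 4⟩ : ℂ) = u := by
    apply Complex.ext <;> simp only <;> ring
  have f1 : 2 * ((s - c + 1) / 2) - 1 = s - c := by ring
  have f2 : 2 * ((s + 1) / 2) - 1 = s := by ring
  have f3 : ∀ r : ℝ, 2 * ((r + 1) / 2) - 1 = r := fun r => by ring
  rw [eu, f3, f3, f3, f3, ha, hb]
  exact ⟨⟨hu, rfl⟩, hu, rfl⟩

end LinkLoop

section MinMax

variable {N X : Type*} [DecidableEq N] [TopologicalSpace X] {x : X}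

/-- Precompose a loop that is trivial on a diagonal with the retraction onto one side of it. -/
def GenLoop.below (φ : GenLoop N X x) (i j : N) (hij : i ≠ j)
    (hφ : ∀ y, y i = y j → φ y = x) : GenLoop N X x :=
  ⟨⟨fun y => φ (Function.update y i (min (y i) (y j))),
    (GenLoop.continuous φ).comp (continuous_id.update i (by fun_prop))⟩, fun y ⟨k, hk⟩ => by
    by_cases hki : k = i
    · subst hki
      rcases hk with hk | hk
      · exact GenLoop.boundary φ _ ⟨k, Or.inl (by simp [hk])⟩
      · exact hφ _ (by
          rw [Function.update_self, Function.update_of_ne hij.symm, hk]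
          exact min_eq_right unitInterval.le_one')
    · exact GenLoop.boundary φ _ ⟨k, by rwa [Function.update_of_ne hki]⟩⟩

/-- Precompose a loop that is trivial on a diagonal with the retraction onto the other side. -/
def GenLoop.above (φ : GenLoop N X x) (i j : N) (hij : i ≠ j)
    (hφ : ∀ y, y i = y j → φ y = x) : GenLoop N X x :=
  ⟨⟨fun y => φ (Function.update y i (max (y i) (y j))),
    (GenLoop.continuous φ).comp (continuous_id.update i (by fun_prop))⟩, fun y ⟨k, hk⟩ => by
    by_cases hki : k = i
    · subst hki
      rcases hk with hk | hk
      · exact hφ _ (by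
          rw [Function.update_self, Function.update_of_ne hij.symm, hk]
          exact max_eq_right unitInterval.nonneg')
      · exact GenLoop.boundary φ _ ⟨k, Or.inr (by
          rw [Function.update_self, hk]; exact max_eq_left unitInterval.le_one')⟩
    · exact GenLoop.boundary φ _ ⟨k, by rwa [Function.update_of_ne hki]⟩⟩

theorem GenLoop.below_apply (φ : GenLoop N X x) {i j : N} (hij : i ≠ j)
    (hφ : ∀ y, y i = y j → φ y = x) (y : N → I) :
    GenLoop.below φ i j hij hφ y = φ (Function.update y i (min (y i) (y j))) := rfl

theorem GenLoop.above_apply (φ : GenLoop N X x) {i j : N} (hij : i ≠ j)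
    (hφ : ∀ y, y i = y j → φ y = x) (y : N → I) :
    GenLoop.above φ i j hij hφ y = φ (Function.update y i (max (y i) (y j))) := rfl

theorem HomotopyGroup.cls_eq_above_mul_below [Nonempty N] (φ : GenLoop N X x) {i j : N}
    (hij : i ≠ j) (hφ : ∀ y, y i = y j → φ y = x) :
    HomotopyGroup.cls φ =
      HomotopyGroup.cls (GenLoop.above φ i j hij hφ) *
        HomotopyGroup.cls (GenLoop.below φ i j hij hφ) := by
  rw [← HomotopyGroup.cls_transAt i, HomotopyGroup.cls_eq_iff]
  refine GenLoop.homotopic_mk (fun s y => φ (Function.update y i (clampI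
    (max (min ((1 + s) * y i) (y j)) ((1 + s) * y i - s))))) ?_ ?_ ?_ ?_
  · exact (GenLoop.continuous φ).comp (continuous_snd.update i (by fun_prop))
  · intro y
    have : max (min ((1 + ((0 : I) : ℝ)) * y i) (y j : ℝ)) ((1 + ((0 : I) : ℝ)) * y i - (0 : I))
        = y i := by
      simp
    rw [this, clampI_coe, Function.update_eq_self]
  · intro y
    rw [GenLoop.transAt_apply]
    have b1 := (y i).2
    have b2 := (y j).2
    split_ifs with h
    · rw [GenLoop.below_apply, Function.update_idem, Function.update_self,
        Function.update_of_ne hij.symm]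
      congr 2
      have hm : (min (Set.projIcc 0 1 zero_le_one (2 * (y i : ℝ))) (y j) : I) =
        clampI (min (2 * (y i : ℝ)) (y j)) := by
        conv_lhs => rw [← clampI_coe (y j)]
        exact (Set.monotone_projIcc (zero_le_one (α := ℝ))).map_min.symm
      rw [hm]
      congr 2
      rw [max_eq_left, Set.Icc.coe_one]
      · norm_num
      · rw [Set.Icc.coe_one, le_min_iff]
        constructor <;> linarith [b1.1, b2.1]
    · rw [GenLoop.above_apply, Function.update_idem, Function.update_self,
        Function.update_of_ne hij.symm]
      congr 2
      have hm : (max (Set.projIcc 0 1 zero_le_one (2 * (y i : ℝ) - 1)) (y j) : I) =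
        clampI (max (2 * (y i : ℝ) - 1) (y j)) := by
        conv_lhs => rw [← clampI_coe (y j)]
        exact (Set.monotone_projIcc (zero_le_one (α := ℝ))).map_max.symm
      rw [hm]
      congr 1
      rw [Set.Icc.coe_one, min_eq_right (by linarith [b2.2]), max_comm]
      norm_num
  · rintro s y ⟨k, hk⟩
    by_cases hki : k = i
    · subst hki
      refine GenLoop.boundary φ _ ⟨k, ?_⟩
      rw [Function.update_self]
      rcases hk with hk | hk
      · left
        refine clampI_of_le ?_
        rw [hk]
        simp [s.2.1]
      · right
        refine clampI_of_ge (le_max_of_le_right ?_)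
        rw [hk]
        simp
    · exact GenLoop.boundary φ _ ⟨k, by rwa [Function.update_of_ne hki]⟩

end MinMax

section Square

variable {H : I → (Fin 4 → I) → SphThree}

theorem linkPhi_zero (α : ℂ) (y : Fin 6 → I) :
    linkPhi H α 0 y = pairMap α (H (clampI (2 * y 3 - 1)) ![y 0, y 1, y 2, y 4])
      (H (clampI (2 * y 3 - 1)) ![y 0, y 1, y 2, y 5]) := by
  simp [linkPhi, clampI_coe]

theorem linkPhi_diag {α : ℂ} (hα : ‖α‖ = 2) {y : Fin 6 → I} (h : y 4 = y 5) :
    linkPhi H α 0 y = OnePoint.infty := by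
  rw [linkPhi_zero, h, pairMap_self hα]

theorem IsLinkNull.loop_diag (hH : IsLinkNull H) {α : ℂ} (hα : ‖α‖ = 2) (y : Fin 6 → I)
    (h : y 4 = y 5) : hH.loop hα 0 y = OnePoint.infty :=
  linkPhi_diag hα h

/-- The automorphism of the sixth homotopy group induced by exchanging factors in both the source
and the target. -/
noncomputable def swapHom : HomotopyGroup (Fin 6) SphSix OnePoint.infty →*
    HomotopyGroup (Fin 6) SphSix OnePoint.infty :=
  (HomotopyGroup.map (x := OnePoint.infty) (y := OnePoint.infty) ⟨swapSix, swapSix.continuous⟩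
    swapSix_infty).comp (HomotopyGroup.reindex (Equiv.swap 4 5))

theorem swapHom_cls {f g : GenLoop (Fin 6) SphSix OnePoint.infty}
    (h : ∀ y, g y = swapSix (f fun n => y (Equiv.swap 4 5 n))) :
    swapHom (HomotopyGroup.cls f) = HomotopyGroup.cls g := by
  let f' : GenLoop (Fin 6) SphSix OnePoint.infty :=
    ⟨⟨fun y => f fun n => y (Equiv.swap 4 5 n), (GenLoop.continuous f).comp (by fun_prop)⟩,
      fun y ⟨i, hi⟩ => GenLoop.boundary f _ ⟨Equiv.swap 4 5 i, by simpa using hi⟩⟩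
  rw [swapHom, MonoidHom.comp_apply, HomotopyGroup.reindex_cls _ f f' (fun y => rfl),
    HomotopyGroup.map_cls]
  congr 1
  exact GenLoop.ext _ _ fun y => (h y).symm

theorem swapHom_surjective : Function.Surjective swapHom := by
  intro a
  obtain ⟨g, rfl⟩ := HomotopyGroup.cls_surj a
  refine ⟨HomotopyGroup.cls ⟨⟨fun y => swapSix (g fun n => y (Equiv.swap 4 5 n)),
    swapSix.continuous.comp ((GenLoop.continuous g).comp (by fun_prop))⟩, fun y ⟨i, hi⟩ => ?_⟩, ?_⟩
  · change swapSix (g _) = _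
    rw [GenLoop.boundary g _ ⟨Equiv.swap 4 5 i, by simpa using hi⟩, swapSix_infty]
  · refine swapHom_cls fun y => ?_
    change _ = swapSix (swapSix (g _))
    rw [swapSix_swapSix]
    simp

theorem IsLinkNull.cls_below_neg (hH : IsLinkNull H) {α : ℂ} (hα : ‖α‖ = 2)
    (hα' : ‖-α‖ = 2) :
    HomotopyGroup.cls (GenLoop.below (hH.loop hα 0) 4 5 (by decide) (hH.loop_diag hα)) =
    HomotopyGroup.cls (GenLoop.below (hH.loop hα' 0) 4 5 (by decide) (hH.loop_diag hα')) := by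
  have hn : ∀ s : I, ‖α * Complex.exp ((Real.pi * s : ℝ) * Complex.I)‖ = 2 := fun s => by
    rw [norm_mul, Complex.norm_exp_ofReal_mul_I, hα, mul_one]
  refine HomotopyGroup.cls_eq_iff.2 (GenLoop.homotopic_mk (fun s y =>
    GenLoop.below (hH.loop (hn s) 0) 4 5 (by decide) (hH.loop_diag (hn s)) y) ?_ ?_ ?_ ?_)
  · simp only [GenLoop.below_apply, IsLinkNull.loop_apply, linkPhi_zero]
    have hu : Continuous fun q : I × (Fin 6 → I) =>
      Function.update q.2 4 (min (q.2 4) (q.2 5)) := continuous_snd.update 4 (by fun_prop)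
    have hc := fun i => (continuous_apply i).comp hu
    have hc3 : Continuous fun q : I × (Fin 6 → I) =>
        ((Function.update q.2 4 (min (q.2 4) (q.2 5)) 3 : I) : ℝ) :=
      continuous_subtype_val.comp (hc 3)
    exact Continuous.pairMap (by fun_prop) (fun q => hn q.1)
      (hH.comp (by fun_prop) (hc 0) (hc 1) (hc 2) (hc 4))
      (hH.comp (by fun_prop) (hc 0) (hc 1) (hc 2) (hc 5))
  · intro y
    simp only [GenLoop.below_apply, IsLinkNull.loop_apply]
    simp
  · intro y
    simp only [GenLoop.below_apply, IsLinkNull.loop_apply]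
    simp
  · exact fun s y hy => GenLoop.boundary _ y hy

theorem IsLinkNull.cls_above (hH : IsLinkNull H) {α : ℂ} (hα : ‖α‖ = 2) :
    HomotopyGroup.cls (GenLoop.above (hH.loop hα 0) 4 5 (by decide) (hH.loop_diag hα)) =
    swapHom (HomotopyGroup.cls
      (GenLoop.below (hH.loop hα 0) 4 5 (by decide) (hH.loop_diag hα))) := by
  have hα' : ‖-α‖ = 2 := by rwa [norm_neg]
  rw [hH.cls_below_neg hα hα', eq_comm]
  refine swapHom_cls fun y => ?_
  rw [GenLoop.below_apply, GenLoop.above_apply, hH.loop_apply, hH.loop_apply, linkPhi_zero,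
    linkPhi_zero, swapSix_pairMap, neg_neg]
  have e4 : Equiv.swap (4 : Fin 6) 5 4 = 5 := by decide
  have e5 : Equiv.swap (4 : Fin 6) 5 5 = 4 := by decide
  have e0 : Equiv.swap (4 : Fin 6) 5 0 = 0 := by decide
  have e1 : Equiv.swap (4 : Fin 6) 5 1 = 1 := by decide
  have e2 : Equiv.swap (4 : Fin 6) 5 2 = 2 := by decide
  have e3 : Equiv.swap (4 : Fin 6) 5 3 = 3 := by decide
  simp only [Function.update_self, ne_eq, Fin.reduceEq, not_false_eq_true, Function.update_of_ne,
    e0, e1, e2, e3, e4, e5]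
  rcases le_total (y 4) (y 5) with h | h
  · rw [max_eq_right h, min_eq_right h, pairMap_self hα, pairMap_self hα]
  · rw [max_eq_left h, min_eq_left h]

theorem IsLinkNull.isSquare_cls_loop [IsCyclic (HomotopyGroup (Fin 6) SphSix OnePoint.infty)]
    (hH : IsLinkNull H) {α : ℂ} (hα : ‖α‖ = 2) (l : I) (hl : l = 1) :
    IsSquare (HomotopyGroup.cls (hH.loop hα l)) := by
  subst hl
  rw [← hH.cls_loop, HomotopyGroup.cls_eq_above_mul_below (i := 4) (j := 5) _ (by decide)
    (hH.loop_diag hα), hH.cls_above]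
  obtain ⟨m, hm⟩ := swapHom.map_cyclic
  rcases Int.even_or_odd' m with ⟨k, rfl | rfl⟩
  · refine (?_ : ∀ a : HomotopyGroup (Fin 6) SphSix OnePoint.infty, IsSquare a) _
    intro a
    obtain ⟨b, rfl⟩ := swapHom_surjective a
    exact ⟨b ^ k, by rw [hm, ← zpow_add, two_mul]⟩
  · rw [hm, zpow_add_one, mul_assoc, ← zpow_two, ← zpow_add]
    exact ⟨_ ^ (k + 1), by rw [← zpow_add]; congr 1; ring⟩

end Square

section Generate

variable {N X Y : Type*} [Fintype N] [DecidableEq N] [TopologicalSpace X] [TopologicalSpace Y]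
  [T2Space Y] {x : X} {y : Y}

theorem Cube.le_of_ball_subset {y₀ : N → I} {ε : ℝ} (hε : 0 < ε)
    (h : ∀ a ∈ Cube.boundary N, ε ≤ dist a y₀) (i : N) :
    ε ≤ y₀ i ∧ ε ≤ 1 - (y₀ i : ℝ) := by
  have key : ∀ b : I, b = 0 ∨ b = 1 → ε ≤ dist b (y₀ i) := by
    intro b hb
    by_contra hlt
    refine absurd (h (Function.update y₀ i b) ⟨i, by simpa using hb⟩) (not_le.2 ?_)
    rw [dist_pi_lt_iff hε]
    intro j
    by_cases hj : j = i
    · subst hj; simpa using hlt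
    · rw [Function.update_of_ne hj, dist_self]; exact hε
  have k0 := key 0 (Or.inl rfl)
  have k1 := key 1 (Or.inr rfl)
  rw [Subtype.dist_eq, Real.dist_eq] at k0 k1
  have b := (y₀ i).2
  constructor
  · rwa [Set.Icc.coe_zero, zero_sub, abs_neg, abs_of_nonneg b.1] at k0
  · rwa [Set.Icc.coe_one, abs_of_nonneg (by linarith [b.2])] at k1

theorem HomotopyGroup.exists_map_cls_eq [Nonempty N] (φ : GenLoop N Y y)
    (hs : Function.Surjective φ)
    (hi : ∀ a b, φ a ≠ y → φ a = φ b → a = b) (hy : ∃ z, z ≠ y) (ψ : GenLoop N X x) :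
    ∃ (h : C(Y, X)) (hx : h y = x), HomotopyGroup.map h hx (HomotopyGroup.cls φ) =
      HomotopyGroup.cls ψ := by
  obtain ⟨z, hz⟩ := hy
  obtain ⟨y₀, rfl⟩ := hs z
  have ho : IsOpen {a | φ a ≠ y} := isOpen_ne_fun (GenLoop.continuous φ) continuous_const
  obtain ⟨ε, hε, hball⟩ := Metric.isOpen_iff.1 ho y₀ hz
  have hfar : ∀ a, φ a = y → ε ≤ dist a y₀ := fun a ha => by
    by_contra hlt
    exact hball (not_le.1 hlt) ha
  have hb := Cube.le_of_ball_subset hε fun a ha => hfar a (GenLoop.boundary φ a ha)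
  have hc : Continuous fun (q : I × (N → I)) (i : N) => clampI
      ((1 - q.1) * q.2 i + q.1 * (((q.2 i : ℝ) - y₀ i) / ε + 1 / 2)) := by fun_prop
  have hc1 : Continuous fun (a : N → I) (i : N) => clampI (((a i : ℝ) - y₀ i) / ε + 1 / 2) := by
    fun_prop
  let χ : C(N → I, X) := ⟨fun a => ψ fun i => clampI (((a i : ℝ) - y₀ i) / ε + 1 / 2),
    (GenLoop.continuous ψ).comp hc1⟩
  have hχ : ∀ a, φ a = y → χ a = x := by
    intro a ha
    have h1 := hfar a ha
    obtain ⟨i, hi⟩ : ∃ i, ε ≤ dist (a i) (y₀ i) := by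
      by_contra hn
      push Not at hn
      exact absurd ((dist_pi_lt_iff hε).2 hn) (not_lt.2 h1)
    rw [Subtype.dist_eq, Real.dist_eq, le_abs] at hi
    refine GenLoop.boundary ψ _ ⟨i, ?_⟩
    rcases hi with hi | hi
    · right
      have := (one_le_div hε).2 hi
      exact clampI_of_ge (by linarith)
    · left
      have := (one_le_div hε).2 hi
      rw [neg_div] at this
      exact clampI_of_le (by linarith)
  have hq : IsQuotientMap φ :=
    (GenLoop.continuous φ).isClosedMap.isQuotientMap (GenLoop.continuous φ) hs
  have hfac : ∀ a b, φ a = φ b → χ a = χ b := by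
    intro a b hab
    by_cases ha : φ a = y
    · rw [hχ a ha, hχ b (hab ▸ ha)]
    · rw [hi a b ha hab]
  let φc : C(N → I, Y) := ⟨φ, GenLoop.continuous φ⟩
  have hq' : IsQuotientMap φc := hq
  let h : C(Y, X) := hq'.lift χ hfac
  have hh : ∀ a, h (φ a) = χ a := fun a => congrArg (fun f : C(N → I, X) => f a)
    (hq'.lift_comp χ hfac)
  have hx : h y = x := by
    have h0 : (0 : N → I) ∈ Cube.boundary N := ⟨Classical.arbitrary N, Or.inl rfl⟩
    rw [← GenLoop.boundary φ 0 h0, hh, hχ _ (GenLoop.boundary φ 0 h0)]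
  refine ⟨h, hx, ?_⟩
  rw [HomotopyGroup.map_cls, eq_comm, HomotopyGroup.cls_eq_iff]
  refine GenLoop.homotopic_mk (fun s a => ψ fun i => clampI
    ((1 - s) * a i + s * (((a i : ℝ) - y₀ i) / ε + 1 / 2))) ((GenLoop.continuous ψ).comp hc)
    ?_ ?_ ?_
  · intro a; simp [clampI_coe]
  · intro a
    rw [GenLoop.map_apply, hh]
    simp [χ]
  · rintro s a ⟨i, hi⟩
    refine GenLoop.boundary ψ _ ⟨i, ?_⟩
    have s0 := s.2.1
    have s1 := s.2.2
    rcases hi with hi | hi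
    · left
      apply clampI_of_le
      have := (one_le_div hε).2 (hb i).1
      rw [hi, Set.Icc.coe_zero, zero_sub, neg_div]
      nlinarith
    · right
      apply clampI_of_ge
      have := (one_le_div hε).2 (hb i).2
      rw [hi, Set.Icc.coe_one]
      nlinarith

end Generate

theorem nontrivial_pi_four_sphThree :
    Nontrivial (HomotopyGroup (Fin 4) SphThree OnePoint.infty) := by
  by_contra hn
  rw [not_nontrivial_iff_subsingleton] at hn
  obtain ⟨e⟩ := OnePoint.nonempty_mulEquiv_punct (N := Fin 6) (V := (ℂ × ℝ) × (ℂ × ℝ))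
    (W := ℝ × ℝ × ℝ × ℝ × ℝ × ℂ) (by simp) oneSeven
  have hcyc := isCyclic_pi_six
  have : IsCyclic (HomotopyGroup (Fin 6) SphSix OnePoint.infty) :=
    isCyclic_of_surjective e.symm e.symm.surjective
  obtain ⟨H, hH, h0, h1, hb⟩ := (HomotopyGroup.cls_eq_one_iff.1
    (Subsingleton.elim (HomotopyGroup.cls linkLoop) 1)).exists_homotopy
  have hL : IsLinkNull H := ⟨hH, h0, h1, hb⟩
  have h2 : ‖(2 : ℂ)‖ = 2 := by simp
  refine not_forall_isSquare_pi_six fun a => ?_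
  obtain ⟨ψ, hψ⟩ := HomotopyGroup.cls_surj (e.symm a)
  obtain ⟨h, hx, hm⟩ := HomotopyGroup.exists_map_cls_eq (hL.loop h2 1)
    (fun z => hL.linkPhi_one_surj z) (fun a b => hL.linkPhi_one_injOn h2)
    ⟨((0 : (ℂ × ℝ) × (ℂ × ℝ)) : SphSix), OnePoint.coe_ne_infty _⟩ ψ
  have := ((hL.isSquare_cls_loop h2 1 rfl).map (HomotopyGroup.map h hx)).map e
  rwa [hm, hψ, e.apply_symm_apply] at this

theorem nonempty_mulEquiv_zmod_two {G : Type*} [Group G] [IsCyclic G] [Nontrivial G]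
    (h : ∀ a : G, a * a = 1) : Nonempty (G ≃* Multiplicative (ZMod 2)) := by
  have hcard : Nat.card G = 2 := by
    rw [← IsCyclic.exponent_eq_card]
    have hd : Monoid.exponent G ∣ 2 :=
      Monoid.exponent_dvd_of_forall_pow_eq_one fun a => by rw [pow_two, h]
    refine ((Nat.dvd_prime Nat.prime_two).1 hd).resolve_left fun h1 => ?_
    exact not_subsingleton G (Monoid.exp_eq_one_iff.1 h1)
  have e : Multiplicative (ZMod (Nat.card G)) ≃* G := zmodCyclicMulEquiv inferInstance
  rw [hcard] at e
  exact ⟨e.symm⟩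

theorem nonempty_pi_four_sphere_mulEquiv (p : Sph) :
    Nonempty (HomotopyGroup (Fin 4) Sph p ≃* Multiplicative (ZMod 2)) := by
  have hp : (p : EuclideanSpace ℝ (Fin 3)) ≠ 0 := fun h => by simpa [h] using p.2
  obtain ⟨e₁⟩ := Punct.nonempty_mulEquiv_sphere (N := Fin 4) p ⟨p, hp⟩ rfl
  obtain ⟨e₂⟩ := Punct.nonempty_mulEquiv (N := Fin 4) (W := ℝ × ℂ) (by simp) ⟨_, hp⟩
    (Punct.incl oneC)
  obtain ⟨w⟩ : Nonempty (Punct (ℝ × ℝ × ℂ)) := ⟨⟨(1, 0, 0), by simp⟩⟩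
  obtain ⟨e₃⟩ := nonempty_hopf_mulEquiv (m := 3) (by norm_num) w
  obtain ⟨e₄⟩ := OnePoint.nonempty_mulEquiv_punct (N := Fin 4) (V := ℂ × ℝ) (by simp) w
  have := nontrivial_pi_four_sphThree
  have := e₄.symm.toEquiv.nontrivial
  have := isCyclic_pi_four w
  obtain ⟨e₅⟩ := nonempty_mulEquiv_zmod_two (mul_self_pi_four w)
  exact ⟨e₁.trans (e₂.trans (e₃.trans e₅))⟩

/-- The fourth homotopy group `π₄(S² × S², (p,p))` is isomorphic, as a group,
to `ZMod 2 × ZMod 2`. -/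
theorem pi4_of_S2_times_S2 (p : Sph) :
    Nonempty ((π_ 4) Xt (p, p) ≃* Multiplicative (ZMod 2 × ZMod 2)) := by
  obtain ⟨e⟩ := nonempty_pi_four_sphere_mulEquiv p
  exact ⟨HomotopyGroup.prodEquiv.trans
    ((e.prodCongr e).trans (MulEquiv.prodMultiplicative _ _).symm)⟩
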